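/- Let q be a prime power, F a finite field with q^2 elements, 1 < d ≤ q, and G ∈ F[x_0,...,x_4] a nonzero homogeneous polynomial of degree d such that no plane of ℙ^4(F) is contained in V(G)(F). If for every plane Π of ℙ^4(F) at most one generator of V_3 is contained in Π ∩ V(G)(F), then |V(G)(F) ∩ V_3| ≤ (d−1)q^5 + (d−1)q^3 + q^2 + (d−1)q + 1 < d(q^5 + q^2) + q^3 + 1. -/

import Mathlib

open MvPolynomial

noncomputable section

/-- The projective space ℙ⁴(F): 1-dimensional F-linear subspaces of F⁵. -/
abbrev P4 (F : Type) [Field F] := Projectivization F (Fin 5 → F)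

/-- The non-degenerate Hermitian threefold
    V₃ = {[x] ∈ ℙ⁴(F) : x₀^{q+1} + ⋯ + x₄^{q+1} = 0}. -/
def hermV3 (q : ℕ) (F : Type) [Field F] : Set (P4 F) :=
  {x | ∑ i, x.rep i ^ (q + 1) = 0}

/-- V(G)(F) = {[x] ∈ ℙ⁴(F) : G(x) = 0}, for G homogeneous this is well defined. -/
def VG {F : Type} [Field F] (G : MvPolynomial (Fin 5) F) : Set (P4 F) :=
  {x | eval x.rep G = 0}

/-- The set of points of ℙ⁴(F) contained in an F-linear subspace of F⁵ of dimension k. -/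
def IsLinSub (F : Type) [Field F] (k : ℕ) (S : Set (P4 F)) : Prop :=
  ∃ W : Submodule F (Fin 5 → F), Module.finrank F W = k ∧
    S = {x : P4 F | x.submodule ≤ W}

/-- A line of ℙ⁴(F). -/
def IsLine (F : Type) [Field F] (S : Set (P4 F)) : Prop := IsLinSub F 2 S

/-- A plane of ℙ⁴(F). -/
def IsPlane (F : Type) [Field F] (S : Set (P4 F)) : Prop := IsLinSub F 3 S

/-- A hyperplane of ℙ⁴(F). -/
def IsHyperplane (F : Type) [Field F] (S : Set (P4 F)) : Prop := IsLinSub F 4 S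

/-- The tangent hyperplane T_P(V₃) = {[x] : a₀^q x₀ + ⋯ + a₄^q x₄ = 0} where P = [a]. -/
def tangentHyp (q : ℕ) {F : Type} [Field F] (P : P4 F) : Set (P4 F) :=
  {x | ∑ i, P.rep i ^ q * x.rep i = 0}

/-- A subset of ℙ⁴(F) is a tangent hyperplane to V₃ if it equals T_P(V₃) for some P ∈ V₃. -/
def IsTangentHyp (q : ℕ) {F : Type} [Field F] (S : Set (P4 F)) : Prop :=
  ∃ P ∈ hermV3 q F, S = tangentHyp q P

section Growth

variable {L A : Type*} [Field L] [CommRing A] [Algebra L A]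

/-- The dimension of the image of the subspace `W` in `A ⧸ I`. -/
def hilb (W : Submodule L A) (I : Ideal A) : ℕ :=
  Module.finrank L (W.map (Ideal.Quotient.mkₐ L I).toLinearMap)

theorem finrank_quotient_le_add (y : A) (K₁ K₂ K₃ : Ideal A) (h₁ : ∀ x ∈ K₁, y * x ∈ K₂)
    (h₃ : K₃ ≤ K₂ ⊔ Ideal.span {y}) (h₂₃ : K₂ ≤ K₃)
    [FiniteDimensional L (A ⧸ K₁)] [FiniteDimensional L (A ⧸ K₂)] :
    Module.finrank L (A ⧸ K₂) ≤ Module.finrank L (A ⧸ K₁) + Module.finrank L (A ⧸ K₃) := by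
  let g : (A ⧸ K₂) →ₗ[L] (A ⧸ K₃) := (Ideal.Quotient.factorₐ L h₂₃).toLinearMap
  let f : (A ⧸ K₁) →ₗ[L] (A ⧸ K₂) :=
    (Submodule.liftQ (K₁.restrictScalars L)
      ((Ideal.Quotient.mkₐ L K₂).toLinearMap ∘ₗ LinearMap.mulLeft L y)
      (fun x hx => by
        exact Ideal.Quotient.eq_zero_iff_mem.2 (h₁ x hx)))
  have hg : Function.Surjective g := Ideal.Quotient.factor_surjective h₂₃
  have : FiniteDimensional L (A ⧸ K₃) := Module.Finite.of_surjective g hg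
  have hker : LinearMap.ker g ≤ LinearMap.range f := by
    intro x hx
    obtain ⟨x, rfl⟩ := Ideal.Quotient.mk_surjective x
    have hx' : x ∈ K₃ := by
      have : (Ideal.Quotient.factor h₂₃) (Ideal.Quotient.mk K₂ x) = 0 := hx
      rwa [Ideal.Quotient.factor_mk, Ideal.Quotient.eq_zero_iff_mem] at this
    obtain ⟨a, ha, b, hb, rfl⟩ := Submodule.mem_sup.1 (h₃ hx')
    obtain ⟨c, rfl⟩ := Ideal.mem_span_singleton'.1 hb
    refine ⟨Ideal.Quotient.mk K₁ c, ?_⟩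
    change Ideal.Quotient.mk K₂ (y * c) = _
    rw [Ideal.Quotient.eq]
    have : y * c - (a + c * y) = -a := by ring
    rw [this]
    exact K₂.neg_mem ha
  have h := LinearMap.finrank_range_add_finrank_ker g
  have h1 := Submodule.finrank_mono hker
  have h2 := LinearMap.finrank_range_le f
  have h3 := Submodule.finrank_le (LinearMap.range g)
  omega

theorem finrank_quotient_anti {K₁ K₂ : Ideal A} (h : K₁ ≤ K₂) [FiniteDimensional L (A ⧸ K₁)] :
    Module.finrank L (A ⧸ K₂) ≤ Module.finrank L (A ⧸ K₁) :=
  LinearMap.finrank_le_finrank_of_surjective (f := (Ideal.Quotient.factorₐ L h).toLinearMap)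
    (Ideal.Quotient.factor_surjective h)

theorem finiteDimensional_quotient_of_le {K₁ K₂ : Ideal A} (h : K₁ ≤ K₂)
    [FiniteDimensional L (A ⧸ K₁)] : FiniteDimensional L (A ⧸ K₂) :=
  Module.Finite.of_surjective (Ideal.Quotient.factorₐ L h).toLinearMap
    (Ideal.Quotient.factor_surjective h)

theorem hilb_le_finrank (W : Submodule L A) [FiniteDimensional L W] (I : Ideal A) :
    hilb W I ≤ Module.finrank L W :=
  Submodule.finrank_map_le _ _

/-- Multiplication by `y` embeds `A ⧸ (I : y)` into `A ⧸ I`, with cokernel `A ⧸ (I + (y))`. -/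
theorem hilb_add_le (W W' : Submodule L A) [FiniteDimensional L W] (y : A) (I I' 𝔮 : Ideal A)
    (h𝔮 : ∀ x, x ∈ 𝔮 ↔ y * x ∈ I) (hI : I ≤ I') (hy : y ∈ I') (hW : ∀ x ∈ W', y * x ∈ W) :
    hilb W I' + hilb W' 𝔮 ≤ hilb W I := by
  let g : (A ⧸ I) →ₗ[L] (A ⧸ I') := (Ideal.Quotient.factorₐ L hI).toLinearMap
  let f : (A ⧸ 𝔮) →ₗ[L] (A ⧸ I) :=
    (Submodule.liftQ (𝔮.restrictScalars L)
      ((Ideal.Quotient.mkₐ L I).toLinearMap ∘ₗ LinearMap.mulLeft L y)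
      (fun x hx => by
        exact Ideal.Quotient.eq_zero_iff_mem.2 ((h𝔮 x).1 hx)))
  have hf : Function.Injective f := by
    rw [injective_iff_map_eq_zero]
    intro x hx
    obtain ⟨x, rfl⟩ := Ideal.Quotient.mk_surjective x
    have : Ideal.Quotient.mk I (y * x) = 0 := hx
    rw [Ideal.Quotient.eq_zero_iff_mem] at this ⊢
    exact (h𝔮 x).2 this
  set V := W.map (Ideal.Quotient.mkₐ L I).toLinearMap with hV
  set U := (W'.map (Ideal.Quotient.mkₐ L 𝔮).toLinearMap).map f with hU
  have hUr : Module.finrank L U = hilb W' 𝔮 := (Submodule.equivMapOfInjective f hf _).finrank_eq.symm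
  have hUV : U ≤ V := by
    rintro _ ⟨_, ⟨x, hx, rfl⟩, rfl⟩
    exact ⟨y * x, hW x hx, rfl⟩
  have hUg : U ≤ LinearMap.ker g := by
    rintro _ ⟨_, ⟨x, hx, rfl⟩, rfl⟩
    change Ideal.Quotient.mk I' (y * x) = 0
    rw [Ideal.Quotient.eq_zero_iff_mem]
    exact I'.mul_mem_right _ hy
  have hmap : V.map g = W.map (Ideal.Quotient.mkₐ L I').toLinearMap := by
    rw [hV, ← Submodule.map_comp]
    rfl
  have h1 := LinearMap.finrank_range_add_finrank_ker (g.domRestrict V)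
  have h2 : LinearMap.range (g.domRestrict V) = V.map g := LinearMap.range_domRestrict _ _
  have h3 : Module.finrank L U ≤ Module.finrank L (LinearMap.ker (g.domRestrict V)) := by
    have : U = (U.comap V.subtype).map V.subtype := by
      rw [Submodule.map_comap_subtype, inf_eq_right.2 hUV]
    rw [this, ← (Submodule.equivMapOfInjective V.subtype V.injective_subtype _).finrank_eq]
    apply Submodule.finrank_mono
    intro x hx
    exact hUg hx
  rw [h2, hmap] at h1
  change hilb W I' + _ = hilb W I at h1
  omega

variable (L A) in
/-- An exhaustive increasing multiplicative filtration by finite-dimensional subspaces. -/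
structure FinFiltration where
  /-- The steps of the filtration. -/
  step : ℕ → Submodule L A
  finite : ∀ n, FiniteDimensional L (step n)
  mono : Monotone step
  mul_mem : ∀ {m n x y}, x ∈ step m → y ∈ step n → x * y ∈ step (m + n)
  exhaust : ∀ x, ∃ n, x ∈ step n

variable {ι : Type*} [Fintype ι]

/-- The ideal `I` has at least linear growth with a slope `η` that bounds, up to the factor `ρ`,
the weighted sum of the growths of the lengths of `A ⧸ (I + 𝔪 P ^ j)`. -/
def SlopeBound (Fil : FinFiltration L A) (𝔪 : ι → Ideal A) (w : ι → ℝ) (ρ : ℝ) (I : Ideal A) :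
    Prop :=
  ∃ η c : ℝ, 0 ≤ η ∧ (∀ n : ℕ, η * n - c ≤ hilb (Fil.step n) I) ∧
    ∀ j : ℕ, ∑ P, w P * Module.finrank L (A ⧸ (I ⊔ 𝔪 P ^ j)) ≤ ρ * η * j + c

/-- By the Chinese remainder theorem the lengths at pairwise coprime ideals add up. -/
theorem exists_sum_finrank_le_hilb (Fil : FinFiltration L A) {𝔪 : ι → Ideal A}
    (hco : Pairwise fun P P' => IsCoprime (𝔪 P) (𝔪 P'))
    (hfin : ∀ P j, FiniteDimensional L (A ⧸ 𝔪 P ^ j)) (S : Finset ι) (I : Ideal A) (j : ℕ) :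
    ∃ n₀, ∀ n, n₀ ≤ n →
      ∑ P ∈ S, Module.finrank L (A ⧸ (I ⊔ 𝔪 P ^ j)) ≤ hilb (Fil.step n) I := by
  have hfin' : ∀ P, FiniteDimensional L (A ⧸ (I ⊔ 𝔪 P ^ j)) := fun P =>
    haveI := hfin P j
    finiteDimensional_quotient_of_le (L := L) (le_sup_right : 𝔪 P ^ j ≤ I ⊔ 𝔪 P ^ j)
  let π : (A ⧸ I) →ₗ[L] (∀ P : S, A ⧸ (I ⊔ 𝔪 P ^ j)) :=
    LinearMap.pi fun P => (Ideal.Quotient.factorₐ L le_sup_left).toLinearMap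
  have hπ : Function.Surjective (π ∘ₗ (Ideal.Quotient.mkₐ L I).toLinearMap) := by
    intro x
    have hc : Pairwise (Function.onFun IsCoprime fun P : S => I ⊔ 𝔪 P ^ j) := by
      intro P P' hPP'
      have h : IsCoprime (𝔪 P ^ j) (𝔪 P' ^ j) :=
        (hco (fun h => hPP' (Subtype.ext h))).pow
      change IsCoprime _ _
      rw [Ideal.isCoprime_iff_sup_eq] at h ⊢
      rw [eq_top_iff, ← h]
      exact sup_le_sup le_sup_right le_sup_right
    obtain ⟨r, hr⟩ := Ideal.pi_quotient_surjective hc x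
    exact ⟨r, funext hr⟩
  obtain ⟨s, hs⟩ := (Module.finite_def.1 (inferInstance :
    FiniteDimensional L (∀ P : S, A ⧸ (I ⊔ 𝔪 P ^ j))))
  choose g hg using hπ
  choose N hN using Fil.exhaust
  refine ⟨s.sup fun x => N (g x), fun n hn => ?_⟩
  have hsurj : ((Fil.step n).map (Ideal.Quotient.mkₐ L I).toLinearMap).map π = ⊤ := by
    rw [eq_top_iff, ← hs, Submodule.span_le]
    intro x hx
    exact ⟨_, ⟨g x, Fil.mono ((Finset.le_sup (f := fun x => N (g x)) hx).trans hn) (hN _), rfl⟩,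
      hg x⟩
  have := Fil.finite n
  have h := Submodule.finrank_map_le π ((Fil.step n).map (Ideal.Quotient.mkₐ L I).toLinearMap)
  rw [hsurj, finrank_top, Module.finrank_pi_fintype] at h
  rw [← Finset.sum_coe_sort]
  exact h

theorem slopeBound_of_prime (Fil : FinFiltration L A) {𝔪 : ι → Ideal A}
    (hco : Pairwise fun P P' => IsCoprime (𝔪 P) (𝔪 P'))
    (hfin : ∀ P j, FiniteDimensional L (A ⧸ 𝔪 P ^ j)) {w : ι → ℝ} (hw : ∀ P, 0 ≤ w P) {ρ : ℝ}
    {κ c₀ : ℕ} (hκ : ∀ n, Module.finrank L (Fil.step n) ≤ κ * n + c₀)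
    (𝔮 : Ideal A) [𝔮.IsPrime] (S : Finset ι) {D m : ℕ} (hD : 0 < D) (hm : 0 < m) {f : A}
    (hf𝔮 : f ∉ 𝔮) (hfD : f ∈ Fil.step D)
    (hfS : ∀ P ∈ S, f ∈ 𝔮 ⊔ 𝔪 P ^ m ∧ w P * D ≤ ρ * m)
    {c₁ : ℕ} (hc₁ : ∀ P ∉ S, ∀ j, Module.finrank L (A ⧸ (𝔮 ⊔ 𝔪 P ^ j)) ≤ c₁) :
    SlopeBound Fil 𝔪 w ρ 𝔮 := by
  have hfinI : ∀ (I : Ideal A) P j, FiniteDimensional L (A ⧸ (I ⊔ 𝔪 P ^ j)) := fun I P j =>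
    haveI := hfin P j
    finiteDimensional_quotient_of_le (L := L) (le_sup_right : 𝔪 P ^ j ≤ I ⊔ 𝔪 P ^ j)
  set E : ℕ → ℕ := fun j => ∑ P ∈ S, Module.finrank L (A ⧸ (𝔮 ⊔ 𝔪 P ^ j)) with hE
  have hEmono : Monotone E := fun i j hij => Finset.sum_le_sum fun P _ =>
    haveI := hfinI 𝔮 P j
    finrank_quotient_anti (sup_le_sup_left (Ideal.pow_le_pow_right hij) _)
  have hmul : ∀ x, x ∈ 𝔮 ↔ f * x ∈ 𝔮 := fun x =>
    ⟨fun h => 𝔮.mul_mem_left _ h, fun h =>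
      ((Ideal.IsPrime.mem_or_mem ‹_› h).resolve_left hf𝔮)⟩
  have hstep : ∀ j, ∃ n₀, ∀ n, n₀ ≤ n →
      (E (j + m) - E j) + hilb (Fil.step n) 𝔮 ≤ hilb (Fil.step (n + D)) 𝔮 := by
    intro j
    obtain ⟨n₀, hn₀⟩ := exists_sum_finrank_le_hilb Fil hco hfin S (𝔮 ⊔ Ideal.span {f}) (j + m)
    refine ⟨n₀, fun n hn => ?_⟩
    have h1 := hn₀ (n + D) (by omega)
    have := Fil.finite (n + D)
    have h2 := hilb_add_le (Fil.step (n + D)) (Fil.step n) f 𝔮 (𝔮 ⊔ Ideal.span {f}) 𝔮 hmul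
      le_sup_left (Ideal.mem_sup_right (Ideal.mem_span_singleton_self f))
      (fun x hx => by simpa [add_comm] using Fil.mul_mem hfD hx)
    have h3 : E (j + m) ≤ E j +
        ∑ P ∈ S, Module.finrank L (A ⧸ (𝔮 ⊔ Ideal.span {f} ⊔ 𝔪 P ^ (j + m))) := by
      rw [hE, ← Finset.sum_add_distrib]
      refine Finset.sum_le_sum fun P hP => ?_
      have := hfinI 𝔮 P j
      have := hfinI 𝔮 P (j + m)
      refine finrank_quotient_le_add f _ _ _ (fun x hx => ?_) ?_ ?_
      · obtain ⟨a, ha, b, hb, rfl⟩ := Submodule.mem_sup.1 hx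
        obtain ⟨a', ha', b', hb', hab⟩ := Submodule.mem_sup.1 (hfS P hP).1
        have : f * (a + b) = (f * a + a' * b) + b * b' := by rw [← hab]; ring
        rw [this]
        refine Submodule.add_mem_sup (𝔮.add_mem (𝔮.mul_mem_left _ ha) (𝔮.mul_mem_right _ ha')) ?_
        rw [pow_add]
        exact Ideal.mul_mem_mul hb hb'
      · rw [sup_right_comm]
      · exact sup_le_sup_right le_sup_left _
    omega
  have hslope : ∀ j, ∃ c : ℕ, ∀ n : ℕ,
      (E (j + m) - E j) * n ≤ D * hilb (Fil.step n) 𝔮 + c := by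
    intro j
    obtain ⟨n₀, hn₀⟩ := hstep j
    refine ⟨(E (j + m) - E j) * (n₀ + D), fun n => ?_⟩
    induction n using Nat.strong_induction_on with
    | _ n ih =>
      by_cases hn : n < n₀ + D
      · exact (Nat.mul_le_mul_left _ hn.le).trans (Nat.le_add_left _ _)
      · obtain ⟨k, rfl⟩ : ∃ k, n = k + D := ⟨n - D, by omega⟩
        have h1 := ih k (by omega)
        have h2 := hn₀ k (by omega)
        have h3 := Nat.mul_le_mul_left D h2
        nlinarith
  have hbdd : ∀ j, E (j + m) - E j ≤ D * κ := by
    intro j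
    obtain ⟨c, hc⟩ := hslope j
    by_contra! hlt
    have h1 := hc (D * c₀ + c + 1)
    have := Fil.finite (D * c₀ + c + 1)
    have h2 := (hilb_le_finrank (Fil.step (D * c₀ + c + 1)) 𝔮).trans (hκ _)
    have h3 := Nat.mul_le_mul_left D h2
    have h4 := Nat.mul_le_mul_right (D * c₀ + c + 1) (Nat.succ_le_of_lt hlt)
    nlinarith
  obtain ⟨j₀, hj₀⟩ : ∃ j₀, ∀ j, E (j + m) - E j ≤ E (j₀ + m) - E j₀ := by
    have hfr : (Set.range fun j => E (j + m) - E j).Finite :=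
      (Set.finite_Iic (D * κ)).subset (by rintro _ ⟨j, rfl⟩; exact hbdd j)
    obtain ⟨_, ⟨j₀, rfl⟩, h⟩ := Set.exists_max_image _ id hfr (Set.range_nonempty _)
    exact ⟨j₀, fun j => h _ ⟨j, rfl⟩⟩
  set s := E (j₀ + m) - E j₀ with hs
  have hEle : ∀ j, m * E j ≤ s * j + m * E m := by
    intro j
    induction j using Nat.strong_induction_on with
    | _ j ih =>
      by_cases hj : j < m
      · exact (Nat.mul_le_mul_left _ (hEmono hj.le)).trans (Nat.le_add_left _ _)
      · obtain ⟨k, rfl⟩ : ∃ k, j = k + m := ⟨j - m, by omega⟩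
        have h1 := ih k (by omega)
        have h2 : E (k + m) ≤ E k + s := by have := hj₀ k; omega
        have h3 := Nat.mul_le_mul_left m h2
        nlinarith
  obtain ⟨c, hc⟩ := hslope j₀
  have hDR : (0 : ℝ) < D := by exact_mod_cast hD
  have hmR : (0 : ℝ) < m := by exact_mod_cast hm
  have hW : 0 ≤ ∑ P, w P := Finset.sum_nonneg fun P _ => hw P
  have hc₁' : 0 ≤ (∑ P, w P) * c₁ := mul_nonneg hW (Nat.cast_nonneg _)
  refine ⟨s / D, c + |ρ| * m * E m / D + (∑ P, w P) * c₁, by positivity, fun n => ?_, fun j => ?_⟩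
  · have h : (s : ℝ) * n ≤ D * hilb (Fil.step n) 𝔮 + c := by exact_mod_cast hc n
    have h1 : (s : ℝ) / D * n ≤ hilb (Fil.step n) 𝔮 + c := by
      rw [div_mul_eq_mul_div, div_le_iff₀ hDR]
      have : (c : ℝ) ≤ c * D := le_mul_of_one_le_right (by positivity) (by exact_mod_cast hD)
      linarith
    have : 0 ≤ |ρ| * m * E m / D := by positivity
    linarith
  · classical
    rw [← Finset.sum_add_sum_compl S]
    have h1 : ∑ P ∈ Sᶜ, w P * (Module.finrank L (A ⧸ (𝔮 ⊔ 𝔪 P ^ j)) : ℝ) ≤ (∑ P, w P) * c₁ := by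
      rw [Finset.sum_mul]
      refine (Finset.sum_le_sum fun P hP => ?_).trans
        (Finset.sum_le_univ_sum_of_nonneg fun P => mul_nonneg (hw P) (Nat.cast_nonneg _))
      exact mul_le_mul_of_nonneg_left (by exact_mod_cast hc₁ P (Finset.mem_compl.1 hP) j) (hw P)
    have h2 : ∑ P ∈ S, w P * (Module.finrank L (A ⧸ (𝔮 ⊔ 𝔪 P ^ j)) : ℝ) ≤
        ρ * m / D * E j := by
      rw [hE]
      push_cast
      rw [Finset.mul_sum]
      refine Finset.sum_le_sum fun P hP => mul_le_mul_of_nonneg_right ?_ (Nat.cast_nonneg _)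
      rw [le_div_iff₀ hDR]
      exact (hfS P hP).2
    have h3 : ρ * m / D * E j ≤ ρ * (s / D) * j + |ρ| * m * E m / D := by
      rcases S.eq_empty_or_nonempty with rfl | ⟨P, hP⟩
      · have h0 : ∀ j, E j = 0 := fun j => by simp [hE]
        simp [hs, h0]
      have hρ : 0 ≤ ρ := by
        have := (hfS P hP).2
        have h' : 0 ≤ w P * D := mul_nonneg (hw P) hDR.le
        by_contra! hneg
        nlinarith
      have h : (m : ℝ) * E j ≤ s * j + m * E m := by exact_mod_cast hEle j
      rw [abs_of_nonneg hρ]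
      calc ρ * m / D * E j = ρ / D * (m * E j) := by ring
        _ ≤ ρ / D * (s * j + m * E m) := mul_le_mul_of_nonneg_left h (by positivity)
        _ = _ := by ring
    have : (0 : ℝ) ≤ c := by positivity
    linarith

theorem SlopeBound.of_colon {Fil : FinFiltration L A} {𝔪 : ι → Ideal A}
    (hfin : ∀ P j, FiniteDimensional L (A ⧸ 𝔪 P ^ j)) {w : ι → ℝ} (hw : ∀ P, 0 ≤ w P) {ρ : ℝ}
    {I I' 𝔮 : Ideal A} {y : A} (h𝔮 : ∀ x, x ∈ 𝔮 ↔ y * x ∈ I) (hI' : I' = I ⊔ Ideal.span {y})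
    (h₁ : SlopeBound Fil 𝔪 w ρ I') (h₂ : SlopeBound Fil 𝔪 w ρ 𝔮) :
    SlopeBound Fil 𝔪 w ρ I := by
  have hfinI : ∀ (I : Ideal A) P j, FiniteDimensional L (A ⧸ (I ⊔ 𝔪 P ^ j)) := fun I P j =>
    haveI := hfin P j
    finiteDimensional_quotient_of_le (L := L) (le_sup_right : 𝔪 P ^ j ≤ I ⊔ 𝔪 P ^ j)
  obtain ⟨η₁, c₁, hη₁, hn₁, hj₁⟩ := h₁
  obtain ⟨η₂, c₂, hη₂, hn₂, hj₂⟩ := h₂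
  obtain ⟨a, ha⟩ := Fil.exhaust y
  have hle : I ≤ I' := hI' ▸ le_sup_left
  have hy : y ∈ I' := hI' ▸ Ideal.mem_sup_right (Ideal.mem_span_singleton_self y)
  refine ⟨η₁ + η₂, |c₁| + |c₂| + (η₁ + η₂) * a, by positivity, fun n => ?_, fun j => ?_⟩
  · have b₁ := le_abs_self c₁
    have b₂ := le_abs_self c₂
    rcases lt_or_ge n a with hn | hn
    · have : (n : ℝ) ≤ a := by exact_mod_cast hn.le
      have h0 : (0 : ℝ) ≤ hilb (Fil.step n) I := Nat.cast_nonneg _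
      have := mul_le_mul_of_nonneg_left this (add_nonneg hη₁ hη₂)
      have := abs_nonneg c₁
      have := abs_nonneg c₂
      linarith
    · obtain ⟨k, rfl⟩ := Nat.exists_eq_add_of_le hn
      have := Fil.finite (a + k)
      have h : (hilb (Fil.step (a + k)) I' + hilb (Fil.step k) 𝔮 : ℝ) ≤
          hilb (Fil.step (a + k)) I := by
        exact_mod_cast hilb_add_le _ (Fil.step k) y I I' 𝔮 h𝔮 hle hy fun x hx => Fil.mul_mem ha hx
      have h1 := hn₁ (a + k)
      have h2 := hn₂ k
      push_cast at h1 ⊢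
      have : 0 ≤ η₁ * a := by positivity
      nlinarith
  · have h : ∑ P, w P * (Module.finrank L (A ⧸ (I ⊔ 𝔪 P ^ j)) : ℝ) ≤
        ∑ P, w P * (Module.finrank L (A ⧸ (I' ⊔ 𝔪 P ^ j)) : ℝ) +
        ∑ P, w P * (Module.finrank L (A ⧸ (𝔮 ⊔ 𝔪 P ^ j)) : ℝ) := by
      rw [← Finset.sum_add_distrib]
      refine Finset.sum_le_sum fun P _ => ?_
      rw [← mul_add]
      refine mul_le_mul_of_nonneg_left ?_ (hw P)
      have := hfinI 𝔮 P j
      have := hfinI I P j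
      rw [add_comm]
      norm_cast
      refine finrank_quotient_le_add y _ _ _ (fun x hx => ?_) ?_ (sup_le_sup_right hle _)
      · obtain ⟨b, hb, c, hc, rfl⟩ := Submodule.mem_sup.1 hx
        rw [mul_add]
        exact Submodule.add_mem_sup ((h𝔮 b).1 hb) (Ideal.mul_mem_left _ _ hc)
      · rw [hI', sup_right_comm]
    have h1 := hj₁ j
    have h2 := hj₂ j
    have := le_abs_self c₁
    have := le_abs_self c₂
    have : 0 ≤ (η₁ + η₂) * a := by positivity
    have : ρ * (η₁ + η₂) * j = ρ * η₁ * j + ρ * η₂ * j := by ring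
    linarith

theorem slopeBound_top (Fil : FinFiltration L A) (𝔪 : ι → Ideal A) (w : ι → ℝ) (ρ : ℝ) :
    SlopeBound Fil 𝔪 w ρ ⊤ := by
  refine ⟨0, 0, le_rfl, fun n => by simp, fun j => ?_⟩
  have : ∀ P, Module.finrank L (A ⧸ (⊤ ⊔ 𝔪 P ^ j)) = 0 := fun P => by
    have : Subsingleton (A ⧸ (⊤ ⊔ 𝔪 P ^ j)) :=
      Ideal.Quotient.subsingleton_iff.2 (top_sup_eq _)
    exact Module.finrank_zero_of_subsingleton
  simp [this]

/-- If every prime `𝔮` contains functions of small degree that vanish to high order at the given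
points, then the multiplicities of these points are bounded by the degree. -/
theorem sum_finrank_quotient_pow_le [IsNoetherianRing A] (Fil : FinFiltration L A)
    {𝔪 : ι → Ideal A} (hco : Pairwise fun P P' => IsCoprime (𝔪 P) (𝔪 P'))
    (hfin : ∀ P j, FiniteDimensional L (A ⧸ 𝔪 P ^ j)) {w : ι → ℝ} (hw : ∀ P, 0 ≤ w P) {ρ : ℝ}
    (hρ : 0 ≤ ρ) {κ c₀ : ℕ} (hκ : ∀ n, Module.finrank L (Fil.step n) ≤ κ * n + c₀)
    (hprime : ∀ 𝔮 : Ideal A, 𝔮.IsPrime → ∃ (S : Finset ι) (D m : ℕ) (f : A) (c₁ : ℕ),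
      0 < D ∧ 0 < m ∧ f ∉ 𝔮 ∧ f ∈ Fil.step D ∧
      (∀ P ∈ S, f ∈ 𝔮 ⊔ 𝔪 P ^ m ∧ w P * D ≤ ρ * m) ∧
      ∀ P ∉ S, ∀ j, Module.finrank L (A ⧸ (𝔮 ⊔ 𝔪 P ^ j)) ≤ c₁) :
    ∃ c : ℝ, ∀ j : ℕ, ∑ P, w P * Module.finrank L (A ⧸ 𝔪 P ^ j) ≤ ρ * κ * j + c := by
  have key : ∀ I : Ideal A, SlopeBound Fil 𝔪 w ρ I := by
    intro I
    induction I using IsNoetherian.induction with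
    | hgt I ih =>
    by_cases hI : I = ⊤
    · exact hI ▸ slopeBound_top Fil 𝔪 w ρ
    have : Nontrivial (A ⧸ I) := Ideal.Quotient.nontrivial_iff.2 hI
    obtain ⟨𝔮, h𝔮⟩ := associatedPrimes.nonempty A (A ⧸ I)
    obtain ⟨h𝔮p, y, hy⟩ := (isAssociatedPrime_iff).1 h𝔮
    obtain ⟨y, rfl⟩ := Ideal.Quotient.mk_surjective y
    have hmem : ∀ x, x ∈ 𝔮 ↔ y * x ∈ I := fun x => by
      rw [hy, Submodule.mem_colon_singleton, Submodule.mem_bot, ← Ideal.Quotient.eq_zero_iff_mem,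
        map_mul, mul_comm]
      rfl
    have hyI : y ∉ I := fun h => h𝔮p.ne_top <| by
      rw [Ideal.eq_top_iff_one, hmem]
      simpa using h
    refine SlopeBound.of_colon hfin hw hmem rfl (ih _ ?_) ?_
    · refine lt_of_le_of_ne le_sup_left fun h => hyI ?_
      rw [h]
      exact Ideal.mem_sup_right (Ideal.mem_span_singleton_self y)
    · obtain ⟨S, D, m, f, c₁, hD, hm, hf, hfD, hfS, hc₁⟩ := hprime 𝔮 h𝔮p
      exact slopeBound_of_prime Fil hco hfin hw hκ 𝔮 S hD hm hf hfD hfS hc₁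
  obtain ⟨η, c, hη, hn, hj⟩ := key ⊥
  have hηκ : η ≤ κ := by
    by_contra! hlt
    obtain ⟨n, hn'⟩ := exists_nat_gt ((c₀ + c) / (η - κ))
    rw [div_lt_iff₀ (sub_pos.2 hlt)] at hn'
    have := Fil.finite n
    have h1 : (hilb (Fil.step n) ⊥ : ℝ) ≤ κ * n + c₀ := by
      exact_mod_cast (hilb_le_finrank (Fil.step n) ⊥).trans (hκ n)
    have h2 := hn n
    nlinarith
  refine ⟨c, fun j => ?_⟩
  have h := hj j
  have hbot : ∀ P, Module.finrank L (A ⧸ (⊥ ⊔ 𝔪 P ^ j)) = Module.finrank L (A ⧸ 𝔪 P ^ j) :=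
    fun P => by rw [bot_sup_eq]
  simp only [hbot] at h
  refine h.trans ?_
  gcongr

end Growth

/-- The Hermitian form in hyperbolic coordinates, with `n` in place of the conjugation exponent. -/
def herm {A : Type*} [CommRing A] (n : ℕ) (x : Fin 5 → A) : A :=
  x 0 ^ n * x 4 + x 0 * x 4 ^ n + x 1 ^ n * x 3 + x 1 * x 3 ^ n + x 2 ^ (n + 1)

section Degree

variable {L A : Type*} [Field L] [CommRing A] [Algebra L A]

variable (L) in
/-- The span of the polynomial expressions of degree at most `n` in the `ξ i`. -/
def degSpan (ξ : Fin 5 → A) (n : ℕ) : Submodule L A :=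
  (restrictTotalDegree (Fin 5) L n).map (aeval ξ).toLinearMap

theorem aeval_mem_degSpan (ξ : Fin 5 → A) {p : MvPolynomial (Fin 5) L} {n : ℕ}
    (h : p.totalDegree ≤ n) : aeval ξ p ∈ degSpan L ξ n :=
  ⟨p, (mem_restrictTotalDegree _ _ _).2 h, rfl⟩

theorem degSpan_mono (ξ : Fin 5 → A) : Monotone (degSpan L ξ) := by
  rintro m n hmn _ ⟨p, hp, rfl⟩
  exact aeval_mem_degSpan ξ (((mem_restrictTotalDegree _ _ _).1 hp).trans hmn)

theorem mul_mem_degSpan (ξ : Fin 5 → A) {m n : ℕ} {x y : A} (hx : x ∈ degSpan L ξ m)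
    (hy : y ∈ degSpan L ξ n) : x * y ∈ degSpan L ξ (m + n) := by
  obtain ⟨p, hp, rfl⟩ := hx
  obtain ⟨p', hp', rfl⟩ := hy
  have := aeval_mem_degSpan (L := L) ξ ((totalDegree_mul p p').trans
    (add_le_add ((mem_restrictTotalDegree _ _ _).1 hp) ((mem_restrictTotalDegree _ _ _).1 hp')))
  simpa using this

theorem self_mem_degSpan (ξ : Fin 5 → A) (i : Fin 5) : ξ i ∈ degSpan L ξ 1 := by
  simpa using aeval_mem_degSpan (L := L) ξ (totalDegree_X (R := L) i).le

theorem pow_mem_degSpan (ξ : Fin 5 → A) {m : ℕ} {x : A} (hx : x ∈ degSpan L ξ m) (k : ℕ) :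
    x ^ k ∈ degSpan L ξ (k * m) := by
  induction k with
  | zero => simpa using aeval_mem_degSpan (L := L) ξ (totalDegree_one (R := L)).le
  | succ k ih => rw [pow_succ, Nat.succ_mul]; exact mul_mem_degSpan ξ ih hx

/-- The filtration by degree of an algebra generated by five elements. -/
def degFiltration (ξ : Fin 5 → A) (hξ : Function.Surjective (aeval (R := L) ξ)) :
    FinFiltration L A where
  step := degSpan L ξ
  finite n := Module.Finite.map _ _
  mono := degSpan_mono ξ
  mul_mem := mul_mem_degSpan ξ
  exhaust x := by
    obtain ⟨p, rfl⟩ := hξ x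
    exact ⟨p.totalDegree, aeval_mem_degSpan ξ le_rfl⟩

/-- The monomials of degree `n` in the `ξ i`. -/
def monSet (ξ : Fin 5 → A) (n : ℕ) : Set A :=
  {x | ∃ a b c e f : ℕ, a + b + c + e + f = n ∧
    x = ξ 0 ^ a * ξ 1 ^ b * ξ 2 ^ c * ξ 3 ^ e * ξ 4 ^ f}

/-- The monomials of degree `n` that are not divisible by the leading monomials `x₄ ^ d`,
`x₂ ^ (q + 1)` and `x₁ ^ (q ^ 3) x₃`. -/
def stdMonSet (q d : ℕ) (ξ : Fin 5 → A) (n : ℕ) : Set A :=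
  {x | ∃ a b c e f : ℕ, a + b + c + e + f = n ∧ f < d ∧ c ≤ q ∧ (b < q ^ 3 ∨ e = 0) ∧
    x = ξ 0 ^ a * ξ 1 ^ b * ξ 2 ^ c * ξ 3 ^ e * ξ 4 ^ f}

theorem mul_mem_span_monSet (ξ : Fin 5 → A) (i : Fin 5) {n : ℕ} {x : A}
    (hx : x ∈ Submodule.span L (monSet ξ n)) : ξ i * x ∈ Submodule.span L (monSet ξ (n + 1)) := by
  induction hx using Submodule.span_induction with
  | mem x hx =>
    obtain ⟨a, b, c, e, f, h, rfl⟩ := hx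
    apply Submodule.subset_span
    fin_cases i
    · exact ⟨a + 1, b, c, e, f, by omega, by simp only [Fin.zero_eta]; ring⟩
    · exact ⟨a, b + 1, c, e, f, by omega, by simp only [Fin.mk_one]; ring⟩
    · exact ⟨a, b, c + 1, e, f, by omega, by simp only [Fin.reduceFinMk]; ring⟩
    · exact ⟨a, b, c, e + 1, f, by omega, by simp only [Fin.reduceFinMk]; ring⟩
    · exact ⟨a, b, c, e, f + 1, by omega, by simp only [Fin.reduceFinMk]; ring⟩
  | zero => simp
  | add x y _ _ hx hy => rw [mul_add]; exact add_mem hx hy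
  | smul r x _ hx => rw [mul_smul_comm]; exact Submodule.smul_mem _ _ hx

theorem degSpan_le_span_monSet (ξ : Fin 5 → A) {θ : Fin 5 → L} (hθ : ∑ i, θ i • ξ i = 1) (n : ℕ) :
    degSpan L ξ n ≤ Submodule.span L (monSet ξ n) := by
  have hmono : Monotone fun n => Submodule.span L (monSet ξ n) := by
    refine monotone_nat_of_le_succ fun n x hx => ?_
    have : x = ∑ i, θ i • (ξ i * x) := by
      simp_rw [← smul_mul_assoc, ← Finset.sum_mul, hθ, one_mul]
    rw [this]
    exact Submodule.sum_mem _ fun i _ => Submodule.smul_mem _ _ (mul_mem_span_monSet ξ i hx)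
  rintro _ ⟨p, hp, rfl⟩
  replace hp : p.totalDegree ≤ n := (mem_restrictTotalDegree _ _ _).1 hp
  change aeval ξ p ∈ _
  rw [aeval_def, eval₂_eq']
  refine Submodule.sum_mem _ fun s hs => ?_
  rw [← Algebra.smul_def]
  refine Submodule.smul_mem _ _ ((hmono ((le_totalDegree hs).trans hp)) (Submodule.subset_span ?_))
  refine ⟨s 0, s 1, s 2, s 3, s 4, ?_, ?_⟩
  · rw [Finsupp.sum_fintype _ _ (by simp), Fin.sum_univ_five]
  · rw [Fin.prod_univ_five]

theorem mul_mem_span_stdMonSet (q d : ℕ) (ξ : Fin 5 → A) {n : ℕ} {x : A}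
    (hx : x ∈ Submodule.span L (stdMonSet q d ξ n)) :
    ξ 0 * x ∈ Submodule.span L (stdMonSet q d ξ (n + 1)) := by
  induction hx using Submodule.span_induction with
  | mem x hx =>
    obtain ⟨a, b, c, e, f, h, hf, hc, hb, rfl⟩ := hx
    exact Submodule.subset_span ⟨a + 1, b, c, e, f, by omega, hf, hc, hb, by ring⟩
  | zero => simp
  | add x y _ _ hx hy => rw [mul_add]; exact add_mem hx hy
  | smul r x _ hx => rw [mul_smul_comm]; exact Submodule.smul_mem _ _ hx

theorem add_mul_pow_eq (ξ : Fin 5 → A) {k : ℕ} {x u : A} (hx : x ∈ degSpan L ξ (k + 1))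
    (hu : u ∈ degSpan L ξ k) (N : ℕ) :
    ∃ v ∈ degSpan L ξ (N * (k + 1) + k), (x + ξ 0 * u) ^ (N + 1) = x ^ (N + 1) + ξ 0 * v := by
  induction N with
  | zero => exact ⟨u, by simpa using hu, by ring⟩
  | succ N ih =>
    obtain ⟨v, hv, h⟩ := ih
    refine ⟨v * x + x ^ (N + 1) * u + ξ 0 * u * v, ?_, ?_⟩
    · refine add_mem (add_mem ?_ ?_) ?_
      · convert mul_mem_degSpan ξ hv hx using 2; ring
      · convert mul_mem_degSpan ξ (pow_mem_degSpan ξ hx (N + 1)) hu using 1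
      · convert mul_mem_degSpan ξ (mul_mem_degSpan ξ (self_mem_degSpan ξ 0) hu) hv using 2; ring
    · rw [pow_succ, h]; ring

/-- The relations allow to rewrite all monomials in terms of the standard ones. -/
theorem mon_mem_span_stdMonSet {q d : ℕ} (hq : 2 ≤ q) {ξ : Fin 5 → A} {n : ℕ}
    (hn : degSpan L ξ n ≤ Submodule.span L (stdMonSet q d ξ n))
    (h₁ : herm q ξ = 0) (h₃ : herm (q ^ 3) ξ = 0) {G : MvPolynomial (Fin 5) L}
    (hGd : G.IsHomogeneous d) (hG4 : G.coeff (Finsupp.single 4 d) ≠ 0) (hG : aeval ξ G = 0)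
    (k : ℕ) : ∀ a b c e f : ℕ, a + b + c + e + f = n + 1 →
      f * (n + 2) ^ 2 + c * (n + 2) + b = k → ξ 0 ^ a * ξ 1 ^ b * ξ 2 ^ c * ξ 3 ^ e * ξ 4 ^ f ∈
        Submodule.span L (stdMonSet q d ξ (n + 1)) := by
  have hzero : ∀ {x m}, x ∈ degSpan L ξ m → m ≤ n →
      ξ 0 * x ∈ Submodule.span L (stdMonSet q d ξ (n + 1)) := fun hx hm =>
    mul_mem_span_stdMonSet q d ξ (hn (degSpan_mono ξ hm hx))
  have hmon : ∀ a b c e f : ℕ, ξ 0 ^ a * ξ 1 ^ b * ξ 2 ^ c * ξ 3 ^ e * ξ 4 ^ f ∈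
      degSpan L ξ (a + b + c + e + f) := fun a b c e f => by
    have h : ∀ (i : Fin 5) (k : ℕ), ξ i ^ k ∈ degSpan L ξ k := fun i k => by
      simpa using pow_mem_degSpan ξ (self_mem_degSpan (L := L) ξ i) k
    exact mul_mem_degSpan ξ (mul_mem_degSpan ξ (mul_mem_degSpan ξ (mul_mem_degSpan ξ (h 0 a)
      (h 1 b)) (h 2 c)) (h 3 e)) (h 4 f)
  induction k using Nat.strong_induction_on with
  | _ k ih =>
  intro a b c e f hsum hk
  have hlex : ∀ a' b' c' e' f' : ℕ, a' + b' + c' + e' + f' = n + 1 →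
      (f' < f ∨ f' = f ∧ (c' < c ∨ c' = c ∧ b' < b)) →
      ξ 0 ^ a' * ξ 1 ^ b' * ξ 2 ^ c' * ξ 3 ^ e' * ξ 4 ^ f' ∈
        Submodule.span L (stdMonSet q d ξ (n + 1)) := by
    intro a' b' c' e' f' hs hlt
    refine ih _ ?_ a' b' c' e' f' hs rfl
    rw [← hk]
    rcases hlt with hlt | ⟨rfl, hlt | ⟨rfl, hlt⟩⟩
    · have : (f' + 1) * (n + 2) ^ 2 ≤ f * (n + 2) ^ 2 := Nat.mul_le_mul_right _ hlt
      have h1 : c' * (n + 2) ≤ (n + 1) * (n + 2) := Nat.mul_le_mul_right _ (by omega)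
      nlinarith
    · have h1 : (c' + 1) * (n + 2) ≤ c * (n + 2) := Nat.mul_le_mul_right _ hlt
      nlinarith
    · omega
  by_cases hf : d ≤ f
  · obtain ⟨f, rfl⟩ := Nat.exists_eq_add_of_le hf
    rw [aeval_def, eval₂_eq', ← Finset.add_sum_erase _ _ (mem_support_iff.2 hG4)] at hG
    simp only [← Algebra.smul_def] at hG
    have hprod : ∏ i, ξ i ^ (Finsupp.single (4 : Fin 5) d) i = ξ 4 ^ d := by
      rw [Fin.prod_univ_five]; simp
    rw [hprod, ← eq_neg_iff_add_eq_zero, ← eq_inv_smul_iff₀ hG4] at hG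
    have heq : ξ 0 ^ a * ξ 1 ^ b * ξ 2 ^ c * ξ 3 ^ e * ξ 4 ^ (d + f) =
        ξ 4 ^ d * (ξ 0 ^ a * ξ 1 ^ b * ξ 2 ^ c * ξ 3 ^ e * ξ 4 ^ f) := by ring
    rw [heq, hG, smul_mul_assoc, neg_mul, Finset.sum_mul]
    refine Submodule.smul_mem _ _ (Submodule.neg_mem _ (Submodule.sum_mem _ fun s hs => ?_))
    rw [smul_mul_assoc]
    refine Submodule.smul_mem _ _ ?_
    rw [Fin.prod_univ_five]
    obtain ⟨hs4, hs⟩ := Finset.mem_erase.1 hs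
    have hdeg : s 0 + s 1 + s 2 + s 3 + s 4 = d := by
      have := hGd (mem_support_iff.1 hs)
      rwa [Pi.one_def, ← Finsupp.degree_eq_weight_one, Finsupp.degree_eq_sum,
        Fin.sum_univ_five] at this
    have hlt : s 4 < d := by
      by_contra! hle
      apply hs4
      ext i
      fin_cases i <;> simp <;> omega
    convert hlex (s 0 + a) (s 1 + b) (s 2 + c) (s 3 + e) (s 4 + f) (by omega)
      (Or.inl (by omega)) using 1
    ring
  by_cases hc : q + 1 ≤ c
  · obtain ⟨c, rfl⟩ := Nat.exists_eq_add_of_le hc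
    obtain ⟨r, rfl⟩ : ∃ r, q = r + 1 := ⟨q - 1, by omega⟩
    have heq : ξ 0 ^ a * ξ 1 ^ b * ξ 2 ^ (r + 1 + 1 + c) * ξ 3 ^ e * ξ 4 ^ f =
        -(ξ 0 ^ a * ξ 1 ^ (b + (r + 1)) * ξ 2 ^ c * ξ 3 ^ (e + 1) * ξ 4 ^ f)
        - (ξ 0 ^ a * ξ 1 ^ (b + 1) * ξ 2 ^ c * ξ 3 ^ (e + (r + 1)) * ξ 4 ^ f)
        - ξ 0 * (ξ 0 ^ (a + r) * ξ 1 ^ b * ξ 2 ^ c * ξ 3 ^ e * ξ 4 ^ (f + 1))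
        - ξ 0 * (ξ 0 ^ a * ξ 1 ^ b * ξ 2 ^ c * ξ 3 ^ e * ξ 4 ^ (f + (r + 1))) := by
      unfold herm at h₁
      linear_combination (ξ 0 ^ a * ξ 1 ^ b * ξ 2 ^ c * ξ 3 ^ e * ξ 4 ^ f) * h₁
    rw [heq]
    refine sub_mem (sub_mem (sub_mem (neg_mem (hlex _ _ _ _ _ ?_ ?_)) (hlex _ _ _ _ _ ?_ ?_))
      (hzero (hmon _ _ _ _ _) ?_)) (hzero (hmon _ _ _ _ _) ?_) <;> omega
  by_cases hb : q ^ 3 ≤ b ∧ 0 < e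
  · obtain ⟨hb, he⟩ := hb
    obtain ⟨b, rfl⟩ := Nat.exists_eq_add_of_le hb
    obtain ⟨e, rfl⟩ := Nat.exists_eq_add_of_lt he
    rw [zero_add] at *
    obtain ⟨r, rfl⟩ : ∃ r, q = r + 1 := ⟨q - 1, by omega⟩
    obtain ⟨s, hs⟩ : ∃ s, (r + 1) ^ 3 = s + 1 := Nat.exists_eq_succ_of_ne_zero (by positivity)
    -- `N + 1 = q ^ 2 - q + 1`
    set N := (r + 1) * r with hN
    have hNs : (N + 1) * (r + 1 + 1) = (s + 1) + 1 := by rw [hN, ← hs]; ring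
    have hNodd : Odd (N + 1) := by
      rw [hN]; exact (mul_comm (r + 1) r ▸ Nat.even_mul_succ_self r).add_one
    set w := ξ 1 ^ (r + 1) * ξ 3 + ξ 1 * ξ 3 ^ (r + 1) with hw
    set u := ξ 0 ^ r * ξ 4 + ξ 4 ^ (r + 1) with hu
    have hξ : ∀ (i : Fin 5) (k : ℕ), ξ i ^ k ∈ degSpan L ξ k := fun i k => by
      simpa using pow_mem_degSpan ξ (self_mem_degSpan (L := L) ξ i) k
    have hwm : w ∈ degSpan L ξ (r + 1 + 1) := by
      refine add_mem (mul_mem_degSpan ξ (hξ 1 _) (self_mem_degSpan ξ 3)) ?_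
      convert mul_mem_degSpan ξ (self_mem_degSpan (L := L) ξ 1) (hξ 3 (r + 1)) using 2
      ring
    have hum : u ∈ degSpan L ξ (r + 1) :=
      add_mem (mul_mem_degSpan ξ (hξ 0 _) (self_mem_degSpan ξ 4)) (hξ 4 _)
    obtain ⟨v, hv, hvw⟩ := add_mul_pow_eq ξ hwm hum N
    have h2 : ξ 2 ^ (s + 1 + 1) = -(w ^ (N + 1) + ξ 0 * v) := by
      have : ξ 2 ^ (r + 1 + 1) = -(w + ξ 0 * u) := by
        unfold herm at h₁; rw [hw, hu]; linear_combination h₁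
      rw [← hvw, ← hNodd.neg_pow, ← this, ← pow_mul, mul_comm (r + 1 + 1), hNs]
    unfold herm at h₃
    rw [hs, h2] at h₃
    rw [hs] at hsum ⊢
    have heq : ξ 0 ^ a * ξ 1 ^ (s + 1 + b) * ξ 2 ^ c * ξ 3 ^ (e + 1) * ξ 4 ^ f =
        w ^ (N + 1) * (ξ 0 ^ a * ξ 1 ^ b * ξ 2 ^ c * ξ 3 ^ e * ξ 4 ^ f)
        - (ξ 0 ^ a * ξ 1 ^ (b + 1) * ξ 2 ^ c * ξ 3 ^ (e + (s + 1)) * ξ 4 ^ f)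
        - ξ 0 * (ξ 0 ^ (a + s) * ξ 1 ^ b * ξ 2 ^ c * ξ 3 ^ e * ξ 4 ^ (f + 1))
        - ξ 0 * (ξ 0 ^ a * ξ 1 ^ b * ξ 2 ^ c * ξ 3 ^ e * ξ 4 ^ (f + (s + 1)))
        + ξ 0 * (v * (ξ 0 ^ a * ξ 1 ^ b * ξ 2 ^ c * ξ 3 ^ e * ξ 4 ^ f)) := by
      linear_combination (ξ 0 ^ a * ξ 1 ^ b * ξ 2 ^ c * ξ 3 ^ e * ξ 4 ^ f) * h₃
    have hsq : 0 < s := by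
      have : r + 1 < (r + 1) ^ 3 := lt_self_pow₀ (by omega) (by omega)
      omega
    rw [heq]
    refine add_mem (sub_mem (sub_mem (sub_mem ?_ (hlex _ _ _ _ _ ?_ ?_))
      (hzero (hmon _ _ _ _ _) ?_)) (hzero (hmon _ _ _ _ _) ?_))
      (hzero (mul_mem_degSpan ξ hv (hmon _ _ _ _ _)) ?_) <;> try omega
    · rw [hw, add_pow, Finset.sum_mul]
      refine Submodule.sum_mem _ fun i hi => ?_
      have hi : i ≤ N + 1 := Nat.lt_succ_iff.1 (Finset.mem_range.1 hi)
      obtain ⟨i', hi'⟩ := Nat.exists_eq_add_of_le hi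
      rw [hi', Nat.add_sub_cancel_left]
      have : (ξ 1 ^ (r + 1) * ξ 3) ^ i * (ξ 1 * ξ 3 ^ (r + 1)) ^ i' * (((i + i').choose i : ℕ) : A) *
          (ξ 0 ^ a * ξ 1 ^ b * ξ 2 ^ c * ξ 3 ^ e * ξ 4 ^ f) = (((i + i').choose i : ℕ) : L) •
          (ξ 0 ^ a * ξ 1 ^ ((r + 1) * i + i' + b) * ξ 2 ^ c * ξ 3 ^ (i + (r + 1) * i' + e) *
            ξ 4 ^ f) := by
        rw [Algebra.smul_def, map_natCast]; ring
      rw [this]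
      have h1 : (i + i') * (r + 1 + 1) = s + 1 + 1 := by rw [← hi', hNs]
      have h2 : (i + i') * (r + 1) < s + 1 := by
        have : 0 < N := Nat.mul_pos (by omega) (by omega)
        rw [← hi']
        nlinarith
      have h3 : i' ≤ (r + 1) * i' := Nat.le_mul_of_pos_left _ (by omega)
      refine Submodule.smul_mem _ _ (hlex _ _ _ _ _ ?_ (Or.inr ⟨rfl, Or.inr ⟨rfl, ?_⟩⟩)) <;>
        nlinarith
    · have : N * (r + 1 + 1) + (r + 1) = s + 1 := by rw [Nat.succ_mul] at hNs; omega
      omega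
  exact Submodule.subset_span ⟨a, b, c, e, f, hsum, by omega, by omega, by omega, rfl⟩

theorem degSpan_le_span_stdMonSet {q d : ℕ} (hq : 2 ≤ q) (hd : 0 < d) {ξ : Fin 5 → A}
    {θ : Fin 5 → L} (hθ : ∑ i, θ i • ξ i = 1) (h₁ : herm q ξ = 0) (h₃ : herm (q ^ 3) ξ = 0)
    {G : MvPolynomial (Fin 5) L} (hGd : G.IsHomogeneous d)
    (hG4 : G.coeff (Finsupp.single 4 d) ≠ 0) (hG : aeval ξ G = 0) (n : ℕ) :
    degSpan L ξ n ≤ Submodule.span L (stdMonSet q d ξ n) := by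
  induction n with
  | zero =>
    refine (degSpan_le_span_monSet ξ hθ 0).trans (Submodule.span_mono ?_)
    rintro _ ⟨a, b, c, e, f, h, rfl⟩
    exact ⟨a, b, c, e, f, h, by omega, by omega, Or.inr (by omega), rfl⟩
  | succ n ih =>
    refine (degSpan_le_span_monSet ξ hθ (n + 1)).trans (Submodule.span_le.2 ?_)
    rintro _ ⟨a, b, c, e, f, h, rfl⟩
    exact mon_mem_span_stdMonSet hq ih h₁ h₃ hGd hG4 hG _ a b c e f h rfl

theorem finrank_span_stdMonSet_le (q d : ℕ) (ξ : Fin 5 → A) (n : ℕ) :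
    Module.finrank L (Submodule.span L (stdMonSet q d ξ n)) ≤
      (d * (q + 1) * (q ^ 3 + 1)) * n + d * (q + 1) * (q ^ 3 + 1) := by
  classical
  let S₁ : Finset (ℕ × ℕ × ℕ × ℕ) :=
    Finset.range (n + 1) ×ˢ Finset.range (q ^ 3) ×ˢ Finset.range (q + 1) ×ˢ Finset.range d
  let S₂ : Finset (ℕ × ℕ × ℕ) :=
    Finset.range (n + 1) ×ˢ Finset.range (q + 1) ×ˢ Finset.range d
  let f₁ : ℕ × ℕ × ℕ × ℕ → A := fun p => ξ 0 ^ p.1 * ξ 1 ^ p.2.1 * ξ 2 ^ p.2.2.1 *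
    ξ 3 ^ (n - (p.1 + p.2.1 + p.2.2.1 + p.2.2.2)) * ξ 4 ^ p.2.2.2
  let f₂ : ℕ × ℕ × ℕ → A := fun p => ξ 0 ^ p.1 * ξ 1 ^ (n - (p.1 + p.2.1 + p.2.2)) * ξ 2 ^ p.2.1 *
    ξ 4 ^ p.2.2
  have hsub : stdMonSet q d ξ n ⊆ ((S₁.image f₁ ∪ S₂.image f₂ : Finset A) : Set A) := by
    rintro _ ⟨a, b, c, e, f, h, hf, hc, hb, rfl⟩
    rw [Finset.coe_union, Finset.coe_image, Finset.coe_image]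
    by_cases hb' : b < q ^ 3
    · left
      refine ⟨(a, b, c, f), ?_, ?_⟩
      · simp [S₁]; omega
      · simp only [f₁]
        rw [show n - (a + b + c + f) = e by omega]
    · right
      obtain rfl := hb.resolve_left hb'
      refine ⟨(a, c, f), ?_, ?_⟩
      · simp [S₂]; omega
      · simp only [f₂]
        rw [show n - (a + c + f) = b by omega]; ring
  have h₁ : (S₁.image f₁).card ≤ (n + 1) * (q ^ 3 * ((q + 1) * d)) := by
    refine Finset.card_image_le.trans ?_
    simp [S₁]
  have h₂ : (S₂.image f₂).card ≤ (n + 1) * ((q + 1) * d) := by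
    refine Finset.card_image_le.trans ?_
    simp [S₂]
  refine (Submodule.finrank_mono (Submodule.span_mono hsub)).trans
    ((finrank_span_finset_le_card _).trans ((Finset.card_union_le _ _).trans
      ((add_le_add h₁ h₂).trans_eq (by ring))))

theorem finrank_degSpan_le {q d : ℕ} (hq : 2 ≤ q) (hd : 0 < d) {ξ : Fin 5 → A}
    {θ : Fin 5 → L} (hθ : ∑ i, θ i • ξ i = 1) (h₁ : herm q ξ = 0) (h₃ : herm (q ^ 3) ξ = 0)
    {G : MvPolynomial (Fin 5) L} (hGd : G.IsHomogeneous d)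
    (hG4 : G.coeff (Finsupp.single 4 d) ≠ 0) (hG : aeval ξ G = 0) (n : ℕ) :
    Module.finrank L (degSpan L ξ n) ≤
      (d * (q + 1) * (q ^ 3 + 1)) * n + d * (q + 1) * (q ^ 3 + 1) := by
  refine le_trans ?_ (finrank_span_stdMonSet_le (L := L) q d ξ n)
  have hle := degSpan_le_span_stdMonSet hq hd hθ h₁ h₃ hGd hG4 hG n
  have hge : Submodule.span L (stdMonSet q d ξ n) ≤ degSpan L ξ n := by
    rw [Submodule.span_le]
    rintro _ ⟨a, b, c, e, f, h, -, -, -, rfl⟩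
    have h' : ∀ (i : Fin 5) (k : ℕ), ξ i ^ k ∈ degSpan L ξ k := fun i k => by
      simpa using pow_mem_degSpan ξ (self_mem_degSpan (L := L) ξ i) k
    rw [← h]
    exact mul_mem_degSpan ξ (mul_mem_degSpan ξ (mul_mem_degSpan ξ (mul_mem_degSpan ξ (h' 0 a)
      (h' 1 b)) (h' 2 c)) (h' 3 e)) (h' 4 f)
  rw [le_antisymm hle hge]

end Degree

section Coefficients

variable {F A : Type*} [Field F] [CommRing A] [Algebra F A]

theorem coeff_aeval_mem {d : ℕ} {G : MvPolynomial (Fin 5) F} (hG : G.IsHomogeneous d)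
    (M : ℕ → ℕ → Submodule F A) (h₁ : (1 : A) ∈ M 0 0)
    (hmul : ∀ e i e' j, ∀ x ∈ M e i, ∀ y ∈ M e' j, x * y ∈ M (e + e') (i + j))
    {P : Fin 5 → Polynomial A} (hP : ∀ i n, (P i).coeff n ∈ M 1 n) (n : ℕ) :
    (aeval P G).coeff n ∈ M d n := by
  have mul : ∀ e e' (u v : Polynomial A), (∀ n, u.coeff n ∈ M e n) → (∀ n, v.coeff n ∈ M e' n) →
      ∀ n, (u * v).coeff n ∈ M (e + e') n := by
    intro e e' u v hu hv n
    rw [Polynomial.coeff_mul]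
    refine Submodule.sum_mem _ fun p hp => ?_
    rw [← Finset.HasAntidiagonal.mem_antidiagonal.1 hp]
    exact hmul _ _ _ _ _ (hu _) _ (hv _)
  have one : ∀ n, (1 : Polynomial A).coeff n ∈ M 0 n := by
    rintro (_ | n)
    · simpa using h₁
    · simp [Polynomial.coeff_one]
  have pow : ∀ i k n, (P i ^ k).coeff n ∈ M k n := by
    intro i k
    induction k with
    | zero => simpa using one
    | succ k ih => rw [pow_succ]; exact mul _ _ _ _ ih (hP i)
  rw [aeval_def, eval₂_eq', Polynomial.finsetSum_coeff]
  refine Submodule.sum_mem _ fun s hs => ?_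
  have hd := hG (mem_support_iff.1 hs)
  rw [Pi.one_def, ← Finsupp.degree_eq_weight_one, Finsupp.degree_eq_sum] at hd
  rw [IsScalarTower.algebraMap_apply F A (Polynomial A), Polynomial.algebraMap_eq,
    Polynomial.coeff_C_mul, ← Algebra.smul_def, ← hd]
  apply Submodule.smul_mem
  clear hd hs
  revert n
  refine Finset.induction_on (Finset.univ : Finset (Fin 5)) (by simpa using one) ?_
  intro i t hi ih
  rw [Finset.prod_insert hi, Finset.sum_insert hi]
  exact mul _ _ _ _ (pow _ _) ih

theorem coeff_aeval_eq_zero_of_lt {d : ℕ} {G : MvPolynomial (Fin 5) F} (hG : G.IsHomogeneous d)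
    (x y : Fin 5 → A) {n : ℕ} (hn : d < n) :
    (aeval (fun i => Polynomial.C (x i) + Polynomial.X * Polynomial.C (y i)) G).coeff n = 0 := by
  have := coeff_aeval_mem hG (fun e n => if n ≤ e then (⊤ : Submodule F A) else ⊥) (by simp) ?_
    (P := fun i => Polynomial.C (x i) + Polynomial.X * Polynomial.C (y i)) ?_ n
  · simpa [hn.not_ge] using this
  · intro e i e' j u hu v hv
    by_cases h1 : i ≤ e <;> by_cases h2 : j ≤ e' <;> simp_all [add_le_add]
  · rintro i (_ | _ | n) <;> simp [Polynomial.coeff_X, Polynomial.coeff_C]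

theorem aeval_mul_of_isHomogeneous {d : ℕ} {G : MvPolynomial (Fin 5) F} (hG : G.IsHomogeneous d)
    (c : A) (x : Fin 5 → A) : aeval (fun i => c * x i) G = c ^ d * aeval x G := by
  rw [aeval_def, aeval_def, eval₂_eq', eval₂_eq', Finset.mul_sum]
  refine Finset.sum_congr rfl fun s hs => ?_
  have hd := hG (mem_support_iff.1 hs)
  rw [Pi.one_def, ← Finsupp.degree_eq_weight_one, Finsupp.degree_eq_sum] at hd
  simp only [mul_pow]
  rw [Finset.prod_mul_distrib, Finset.prod_pow_eq_pow_sum, hd]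
  ring

theorem reflect_aeval {d : ℕ} {G : MvPolynomial (Fin 5) F} (hG : G.IsHomogeneous d)
    (x y : Fin 5 → A) :
    (aeval (fun i => Polynomial.C (x i) + Polynomial.X * Polynomial.C (y i)) G).reflect d =
      aeval (fun i => Polynomial.C (y i) + Polynomial.X * Polynomial.C (x i)) G := by
  have hdeg : ∀ i, (Polynomial.C (x i) + Polynomial.X * Polynomial.C (y i)).natDegree ≤ 1 := by
    intro i
    compute_degree
  have refl : ∀ i, (Polynomial.C (x i) + Polynomial.X * Polynomial.C (y i)).reflect 1 =
      Polynomial.C (y i) + Polynomial.X * Polynomial.C (x i) := by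
    intro i
    rw [Polynomial.reflect_add, Polynomial.reflect_C, mul_comm Polynomial.X,
      Polynomial.reflect_C_mul, Polynomial.reflect_one_X, pow_one]
    ring
  have pow : ∀ i k, ((Polynomial.C (x i) + Polynomial.X * Polynomial.C (y i)) ^ k).natDegree ≤ k ∧
      ((Polynomial.C (x i) + Polynomial.X * Polynomial.C (y i)) ^ k).reflect k =
      (Polynomial.C (y i) + Polynomial.X * Polynomial.C (x i)) ^ k := by
    intro i k
    induction k with
    | zero => simp
    | succ k ih =>
      rw [pow_succ, pow_succ, Polynomial.reflect_mul _ _ ih.1 (hdeg i), ih.2, refl]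
      exact ⟨Polynomial.natDegree_mul_le_of_le ih.1 (hdeg i), rfl⟩
  rw [aeval_def, aeval_def, eval₂_eq', eval₂_eq']
  ext n
  rw [Polynomial.coeff_reflect, Polynomial.finsetSum_coeff, Polynomial.finsetSum_coeff]
  refine Finset.sum_congr rfl fun s hs => ?_
  have hd := hG (mem_support_iff.1 hs)
  rw [Pi.one_def, ← Finsupp.degree_eq_weight_one, Finsupp.degree_eq_sum] at hd
  rw [IsScalarTower.algebraMap_apply F A (Polynomial A), Polynomial.algebraMap_eq,
    Polynomial.coeff_C_mul, Polynomial.coeff_C_mul, ← hd, ← Polynomial.coeff_reflect]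
  congr 2
  refine (Finset.induction_on (Finset.univ : Finset (Fin 5)) (motive := fun t =>
    (∏ i ∈ t, (Polynomial.C (x i) + Polynomial.X * Polynomial.C (y i)) ^ s i).natDegree ≤
        ∑ i ∈ t, s i ∧
      (∏ i ∈ t, (Polynomial.C (x i) + Polynomial.X * Polynomial.C (y i)) ^ s i).reflect
        (∑ i ∈ t, s i) =
      ∏ i ∈ t, (Polynomial.C (y i) + Polynomial.X * Polynomial.C (x i)) ^ s i) (by simp) ?_).2
  intro i t hi ih
  rw [Finset.prod_insert hi, Finset.prod_insert hi, Finset.sum_insert hi,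
    Polynomial.reflect_mul _ _ (pow _ _).1 ih.1, (pow _ _).2, ih.2]
  exact ⟨Polynomial.natDegree_mul_le_of_le (pow _ _).1 ih.1, rfl⟩

theorem coeff_zero_aeval (G : MvPolynomial (Fin 5) F) (x y : Fin 5 → A) :
    (aeval (fun i => Polynomial.C (x i) + Polynomial.X * Polynomial.C (y i)) G).coeff 0 =
      aeval x G := by
  rw [Polynomial.coeff_zero_eq_aeval_zero]
  have := (comp_aeval_apply (fun i => Polynomial.C (x i) + Polynomial.X * Polynomial.C (y i))
    ((Polynomial.aeval (0 : A)).restrictScalars F) G)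
  simpa using this

theorem coeff_aeval_self {d : ℕ} {G : MvPolynomial (Fin 5) F} (hG : G.IsHomogeneous d)
    (x y : Fin 5 → A) :
    (aeval (fun i => Polynomial.C (x i) + Polynomial.X * Polynomial.C (y i)) G).coeff d =
      aeval y G := by
  rw [← coeff_zero_aeval G y x, ← reflect_aeval hG, Polynomial.coeff_reflect]
  simp

end Coefficients

section Polar

variable {F A : Type*} [Field F] [CommRing A] [Algebra F A]

/-- The polynomial `G (y + X v)`. -/
def pencil (G : MvPolynomial (Fin 5) F) (y v : Fin 5 → A) : Polynomial A :=
  aeval (fun i => Polynomial.C (y i) + Polynomial.X * Polynomial.C (v i)) G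

theorem map_pencil {B : Type*} [CommRing B] [Algebra F B] (φ : A →ₐ[F] B)
    (G : MvPolynomial (Fin 5) F) (y v : Fin 5 → A) :
    (pencil G y v).map (φ : A →+* B) = pencil G (fun i => φ (y i)) fun i => φ (v i) := by
  have := comp_aeval_apply (fun i => Polynomial.C (y i) + Polynomial.X * Polynomial.C (v i))
    (Polynomial.mapAlgHom φ) G
  simpa [pencil] using this

theorem coeff_pencil_map {B : Type*} [CommRing B] [Algebra F B] (φ : A →ₐ[F] B)
    (G : MvPolynomial (Fin 5) F) (y v : Fin 5 → A) (n : ℕ) :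
    (pencil G (fun i => φ (y i)) fun i => φ (v i)).coeff n = φ ((pencil G y v).coeff n) := by
  rw [← map_pencil, Polynomial.coeff_map]; rfl

theorem pencil_add_mul (G : MvPolynomial (Fin 5) F) (y v : Fin 5 → A) (a : A) :
    pencil G (fun i => y i + a * v i) v = (pencil G y v).comp (Polynomial.X + Polynomial.C a) := by
  have := comp_aeval_apply (fun i => Polynomial.C (y i) + Polynomial.X * Polynomial.C (v i))
    ((Polynomial.aeval (Polynomial.X + Polynomial.C a : Polynomial A)).restrictScalars F) G
  simp only [AlgHom.restrictScalars_apply, ← Polynomial.comp_eq_aeval] at this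
  rw [pencil, pencil, this]
  congr 2
  ext1 i
  simp
  ring

theorem coeff_pencil_mul_right (G : MvPolynomial (Fin 5) F) (y v : Fin 5 → A) (a : A) (n : ℕ) :
    (pencil G y fun i => a * v i).coeff n = (pencil G y v).coeff n * a ^ n := by
  have := comp_aeval_apply (fun i => Polynomial.C (y i) + Polynomial.X * Polynomial.C (v i))
    ((Polynomial.aeval (Polynomial.C a * Polynomial.X : Polynomial A)).restrictScalars F) G
  simp only [AlgHom.restrictScalars_apply, ← Polynomial.comp_eq_aeval] at this
  rw [← Polynomial.comp_C_mul_X_coeff, pencil, pencil, this]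
  congr 3
  ext1 i
  simp
  ring

theorem pencil_mul {d : ℕ} {G : MvPolynomial (Fin 5) F} (hG : G.IsHomogeneous d)
    (y v : Fin 5 → A) (a : A) :
    pencil G (fun i => a * y i) (fun i => a * v i) = Polynomial.C (a ^ d) * pencil G y v := by
  rw [pencil, pencil, Polynomial.C_pow, ← aeval_mul_of_isHomogeneous hG]
  congr 2
  ext1 i
  simp
  ring

theorem coeff_pencil_mem {d : ℕ} {G : MvPolynomial (Fin 5) F} (hG : G.IsHomogeneous d)
    {y : Fin 5 → A} (v : Fin 5 → A) {I : Ideal A} (hy : ∀ i, y i ∈ I) (n : ℕ) :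
    (pencil G y v).coeff n ∈ I ^ (d - n) := by
  refine coeff_aeval_mem hG (fun e n => (I ^ (e - n)).restrictScalars F) (by simp) ?_ ?_ n
  · intro e i e' j a ha b hb
    have := Ideal.mul_mem_mul ha hb
    rw [← pow_add] at this
    exact Ideal.pow_le_pow_right (by omega) this
  · rintro i (_ | _ | n)
    · simpa using hy i
    · simp
    · simp

theorem pencil_eq_zero_of_nilpotent {d : ℕ} {G : MvPolynomial (Fin 5) F} (hG : G.IsHomogeneous d)
    {y v : Fin 5 → A} (hv : aeval v G = 0) {k : ℕ}
    (h₁ : ∀ n < d - k, (pencil G y v).coeff n = 0)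
    (h₂ : ∀ n < k, (pencil G (fun i => y i + v i) v).coeff n = 0) (hk : k ≤ d) :
    pencil G y v = 0 := by
  nontriviality A
  have h1 : Polynomial.X ^ (d - k) ∣ pencil G y v := Polynomial.X_pow_dvd_iff.2 h₁
  have h2 : (Polynomial.X - Polynomial.C 1) ^ k ∣ pencil G y v := by
    have h3 : Polynomial.X ^ k ∣ pencil G (fun i => y i + v i) v := Polynomial.X_pow_dvd_iff.2 h₂
    have h4 := pencil_add_mul G y v 1
    simp only [one_mul] at h4
    rw [h4] at h3
    obtain ⟨r, hr⟩ := h3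
    refine ⟨r.comp (Polynomial.X - Polynomial.C 1), ?_⟩
    have := congrArg (fun p : Polynomial A => p.comp (Polynomial.X - Polynomial.C 1)) hr
    simpa [Polynomial.comp_assoc] using this
  have hco : IsCoprime (Polynomial.X ^ (d - k)) ((Polynomial.X - Polynomial.C (1 : A)) ^ k) := by
    apply IsCoprime.pow
    exact ⟨1, -1, by simp⟩
  have h5 := hco.mul_dvd h1 h2
  by_contra hne
  have hmon : (Polynomial.X ^ (d - k) * (Polynomial.X - Polynomial.C (1 : A)) ^ k).Monic :=
    (Polynomial.monic_X_pow _).mul ((Polynomial.monic_X_sub_C _).pow _)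
  refine hmon.not_dvd_of_degree_lt hne ?_ h5
  have hdeg : (Polynomial.X ^ (d - k) * (Polynomial.X - Polynomial.C (1 : A)) ^ k).natDegree =
      d := by
    rw [(Polynomial.monic_X_pow _).natDegree_mul ((Polynomial.monic_X_sub_C _).pow _),
      (Polynomial.monic_X_sub_C (1 : A)).natDegree_pow, Polynomial.natDegree_X_pow,
      Polynomial.natDegree_X_sub_C]
    omega
  rw [Polynomial.degree_eq_natDegree hmon.ne_zero, hdeg, Polynomial.degree_lt_iff_coeff_zero]
  intro m hm
  obtain rfl | hm := hm.eq_or_lt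
  · rw [pencil, coeff_aeval_self hG, hv]
  · exact coeff_aeval_eq_zero_of_lt hG y v hm

end Polar

section PolarCoeff

variable {F A : Type*} [Field F] [Fintype F] [CommRing A] [Algebra F A]

/-- The coefficients of the polynomial `G (x + X Φ x)`, where `Φ` is the Frobenius over `F`. -/
def polarCoeff (G : MvPolynomial (Fin 5) F) (x : Fin 5 → A) (n : ℕ) : A :=
  (pencil G x fun i => x i ^ Fintype.card F).coeff n

theorem polarCoeff_map {B : Type*} [CommRing B] [Algebra F B] (φ : A →ₐ[F] B)
    (G : MvPolynomial (Fin 5) F) (x : Fin 5 → A) (n : ℕ) :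
    polarCoeff G (fun i => φ (x i)) n = φ (polarCoeff G x n) := by
  rw [polarCoeff, polarCoeff, ← coeff_pencil_map]
  simp

theorem polarCoeff_mul {d : ℕ} {G : MvPolynomial (Fin 5) F} (hG : G.IsHomogeneous d)
    (a : A) (x : Fin 5 → A) (n : ℕ) :
    polarCoeff G (fun i => a * x i) n =
      a ^ (d + n * (Fintype.card F - 1)) * polarCoeff G x n := by
  have h : (fun i => (a * x i) ^ Fintype.card F) =
      fun i => a * (a ^ (Fintype.card F - 1) * x i ^ Fintype.card F) := by
    ext1 i
    rw [mul_pow, ← mul_assoc, ← pow_succ', Nat.sub_add_cancel Fintype.card_pos]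
  rw [polarCoeff, h, pencil_mul hG, Polynomial.coeff_C_mul, coeff_pencil_mul_right, polarCoeff,
    ← pow_mul]
  ring

theorem polarCoeff_mem_degSpan {L : Type*} [Field L] [Algebra F L] [Algebra L A]
    [IsScalarTower F L A] {d : ℕ} {G : MvPolynomial (Fin 5) F} (hG : G.IsHomogeneous d)
    (ξ : Fin 5 → A) (n : ℕ) :
    polarCoeff G ξ n ∈ degSpan L ξ (d + n * (Fintype.card F - 1)) := by
  refine coeff_aeval_mem hG (fun e n =>
    (degSpan L ξ (e + n * (Fintype.card F - 1))).restrictScalars F) ?_ ?_ ?_ n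
  · simpa using pow_mem_degSpan (L := L) ξ (self_mem_degSpan ξ 0) 0
  · intro e i e' j a ha b hb
    have := mul_mem_degSpan ξ ha hb
    refine degSpan_mono ξ ?_ this
    rw [add_mul]
    omega
  · intro i n
    beta_reduce
    generalize hz : ξ i ^ Fintype.card F = z
    rcases n with _ | _ | n
    · simpa using self_mem_degSpan ξ i
    · have := pow_mem_degSpan ξ (self_mem_degSpan (L := L) ξ i) (Fintype.card F)
      rw [hz] at this
      simpa [Nat.add_sub_cancel' (Fintype.card_pos (α := F))] using this
    · simp

/-- The ideal of the point with coordinates `v`. -/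
def pointIdeal (x : Fin 5 → A) (v : Fin 5 → F) : Ideal A :=
  Ideal.span (Set.range fun i => x i - algebraMap F A (v i))

omit [Fintype F] in
theorem sub_mem_pointIdeal (x : Fin 5 → A) (v : Fin 5 → F) (i : Fin 5) :
    x i - algebraMap F A (v i) ∈ pointIdeal x v :=
  Ideal.subset_span ⟨i, rfl⟩

theorem pow_card_sub (a : A) (c : F) :
    a ^ Fintype.card F - algebraMap F A c = (a - algebraMap F A c) ^ Fintype.card F := by
  have := map_sub (FiniteField.frobeniusAlgHom F A) a (algebraMap F A c)
  rw [AlgHom.commutes] at this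
  exact this.symm

theorem pencil_eq_zero_of_polarCoeff {d : ℕ} {G : MvPolynomial (Fin 5) F}
    (hG : G.IsHomogeneous d) {x : Fin 5 → A} {v : Fin 5 → F} (hv : eval v G = 0) {k : ℕ}
    (hk : k ≤ d) {I : Ideal A} (hI : k < d → pointIdeal x v ^ (k + 1) ≤ I)
    (hIQ : pointIdeal x v ^ Fintype.card F ≤ I) (h : ∀ n < k, polarCoeff G x n ∈ I) (n : ℕ) :
    (pencil G (fun i => x i - algebraMap F A (v i)) fun i => algebraMap F A (v i)).coeff n ∈ I ∧
      polarCoeff G x n ∈ I := by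
  have hx : ∀ i, Ideal.Quotient.mkₐ F I (x i) ^ Fintype.card F = algebraMap F (A ⧸ I) (v i) := by
    intro i
    rw [← sub_eq_zero, pow_card_sub, ← (Ideal.Quotient.mkₐ F I).commutes, ← map_sub, ← map_pow]
    exact Ideal.Quotient.eq_zero_iff_mem.2 (hIQ (Ideal.pow_mem_pow (sub_mem_pointIdeal x v i) _))
  have key : pencil G (fun i => Ideal.Quotient.mkₐ F I (x i - algebraMap F A (v i)))
      (fun i => Ideal.Quotient.mkₐ F I (algebraMap F A (v i))) = 0 := by
    refine pencil_eq_zero_of_nilpotent hG (k := k) ?_ ?_ ?_ hk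
    · have := aeval_algebraMap_apply (A ⧸ I) v G
      rw [aeval_eq_eval] at this
      erw [hv, map_zero] at this
      simpa [Function.comp_def] using this
    · intro n hn
      rw [coeff_pencil_map]
      refine Ideal.Quotient.eq_zero_iff_mem.2 (hI (by omega) (Ideal.pow_le_pow_right (by omega)
        (coeff_pencil_mem hG _ (sub_mem_pointIdeal x v) n)))
    · intro n hn
      have := polarCoeff_map (Ideal.Quotient.mkₐ F I) G x n
      simp only [polarCoeff, hx] at this
      simp only [map_sub, AlgHom.commutes, sub_add_cancel]
      rw [this]
      exact Ideal.Quotient.eq_zero_iff_mem.2 (h n hn)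
  constructor
  · apply Ideal.Quotient.eq_zero_iff_mem.1
    have := coeff_pencil_map (Ideal.Quotient.mkₐ F I) G (fun i => x i - algebraMap F A (v i))
      (fun i => algebraMap F A (v i)) n
    rw [key, Polynomial.coeff_zero] at this
    exact this.symm
  · apply Ideal.Quotient.eq_zero_iff_mem.1
    have := polarCoeff_map (Ideal.Quotient.mkₐ F I) G x n
    have h2 := pencil_add_mul G (fun i => Ideal.Quotient.mkₐ F I (x i - algebraMap F A (v i)))
      (fun i => Ideal.Quotient.mkₐ F I (algebraMap F A (v i))) 1
    rw [key] at h2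
    simp only [polarCoeff, hx] at this
    simp only [map_sub, AlgHom.commutes, sub_add_cancel, one_mul, Polynomial.zero_comp] at h2
    rw [h2, Polynomial.coeff_zero] at this
    exact this.symm

/-- The `2 × 2` minors of the matrix with rows `x` and `Φ x`. -/
def frobMinor (F : Type*) [Fintype F] (x : Fin 5 → A) (i j : Fin 5) : A :=
  x i * x j ^ Fintype.card F - x j * x i ^ Fintype.card F

theorem frobMinor_sub_mem (x : Fin 5 → A) (v : Fin 5 → F) (i j : Fin 5) :
    frobMinor F x i j - ((x i - algebraMap F A (v i)) * algebraMap F A (v j) -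
      (x j - algebraMap F A (v j)) * algebraMap F A (v i)) ∈ pointIdeal x v ^ 2 := by
  have h2 : ∀ i, x i ^ Fintype.card F - algebraMap F A (v i) ∈ pointIdeal x v ^ 2 := by
    intro i
    rw [pow_card_sub]
    exact Ideal.pow_le_pow_right (Fintype.one_lt_card (α := F))
      (Ideal.pow_mem_pow (sub_mem_pointIdeal x v i) _)
  have := Ideal.sub_mem _ (Ideal.mul_mem_left _ (x i) (h2 j)) (Ideal.mul_mem_left _ (x j) (h2 i))
  convert this using 1
  rw [frobMinor]
  ring

theorem frobMinor_mem (x : Fin 5 → A) (v : Fin 5 → F) (i j : Fin 5) :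
    frobMinor F x i j ∈ pointIdeal x v := by
  have := Ideal.add_mem _ (Ideal.pow_le_self two_ne_zero (frobMinor_sub_mem x v i j))
    (Ideal.sub_mem _ (Ideal.mul_mem_right (algebraMap F A (v j)) _ (sub_mem_pointIdeal x v i))
      (Ideal.mul_mem_right (algebraMap F A (v i)) _ (sub_mem_pointIdeal x v j)))
  simpa using this

theorem pointIdeal_le_of_frobMinor {x : Fin 5 → A} {v : Fin 5 → F} {e : Fin 5 → A} {u : A}
    (hu : IsUnit u) (hx : ∑ i, e i * x i = u) (hv : ∑ i, e i * algebraMap F A (v i) = u)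
    {𝔮 : Ideal A} (h : ∀ i j, frobMinor F x i j ∈ 𝔮) (n : ℕ) :
    pointIdeal x v ≤ 𝔮 ⊔ pointIdeal x v ^ n := by
  have h2 : pointIdeal x v ≤ 𝔮 ⊔ pointIdeal x v ^ 2 := by
    rw [pointIdeal, Ideal.span_le, ← pointIdeal]
    rintro _ ⟨i, rfl⟩
    have h3 : ∀ j, (x i - algebraMap F A (v i)) * algebraMap F A (v j) -
      (x j - algebraMap F A (v j)) * algebraMap F A (v i) ∈ 𝔮 ⊔ pointIdeal x v ^ 2 := by
      intro j
      have := Ideal.sub_mem _ (Ideal.mem_sup_left (h i j))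
        (Ideal.mem_sup_right (S := 𝔮) (frobMinor_sub_mem x v i j))
      simpa using this
    have h4 := Ideal.sum_mem (𝔮 ⊔ pointIdeal x v ^ 2) (t := Finset.univ)
      fun j _ => Ideal.mul_mem_left _ (e j) (h3 j)
    have h5 : ∑ j, e j * ((x i - algebraMap F A (v i)) * algebraMap F A (v j) -
      (x j - algebraMap F A (v j)) * algebraMap F A (v i)) =
        u * (x i - algebraMap F A (v i)) := by
      have : ∑ j, e j * ((x i - algebraMap F A (v i)) * algebraMap F A (v j) -
          (x j - algebraMap F A (v j)) * algebraMap F A (v i)) =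
          (∑ j, e j * algebraMap F A (v j)) * (x i - algebraMap F A (v i)) -
          (∑ j, e j * x j - ∑ j, e j * algebraMap F A (v j)) * algebraMap F A (v i) := by
        simp only [Finset.sum_mul, sub_mul, ← Finset.sum_sub_distrib]
        refine Finset.sum_congr rfl fun j _ => ?_
        ring
      rw [this, hx, hv]
      ring
    rw [h5] at h4
    exact (Ideal.unit_mul_mem_iff_mem _ hu).1 h4
  induction n with
  | zero => simp
  | succ n ih =>
    rcases n with _ | n
    · simp
    · refine h2.trans (sup_le le_sup_left ?_)
      rw [pow_two]
      refine (Ideal.mul_mono_left ih).trans ?_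
      rw [Ideal.sup_mul, pow_succ _ (n + 1)]
      exact sup_le_sup_right Ideal.mul_le_left _

end PolarCoeff

section Smooth

variable {F A : Type*} [Field F] [Fintype F] [CommRing A] [Algebra F A]

theorem add_pow_of_card_eq {q : ℕ} (hq : IsPrimePow q) (hF : Fintype.card F = q ^ 2)
    (x y : A) : (x + y) ^ q = x ^ q + y ^ q := by
  obtain ⟨p, k, hp, hk, rfl⟩ := hq
  have hp : p.Prime := hp.nat_prime
  nontriviality A
  have : (p : F) = 0 := by
    have : ((Fintype.card F : ℕ) : F) = 0 := by simp
    rw [hF] at this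
    push_cast at this
    exact pow_eq_zero_iff (by positivity) |>.1 (pow_eq_zero_iff two_ne_zero |>.1 this)
  have : CharP F p := by
    obtain ⟨p', hp'⟩ := CharP.exists F
    obtain rfl | rfl := hp.eq_one_or_self_of_dvd p' ((CharP.cast_eq_zero_iff F p' p).1 this)
    · exact absurd rfl (CharP.char_ne_one F 1)
    · exact hp'
  have : CharP A p := charP_of_injective_algebraMap (algebraMap F A).injective p
  have := Fact.mk hp
  exact add_pow_expChar_pow x y p k

theorem mem_range_of_pow_card {κ : Type*} [Field κ] [Algebra F κ] {a : κ}
    (h : a ^ Fintype.card F = a) : ∃ t, algebraMap F κ t = a := by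
  have hne := FiniteField.X_pow_card_sub_X_ne_zero F (Fintype.one_lt_card (α := F))
  have hs : (Polynomial.X ^ Fintype.card F - Polynomial.X : Polynomial F).Splits := by
    rw [Polynomial.splits_iff_card_roots, FiniteField.roots_X_pow_card_sub_X,
      FiniteField.X_pow_card_sub_X_natDegree_eq F (Fintype.one_lt_card (α := F))]
    rfl
  exact hs.mem_range_of_isRoot hne (i := algebraMap F κ) (by simp [h])

omit [Fintype F] in
theorem coeff_one_pencil (G : MvPolynomial (Fin 5) F) (y v : Fin 5 → A) :
    (pencil G v y).coeff 1 = ∑ i, y i * aeval v (pderiv i G) := by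
  induction G using MvPolynomial.induction_on with
  | C a => simp [pencil, IsScalarTower.algebraMap_apply F A (Polynomial A)]
  | add p p' h h' =>
    rw [pencil] at *
    simp only [map_add, Polynomial.coeff_add, h, mul_add, Finset.sum_add_distrib] at *
    rw [h']
  | mul_X p i h =>
    have h0 := coeff_zero_aeval p v y
    rw [pencil] at *
    simp only [map_mul, aeval_X, Polynomial.mul_coeff_one, h, h0, Derivation.leibniz,
      pderiv_X]
    simp [Pi.single_apply, mul_add, Finset.sum_add_distrib, Finset.sum_mul, apply_ite]
    rw [mul_comm (aeval v p)]
    congr 1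
    exact Finset.sum_congr rfl fun j _ => by ring

omit [Fintype F] in
theorem coeff_pencil_sub_one {d : ℕ} (hd : 0 < d) {G : MvPolynomial (Fin 5) F}
    (hG : G.IsHomogeneous d) (y v : Fin 5 → A) :
    (pencil G y v).coeff (d - 1) = ∑ i, y i * aeval v (pderiv i G) := by
  rw [← coeff_one_pencil, pencil, pencil, ← reflect_aeval hG, Polynomial.coeff_reflect,
    Polynomial.revAt_le (by omega), Nat.sub_sub_self hd]

omit [Fintype F] in
theorem cross_eq_zero_or {κ : Type*} [Field κ] {n c a b : Fin 3 → κ}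
    (h₁ : n 0 * a 0 + n 1 * a 1 + n 2 * a 2 = 0) (h₂ : n 0 * b 0 + n 1 * b 1 + n 2 * b 2 = 0)
    (h₃ : c 0 * a 0 + c 1 * a 1 + c 2 * a 2 = 0) (h₄ : c 0 * b 0 + c 1 * b 1 + c 2 * b 2 = 0) :
    (∀ i j, a i * b j = a j * b i) ∨ ∀ i j, n i * c j = n j * c i := by
  have key : ∀ n : Fin 3 → κ, n 0 * a 0 + n 1 * a 1 + n 2 * a 2 = 0 →
      n 0 * b 0 + n 1 * b 1 + n 2 * b 2 = 0 →
      n 0 * (a 2 * b 0 - a 0 * b 2) = n 1 * (a 1 * b 2 - a 2 * b 1) ∧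
      n 0 * (a 0 * b 1 - a 1 * b 0) = n 2 * (a 1 * b 2 - a 2 * b 1) ∧
      n 1 * (a 0 * b 1 - a 1 * b 0) = n 2 * (a 2 * b 0 - a 0 * b 2) := by
    intro n h₁ h₂
    refine ⟨?_, ?_, ?_⟩ <;> grind
  obtain ⟨k1, k2, k3⟩ := key n h₁ h₂
  obtain ⟨l1, l2, l3⟩ := key c h₃ h₄
  by_cases hp : a 1 * b 2 - a 2 * b 1 = 0 ∧ a 2 * b 0 - a 0 * b 2 = 0 ∧ a 0 * b 1 - a 1 * b 0 = 0
  · left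
    obtain ⟨p1, p2, p3⟩ := hp
    intro i j
    fin_cases i <;> fin_cases j <;> simp <;> grind
  · right
    generalize a 1 * b 2 - a 2 * b 1 = p0 at *
    generalize a 2 * b 0 - a 0 * b 2 = p1 at *
    generalize a 0 * b 1 - a 1 * b 0 = p2 at *
    clear h₁ h₂ h₃ h₄ key
    intro i j
    fin_cases i <;> fin_cases j <;> simp <;> grind

/-- The Hermitian form of the quotient of the tangent space by the point. -/
def hermThree {A : Type*} [CommRing A] (q : ℕ) (a : Fin 3 → A) : A :=
  a 0 ^ q * a 2 + a 0 * a 2 ^ q + a 1 ^ (q + 1)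

/-- The base point. -/
def basePt (A : Type*) [CommRing A] : Fin 5 → A := ![0, 0, 0, 0, 1]

theorem exists_isotropic_of_pencil_eq_zero {q : ℕ} (hq : IsPrimePow q)
    (hF : Fintype.card F = q ^ 2) {κ : Type*} [Field κ] [Algebra F κ] {d : ℕ} (hd : 0 < d)
    {G : MvPolynomial (Fin 5) F} (hG : G.IsHomogeneous d)
    (hc : eval (basePt F) (pderiv 1 G) ≠ 0 ∨ eval (basePt F) (pderiv 2 G) ≠ 0 ∨
      eval (basePt F) (pderiv 3 G) ≠ 0)
    {a : Fin 3 → κ} (ha : a ≠ 0) (hη : hermThree q a = 0)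
    (hpen : pencil G ![0, a 0, a 1, a 2, 0] (basePt κ) = 0) :
    ∃ t : Fin 3 → F, t ≠ 0 ∧ hermThree q t = 0 ∧
      ∀ α, eval ![0, t 0, t 1, t 2, α] G = 0 := by
  have hq0 : 0 < q := hq.pos
  have hbase : ∀ p : MvPolynomial (Fin 5) F, aeval (basePt κ) p =
      algebraMap F κ (eval (basePt F) p) := by
    intro p
    have := aeval_algebraMap_apply κ (basePt F) p
    rw [aeval_eq_eval] at this
    erw [← this]
    congr 2
    ext i
    fin_cases i <;> simp [basePt]
  set c : Fin 3 → F := ![eval (basePt F) (pderiv 1 G), eval (basePt F) (pderiv 2 G),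
      eval (basePt F) (pderiv 3 G)] with hcdef
  have hca : algebraMap F κ (c 0) * a 0 + algebraMap F κ (c 1) * a 1 +
      algebraMap F κ (c 2) * a 2 = 0 := by
    have := coeff_pencil_sub_one hd hG ![0, a 0, a 1, a 2, 0] (basePt κ)
    rw [hpen, Polynomial.coeff_zero, Fin.sum_univ_five] at this
    simp only [hbase] at this
    simp [hcdef]
    simp at this
    linear_combination -this
  have fr : ∀ x y : κ, (x + y) ^ Fintype.card F = x ^ Fintype.card F + y ^ Fintype.card F :=
    fun x y => map_add (FiniteField.frobeniusAlgHom F κ) x y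
  have frq : ∀ x y : κ, (x + y) ^ q = x ^ q + y ^ q := add_pow_of_card_eq hq hF
  have hca' : algebraMap F κ (c 0) * a 0 ^ Fintype.card F +
      algebraMap F κ (c 1) * a 1 ^ Fintype.card F +
      algebraMap F κ (c 2) * a 2 ^ Fintype.card F = 0 := by
    have := congrArg (· ^ Fintype.card F) hca
    simpa [fr, mul_pow, ← map_pow, FiniteField.pow_card] using this
  have hna : a 2 ^ q * a 0 + a 1 ^ q * a 1 + a 0 ^ q * a 2 = 0 := by
    rw [← hη, hermThree]
    ring
  have hna' : a 2 ^ q * a 0 ^ Fintype.card F + a 1 ^ q * a 1 ^ Fintype.card F +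
      a 0 ^ q * a 2 ^ Fintype.card F = 0 := by
    have := congrArg (· ^ q) hη
    simp only [hermThree, frq, zero_pow hq0.ne'] at this
    rw [hF, ← this]
    ring
  have hprop : ∀ i j, a i * a j ^ Fintype.card F = a j * a i ^ Fintype.card F := by
    obtain h | h := cross_eq_zero_or (n := ![a 2 ^ q, a 1 ^ q, a 0 ^ q])
      (c := fun i => algebraMap F κ (c i)) (a := a) (b := fun i => a i ^ Fintype.card F)
      hna hna' hca hca'
    · exact h
    · obtain ⟨k, hk⟩ : ∃ k, c k ≠ 0 := by
        rcases hc with h | h | h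
        exacts [⟨0, h⟩, ⟨1, h⟩, ⟨2, h⟩]
      have h2 : ∀ i, ![a 2 ^ q, a 1 ^ q, a 0 ^ q] i =
          algebraMap F κ (c i / c k) * ![a 2 ^ q, a 1 ^ q, a 0 ^ q] k := by
        intro i
        have := h i k
        rw [map_div₀]
        have hk' : algebraMap F κ (c k) ≠ 0 := by simpa using hk
        field_simp
        linear_combination this
      have h3 : ∀ i, ![a 2 ^ q, a 1 ^ q, a 0 ^ q] i ^ Fintype.card F =
          algebraMap F κ (c i / c k) * ![a 2 ^ q, a 1 ^ q, a 0 ^ q] k ^ Fintype.card F := by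
        intro i
        rw [h2 i, mul_pow, ← map_pow, FiniteField.pow_card]
      have h4 : ∀ i j, ![a 2 ^ q, a 1 ^ q, a 0 ^ q] i * ![a 2 ^ q, a 1 ^ q, a 0 ^ q] j ^
          Fintype.card F = ![a 2 ^ q, a 1 ^ q, a 0 ^ q] j *
          ![a 2 ^ q, a 1 ^ q, a 0 ^ q] i ^ Fintype.card F := by
        intro i j
        rw [h3 i, h3 j, h2 i, h2 j]
        ring
      have h5 : ∀ i j, (a i ^ q) * (a j ^ q) ^ Fintype.card F =
          (a j ^ q) * (a i ^ q) ^ Fintype.card F := by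
        intro i j
        have := h4 (Fin.rev i) (Fin.rev j)
        have h6 : ∀ i, ![a 2 ^ q, a 1 ^ q, a 0 ^ q] (Fin.rev i) = a i ^ q := by
          intro i
          fin_cases i <;> rfl
        simpa only [h6] using this
      intro i j
      have hsub : (a i * a j ^ Fintype.card F - a j * a i ^ Fintype.card F) ^ q = 0 := by
        have h6 := frq (a i * a j ^ Fintype.card F - a j * a i ^ Fintype.card F)
          (a j * a i ^ Fintype.card F)
        rw [sub_add_cancel] at h6
        have h7 := h5 i j
        simp only [mul_pow, ← pow_mul, mul_comm q] at h6 h7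
        rw [h7] at h6
        simpa using h6
      exact sub_eq_zero.1 (pow_eq_zero_iff hq0.ne' |>.1 hsub)
  obtain ⟨j, hj⟩ : ∃ j, a j ≠ 0 := Function.ne_iff.1 ha
  have ht : ∀ i, ∃ t, algebraMap F κ t = a i / a j := by
    intro i
    apply mem_range_of_pow_card
    rw [div_pow, div_eq_div_iff (pow_ne_zero _ hj) hj]
    linear_combination hprop j i
  choose t ht using ht
  have hta : ∀ i, a i = a j * algebraMap F κ (t i) := by
    intro i
    rw [ht, mul_div_cancel₀ _ hj]
  refine ⟨t, ?_, ?_, ?_⟩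
  · intro h0
    have := hta j
    simp [h0, hj] at this
  · have h1 : a j ^ (q + 1) * algebraMap F κ (hermThree q t) = 0 := by
      rw [← hη, hermThree, hermThree, hta 0, hta 1, hta 2]
      simp only [map_add, map_mul, map_pow]
      ring
    simpa [hj] using h1
  · intro α
    have h1 := congrArg (Polynomial.aeval (a j * algebraMap F κ α)) hpen
    have h2 := comp_aeval_apply (fun i => Polynomial.C ((![0, a 0, a 1, a 2, 0] : Fin 5 → κ) i) +
      Polynomial.X * Polynomial.C (basePt κ i))
      ((Polynomial.aeval (a j * algebraMap F κ α)).restrictScalars F) G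
    rw [pencil] at h1
    rw [AlgHom.restrictScalars_apply, h1, map_zero] at h2
    have h3 := aeval_mul_of_isHomogeneous hG (a j) fun i =>
      algebraMap F κ ((![0, t 0, t 1, t 2, α] : Fin 5 → F) i)
    have h4 : (fun i => a j * algebraMap F κ ((![0, t 0, t 1, t 2, α] : Fin 5 → F) i)) =
        fun i => (AlgHom.restrictScalars F (Polynomial.aeval (a j * algebraMap F κ α)))
          (Polynomial.C ((![0, a 0, a 1, a 2, 0] : Fin 5 → κ) i) +
            Polynomial.X * Polynomial.C (basePt κ i)) := by
      ext i
      fin_cases i <;> simp [basePt, ← hta]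
    rw [h4, ← h2] at h3
    have h5 := aeval_algebraMap_apply κ (![0, t 0, t 1, t 2, α] : Fin 5 → F) G
    rw [aeval_eq_eval] at h5
    have h6 := (mul_eq_zero_iff_left (pow_ne_zero d hj)).1 h3.symm
    erw [h5] at h6
    simpa using h6

end Smooth

universe u

section Valuation

theorem exists_valuationRing {A : Type u} [CommRing A] {𝔮 𝔪 : Ideal A} [h𝔮 : 𝔮.IsPrime]
    [h𝔪 : 𝔪.IsPrime] (h : 𝔮 ≤ 𝔪) :
    ∃ (K : Type u) (_ : Field K) (O : ValuationSubring K) (ψ : A →+* O),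
      (∀ a, ψ a = 0 ↔ a ∈ 𝔮) ∧ ∀ a ∈ 𝔪, ψ a ∈ IsLocalRing.maximalIdeal O := by
  have hker : ∀ a, algebraMap A (FractionRing (A ⧸ 𝔮)) a = 0 ↔ a ∈ 𝔮 := by
    intro a
    rw [IsScalarTower.algebraMap_apply A (A ⧸ 𝔮), FaithfulSMul.algebraMap_eq_zero_iff]
    exact Ideal.Quotient.eq_zero_iff_mem
  have hunit : ∀ y : 𝔪.primeCompl, IsUnit (algebraMap A (FractionRing (A ⧸ 𝔮)) y) := by
    rintro ⟨y, hy⟩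
    rw [isUnit_iff_ne_zero, ne_eq, hker]
    exact fun hy' => hy (h hy')
  let f : Localization.AtPrime 𝔪 →+* FractionRing (A ⧸ 𝔮) :=
    IsLocalization.lift (M := 𝔪.primeCompl) hunit
  obtain ⟨O, hO, hloc⟩ := IsLocalRing.exists_factor_valuationRing f
  refine ⟨FractionRing (A ⧸ 𝔮), inferInstance, O,
    (f.codRestrict O.toSubring hO).comp (algebraMap A (Localization.AtPrime 𝔪)), ?_, ?_⟩
  · intro a
    rw [← hker, ← Subtype.coe_inj]
    simp only [RingHom.comp_apply, RingHom.codRestrict_apply, ZeroMemClass.coe_zero]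
    rw [show f (algebraMap A _ a) = algebraMap A _ a from IsLocalization.lift_eq hunit a]
  · intro a ha hu
    have := (IsLocalization.AtPrime.to_map_mem_maximal_iff (Localization.AtPrime 𝔪) 𝔪 a).2 ha
    exact this (hloc.map_nonunit _ hu)

theorem ValuationRing.exists_dvd_all {O : Type*} [CommRing O] [IsDomain O] [ValuationRing O]
    (a : Fin 3 → O) : ∃ j, ∀ i, a j ∣ a i := by
  obtain h | h := ValuationRing.dvd_total (a 0) (a 1) <;>
  obtain h' | h' := ValuationRing.dvd_total (a 0) (a 2) <;>
  obtain h'' | h'' := ValuationRing.dvd_total (a 1) (a 2)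
  · exact ⟨0, by simp [Fin.forall_fin_succ, *]⟩
  · exact ⟨0, by simp [Fin.forall_fin_succ, *]⟩
  · exact ⟨2, by simp [Fin.forall_fin_succ, *, h'.trans h]⟩
  · exact ⟨2, by simp [Fin.forall_fin_succ, *]⟩
  · exact ⟨1, by simp [Fin.forall_fin_succ, *]⟩
  · exact ⟨1, by simp [Fin.forall_fin_succ, *, h.trans h']⟩
  · exact ⟨1, by simp [Fin.forall_fin_succ, *]⟩
  · exact ⟨2, by simp [Fin.forall_fin_succ, *]⟩

variable {F : Type*} [Field F] [Fintype F]

theorem exists_isotropic_of_valuationRing {q : ℕ} (hq : IsPrimePow q)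
    (hF : Fintype.card F = q ^ 2) {O : Type*} [CommRing O] [IsDomain O] [ValuationRing O]
    [Algebra F O] {d : ℕ} (hd : 0 < d) (hdq : d ≤ q) {G : MvPolynomial (Fin 5) F}
    (hG : G.IsHomogeneous d)
    (hc : eval (basePt F) (pderiv 1 G) ≠ 0 ∨ eval (basePt F) (pderiv 2 G) ≠ 0 ∨
      eval (basePt F) (pderiv 3 G) ≠ 0)
    {z e : Fin 5 → O} (hz₁ : herm q z = 0) (hz₃ : herm (q ^ 3) z = 0)
    (he : ∑ i, e i * z i = 1) (he4 : e 4 = 1)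
    (hz : ∀ i, z i - basePt O i ∈ IsLocalRing.maximalIdeal O)
    (hne : ∃ i, z i ≠ basePt O i)
    (hpen : ∀ n, (pencil G (fun i => z i - basePt O i) (basePt O)).coeff n ∈
      Ideal.span (Set.range fun i => z i - basePt O i) ^ Fintype.card F) :
    ∃ t : Fin 3 → F, t ≠ 0 ∧ hermThree q t = 0 ∧
      ∀ α, eval ![0, t 0, t 1, t 2, α] G = 0 := by
  have hq2 := hq.two_le
  obtain ⟨j, hj⟩ := ValuationRing.exists_dvd_all ![z 1, z 2, z 3]
  choose a ha using hj
  set t := (![z 1, z 2, z 3] : Fin 3 → O) j with ht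
  have hz1 : z 1 = t * a 0 := ha 0
  have hz2 : z 2 = t * a 1 := ha 1
  have hz3 : z 3 = t * a 2 := ha 2
  have htm : t ∈ IsLocalRing.maximalIdeal O := by
    have h1 := hz 1
    have h2 := hz 2
    have h3 := hz 3
    simp [basePt] at h1 h2 h3
    rw [ht]
    fin_cases j <;> simpa
  have hz0m : z 0 ∈ IsLocalRing.maximalIdeal O := by simpa [basePt] using hz 0
  have hz4u : IsUnit (z 4) := by
    by_contra h
    have h4 := hz 4
    have := Ideal.sub_mem _ ((IsLocalRing.mem_maximalIdeal _).2 h) h4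
    simp [basePt] at this
  obtain ⟨m, hm⟩ : ∃ m, q ^ 3 = q + 1 + (m + 1) := by
    have : 2 * (2 * q) ≤ q ^ 3 := by
      rw [pow_succ, pow_two, mul_assoc]
      exact Nat.mul_le_mul hq2 (Nat.mul_le_mul_right _ hq2)
    exact ⟨q ^ 3 - (q + 2), by omega⟩
  have hu : IsUnit (z 4 ^ q ^ 3 + z 0 ^ (q + 1 + m) * z 4) := by
    by_contra h
    have h5 := Ideal.sub_mem _ ((IsLocalRing.mem_maximalIdeal _).2 h)
      (Ideal.mul_mem_right (z 4) _ (Ideal.pow_mem_of_mem _ hz0m (q + 1 + m) (by omega)))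
    rw [add_sub_cancel_right] at h5
    exact (IsLocalRing.mem_maximalIdeal _).1 h5 (hz4u.pow _)
  obtain ⟨r, hr⟩ : ∃ r, z 0 = t ^ (q ^ 3 + 1) * r := by
    obtain ⟨w, hw⟩ := hu.exists_right_inv
    refine ⟨-(a 0 ^ q ^ 3 * a 2 + a 0 * a 2 ^ q ^ 3 + a 1 ^ (q ^ 3 + 1)) * w, ?_⟩
    have h6 : z 0 * (z 4 ^ q ^ 3 + z 0 ^ (q + 1 + m) * z 4) = -(t ^ (q ^ 3 + 1) *
        (a 0 ^ q ^ 3 * a 2 + a 0 * a 2 ^ q ^ 3 + a 1 ^ (q ^ 3 + 1))) := by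
      have h7 : z 0 ^ q ^ 3 = z 0 * z 0 ^ (q + 1 + m) := by rw [hm]; ring
      rw [herm, hz1, hz2, hz3, h7] at hz₃
      rw [← add_zero (-_), ← hz₃]
      ring
    calc z 0 = z 0 * (z 4 ^ q ^ 3 + z 0 ^ (q + 1 + m) * z 4) * w := by rw [mul_assoc, hw, mul_one]
      _ = _ := by rw [h6]; ring
  obtain ⟨b, hb⟩ : ∃ b, z 4 = 1 + t * b := by
    refine ⟨-(e 0 * (t ^ q ^ 3 * r) + e 1 * a 0 + e 2 * a 1 + e 3 * a 2), ?_⟩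
    rw [Fin.sum_univ_five, he4, hr, hz1, hz2, hz3] at he
    rw [← he]
    ring
  have ht0 : t ≠ 0 := by
    intro h
    obtain ⟨i, hi⟩ := hne
    apply hi
    fin_cases i <;> simp [basePt, hr, hz1, hz2, hz3, hb, h]
  have haj : a j = 1 := by
    have := ha j
    rw [← ht] at this
    exact (mul_eq_left₀ ht0).1 this.symm
  have hη : hermThree q a ∈ IsLocalRing.maximalIdeal O := by
    have h7 : z 0 ^ q = z 0 * z 0 ^ (q - 1) := by rw [← pow_succ', Nat.sub_add_cancel hq.pos]
    have h8 : z 0 = t ^ (q + 1) * (t * (t ^ (m + 1) * r)) := by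
      rw [hr, hm]
      ring
    have h9 : hermThree q a = t * -(t ^ (m + 1) * r * (z 4 ^ q + z 0 ^ (q - 1) * z 4)) := by
      apply mul_left_cancel₀ (pow_ne_zero (q + 1) ht0)
      rw [herm, h7, hz1, hz2, hz3] at hz₁
      rw [hermThree]
      linear_combination hz₁ - (z 4 ^ q + z 0 ^ (q - 1) * z 4) * h8
    rw [h9]
    exact Ideal.mul_mem_right _ _ htm
  have hpenu : ∀ n, (pencil G ![t ^ q ^ 3 * r, a 0, a 1, a 2, b] (basePt O)).coeff n ∈
      IsLocalRing.maximalIdeal O := by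
    intro n
    have h1 : (fun i => t * (![t ^ q ^ 3 * r, a 0, a 1, a 2, b] : Fin 5 → O) i) =
        fun i => z i - basePt O i := by
      ext i
      fin_cases i <;> simp [basePt, hr, hz1, hz2, hz3, hb]
      ring
    have h2 := congrArg (Polynomial.coeff · n)
      (pencil_mul hG (![t ^ q ^ 3 * r, a 0, a 1, a 2, b] : Fin 5 → O) (basePt O) t)
    simp only [Polynomial.coeff_C_mul] at h2
    rw [h1, coeff_pencil_mul_right] at h2
    have h3 : (pencil G (fun i => z i - basePt O i) (basePt O)).coeff n ∈
        Ideal.span {t ^ Fintype.card F} := by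
      rw [← Ideal.span_singleton_pow]
      refine Ideal.pow_right_mono ?_ _ (hpen n)
      rw [Ideal.span_le]
      rintro _ ⟨i, rfl⟩
      rw [← h1]
      exact Ideal.mul_mem_right _ _ (Ideal.mem_span_singleton_self t)
    obtain ⟨s, hs⟩ := Ideal.mem_span_singleton.1 h3
    obtain ⟨k, hk⟩ : ∃ k, Fintype.card F = d + (k + 1) := by
      have : 2 * q ≤ Fintype.card F := by
        rw [hF, pow_two]
        exact Nat.mul_le_mul_right _ hq2
      exact ⟨Fintype.card F - (d + 1), by omega⟩
    rw [hs, hk] at h2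
    have h4 : (pencil G ![t ^ q ^ 3 * r, a 0, a 1, a 2, b] (basePt O)).coeff n =
        t * (t ^ k * s * t ^ n) := by
      apply mul_left_cancel₀ (pow_ne_zero d ht0)
      rw [← h2]
      ring
    rw [h4]
    exact Ideal.mul_mem_right _ _ htm
  let φ : O →ₐ[F] IsLocalRing.ResidueField O := IsScalarTower.toAlgHom F O _
  have hφ : ∀ x, φ x = 0 ↔ x ∈ IsLocalRing.maximalIdeal O :=
    fun x => IsLocalRing.residue_eq_zero_iff x
  refine exists_isotropic_of_pencil_eq_zero hq hF hd hG hc (a := fun i => φ (a i)) ?_ ?_ ?_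
  · intro h
    have := congrFun h j
    simp [haj] at this
  · rw [← (hφ _).2 hη]
    simp [hermThree]
  · have hbase : (fun i => φ (basePt O i)) = basePt _ := by
      ext i
      fin_cases i <;> simp [basePt]
    have h1 : pencil G (fun i => φ ((![t ^ q ^ 3 * r, a 0, a 1, a 2, b] : Fin 5 → O) i))
        (basePt _) = 0 := by
      ext n
      rw [← hbase, coeff_pencil_map, (hφ _).2 (hpenu n), Polynomial.coeff_zero]
    have h2 : (fun i => φ ((![t ^ q ^ 3 * r, a 0, a 1, a 2, b] : Fin 5 → O) i)) =
        fun i => (![0, φ (a 0), φ (a 1), φ (a 2), 0] : Fin 5 → _) i + φ b * basePt _ i := by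
      have := (hφ _).2 htm
      ext i
      fin_cases i <;> simp [basePt, this, hq.pos.ne']
    rw [h2, pencil_add_mul] at h1
    have h3 := congrArg (fun p : Polynomial _ => p.comp (Polynomial.X - Polynomial.C (φ b))) h1
    simpa [Polynomial.comp_assoc] using h3

theorem pointIdeal_le_of_smooth {q : ℕ} (hq : IsPrimePow q)
    (hF : Fintype.card F = q ^ 2) {A : Type*} [CommRing A]
    [Algebra F A] {d : ℕ} (hd : 0 < d) (hdq : d ≤ q) {G : MvPolynomial (Fin 5) F}
    (hG : G.IsHomogeneous d) (hbase : eval (basePt F) G = 0)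
    (hc : eval (basePt F) (pderiv 1 G) ≠ 0 ∨ eval (basePt F) (pderiv 2 G) ≠ 0 ∨
      eval (basePt F) (pderiv 3 G) ≠ 0)
    (hiso : ∀ t : Fin 3 → F, t ≠ 0 → hermThree q t = 0 →
      ∃ α, eval ![0, t 0, t 1, t 2, α] G ≠ 0)
    {z e : Fin 5 → A} (hz₁ : herm q z = 0) (hz₃ : herm (q ^ 3) z = 0)
    (he : ∑ i, e i * z i = 1) (he4 : e 4 = 1) {𝔮 : Ideal A} [𝔮.IsPrime]
    [(pointIdeal z (basePt F)).IsPrime] (hle : 𝔮 ≤ pointIdeal z (basePt F))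
    (hpol : ∀ n < d, polarCoeff G z n ∈ 𝔮) : pointIdeal z (basePt F) ≤ 𝔮 := by
  obtain ⟨K, _, O, ψ, hψ, hψm⟩ := exists_valuationRing hle
  let _ : Algebra F O := (ψ.comp (algebraMap F A)).toAlgebra
  let φ : A →ₐ[F] O := { ψ with commutes' := fun _ => rfl }
  have hφ : ∀ a, φ a = ψ a := fun _ => rfl
  have hbA : ∀ i, algebraMap F A (basePt F i) = basePt A i := by
    intro i
    fin_cases i <;> simp [basePt]
  have hbO : ∀ i, φ (basePt A i) = basePt O i := by
    intro i
    fin_cases i <;> simp [basePt]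
  have hherm : ∀ n, herm n (fun i => φ (z i)) = φ (herm n z) := by
    intro n
    simp [herm]
  by_contra hnot
  suffices h : ∃ t : Fin 3 → F, t ≠ 0 ∧ hermThree q t = 0 ∧
      ∀ α, eval ![0, t 0, t 1, t 2, α] G = 0 by
    obtain ⟨t, ht0, ht, hall⟩ := h
    obtain ⟨α, hα⟩ := hiso t ht0 ht
    exact hα (hall α)
  refine exists_isotropic_of_valuationRing hq hF hd hdq hG hc
    (z := fun i => φ (z i)) (e := fun i => φ (e i)) (by rw [hherm, hz₁, map_zero])
    (by rw [hherm, hz₃, map_zero]) (by simp only [← map_mul, ← map_sum, he, map_one])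
    (by rw [he4, map_one]) ?_ ?_ ?_
  · intro i
    rw [← hbO, ← map_sub, ← hbA]
    exact hψm _ (sub_mem_pointIdeal z _ i)
  · by_contra! hall
    apply hnot
    rw [pointIdeal, Ideal.span_le]
    rintro _ ⟨i, rfl⟩
    refine (hψ _).1 ?_
    rw [← hφ, map_sub, hall i, hbA, hbO, sub_self]
  · intro n
    have h1 := (pencil_eq_zero_of_polarCoeff hG hbase le_rfl
      (I := 𝔮 ⊔ pointIdeal z (basePt F) ^ Fintype.card F) (fun h => (lt_irrefl _ h).elim) le_sup_right
      (fun n hn => Ideal.mem_sup_left (hpol n hn)) n).1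
    obtain ⟨u, hu, w, hw, huw⟩ := Submodule.mem_sup.1 h1
    have hb : basePt O = fun i => φ (algebraMap F A (basePt F i)) := by
      funext i
      rw [hbA, hbO]
    simp only [← hbO, ← map_sub, ← hbA]
    rw [hb, coeff_pencil_map, ← huw, map_add, hφ u, (hψ u).2 hu, zero_add]
    have h2 := Ideal.mem_map_of_mem φ hw
    rw [Ideal.map_pow, pointIdeal, Ideal.map_span, ← Set.range_comp] at h2
    exact h2

end Valuation

section PowerOfVars

variable {σ L : Type*} [Fintype σ] [Field L]

/-- The coefficients of the monomials of degree less than `j`, as coordinates on the quotient by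
the `j`-th power of the ideal of the variables. -/
theorem exists_linearEquiv_quotient_pow_idealOfVars [DecidableEq σ] (j : ℕ) :
    Nonempty ((MvPolynomial σ L ⧸ idealOfVars σ L ^ j) ≃ₗ[L]
      ((Finset.range j).biUnion fun i => Finset.univ.finsuppAntidiag i : Finset (σ →₀ ℕ)) → L) := by
  set S : Finset (σ →₀ ℕ) := (Finset.range j).biUnion fun i => Finset.univ.finsuppAntidiag i
  have hS : ∀ m : σ →₀ ℕ, m ∈ S ↔ m.degree < j := by
    intro m
    simp [S, Finset.mem_finsuppAntidiag, Finsupp.degree_eq_sum]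
  let f : MvPolynomial σ L →ₗ[L] (S → L) := LinearMap.pi fun m => lcoeff L m.1
  have hf : Function.Surjective f := by
    intro g
    refine ⟨∑ m : S, monomial m.1 (g m), ?_⟩
    funext m
    simp [f, coeff_monomial]
  have hker : f.ker = (idealOfVars σ L ^ j).restrictScalars L := by
    ext p
    rw [LinearMap.mem_ker, Submodule.restrictScalars_mem, mem_pow_idealOfVars_iff']
    constructor
    · intro h m hm
      exact congrFun h ⟨m, (hS m).2 hm⟩
    · intro h
      funext m
      exact h m.1 ((hS _).1 m.2)
  exact ⟨(Submodule.quotEquivOfEq _ _ hker).symm.trans (f.quotKerEquivOfSurjective hf)⟩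

instance finiteDimensional_quotient_pow_idealOfVars (j : ℕ) :
    FiniteDimensional L (MvPolynomial σ L ⧸ idealOfVars σ L ^ j) := by
  classical
  obtain ⟨e⟩ := exists_linearEquiv_quotient_pow_idealOfVars (σ := σ) (L := L) j
  exact Module.Finite.equiv e.symm

theorem finrank_quotient_pow_idealOfVars (j : ℕ) :
    Module.finrank L (MvPolynomial (Fin 3) L ⧸ idealOfVars (Fin 3) L ^ j) * 6 =
      j * (j + 1) * (j + 2) := by
  obtain ⟨e⟩ := exists_linearEquiv_quotient_pow_idealOfVars (σ := Fin 3) (L := L) j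
  rw [e.finrank_eq, Module.finrank_fintype_fun_eq_card, Fintype.card_coe, Finset.card_biUnion]
  · have h2 : ∀ i, ((Finset.univ : Finset (Fin 3)).finsuppAntidiag i).card * 2 =
        (i + 1) * (i + 2) := by
      intro i
      rw [Finset.card_finsuppAntidiag_nat_eq_choose, Finset.card_univ, Fintype.card_fin,
        show 3 + i - 1 = i + 2 by omega, Nat.choose_symm_add, Nat.choose_two_right,
        Nat.div_mul_cancel]
      · simp; ring
      · exact (Nat.even_mul_pred_self _).two_dvd
    clear e
    induction j with
    | zero => simp
    | succ j ih =>
      rw [Finset.sum_range_succ, add_mul, ih]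
      have := h2 j
      linear_combination 3 * this
  · intro i _ i' _ hii'
    rw [Function.onFun, Finset.disjoint_left]
    intro m hm hm'
    rw [Finset.mem_finsuppAntidiag] at hm hm'
    exact hii' (hm.1.symm.trans hm'.1)

omit [Fintype σ] in
theorem mem_pow_idealOfVars_of_mul_mem {κ w : MvPolynomial σ L} {m : σ →₀ ℕ} {j : ℕ}
    (hκ : κ.coeff m ≠ 0) (h : κ * w ∈ idealOfVars σ L ^ j) :
    w ∈ idealOfVars σ L ^ (j - m.degree) := by
  have key : ∀ (p : MvPolynomial σ L) (n : ℕ), p ∈ idealOfVars σ L ^ n ↔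
      (n : ℕ∞) ≤ (p : MvPowerSeries σ L).order := by
    intro p n
    rw [mem_pow_idealOfVars_iff']
    constructor
    · intro h
      refine MvPowerSeries.le_order fun d hd => ?_
      rw [coeff_coe]
      exact h d (by exact_mod_cast hd)
    · intro h d hd
      rw [← coeff_coe]
      exact MvPowerSeries.coeff_of_lt_order (lt_of_lt_of_le (by exact_mod_cast hd) h)
  rw [key] at h ⊢
  rw [coe_mul, MvPowerSeries.order_mul] at h
  have h1 : (κ : MvPowerSeries σ L).order ≤ m.degree :=
    MvPowerSeries.order_le (by rwa [coeff_coe])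
  have h2 : (j : ℕ∞) ≤ m.degree + (w : MvPowerSeries σ L).order := h.trans (by gcongr)
  rw [ENat.natCast_sub]
  exact tsub_le_iff_left.2 h2

theorem finrank_quotient_sup_span {κ : MvPolynomial σ L} {m : σ →₀ ℕ} {j o : ℕ}
    (hκ : κ.coeff m ≠ 0) (hm : m.degree = o) (ho : κ ∈ idealOfVars σ L ^ o) (hj : o ≤ j) :
    Module.finrank L (MvPolynomial σ L ⧸ (idealOfVars σ L ^ j ⊔ Ideal.span {κ})) +
      Module.finrank L (MvPolynomial σ L ⧸ idealOfVars σ L ^ (j - o)) =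
      Module.finrank L (MvPolynomial σ L ⧸ idealOfVars σ L ^ j) := by
  set n := idealOfVars σ L
  have hle : n ^ j ≤ n ^ j ⊔ Ideal.span {κ} := le_sup_left
  let g := (Ideal.Quotient.factorₐ L hle).toLinearMap
  have hg : Function.Surjective g := Ideal.Quotient.factor_surjective hle
  let f₀ : MvPolynomial σ L →ₗ[L] (MvPolynomial σ L ⧸ n ^ j) :=
    (Ideal.Quotient.mkₐ L (n ^ j)).toLinearMap ∘ₗ LinearMap.mulLeft L κ
  have hf₀ : f₀.ker = (n ^ (j - o)).restrictScalars L := by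
    ext w
    rw [LinearMap.mem_ker, Submodule.restrictScalars_mem]
    change Ideal.Quotient.mk (n ^ j) (κ * w) = 0 ↔ _
    rw [Ideal.Quotient.eq_zero_iff_mem]
    constructor
    · intro h
      have := mem_pow_idealOfVars_of_mul_mem hκ h
      rwa [hm] at this
    · intro h
      have := Ideal.mul_mem_mul ho h
      rwa [← pow_add, Nat.add_sub_cancel' hj] at this
  have hrange : f₀.range = g.ker := by
    ext x
    obtain ⟨x, rfl⟩ := Ideal.Quotient.mk_surjective x
    rw [LinearMap.mem_range, LinearMap.mem_ker]
    change (∃ w, Ideal.Quotient.mk (n ^ j) (κ * w) = _) ↔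
      Ideal.Quotient.mk (n ^ j ⊔ Ideal.span {κ}) x = 0
    simp only [Ideal.Quotient.eq_zero_iff_mem, Ideal.Quotient.eq, Submodule.mem_sup,
      Ideal.mem_span_singleton']
    constructor
    · rintro ⟨w, hw⟩
      exact ⟨x - κ * w, by rw [← neg_sub]; exact neg_mem hw, κ * w, ⟨w, mul_comm _ _⟩, by ring⟩
    · rintro ⟨a, ha, _, ⟨w, rfl⟩, rfl⟩
      refine ⟨w, ?_⟩
      have : κ * w - (a + w * κ) = -a := by ring
      rw [this]
      exact neg_mem ha
  have h1 := LinearMap.finrank_range_add_finrank_ker g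
  have h2 := f₀.quotKerEquivRange.finrank_eq
  have h3 := (Submodule.quotEquivOfEq _ _ hf₀).finrank_eq
  rw [← h1, LinearMap.range_eq_top.2 hg, finrank_top, ← hrange, ← h2, h3]
  rfl

theorem le_finrank_quotient_sup_span_pair {κ γ : MvPolynomial (Fin 3) L} {m : Fin 3 →₀ ℕ}
    {o s : ℕ} (hκ : κ.coeff m ≠ 0) (hm : m.degree = o) (ho : κ ∈ idealOfVars (Fin 3) L ^ o)
    (hγ : γ ∈ idealOfVars (Fin 3) L ^ s) (hs : s = 1 ∨ s = 2) (ho0 : 0 < o) (j : ℕ) :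
    s * o * j ≤ Module.finrank L (MvPolynomial (Fin 3) L ⧸
      (idealOfVars (Fin 3) L ^ j ⊔ Ideal.span {κ, γ})) + s * o * (s + o) := by
  obtain hj | hj := lt_or_ge j (s + o)
  · have := Nat.mul_le_mul_left (s * o) hj.le
    omega
  obtain ⟨j, rfl⟩ := Nat.exists_eq_add_of_le hj
  set n := idealOfVars (Fin 3) L
  have fd : ∀ i, FiniteDimensional L (MvPolynomial (Fin 3) L ⧸ (n ^ i ⊔ Ideal.span {κ})) :=
    fun i => finiteDimensional_quotient_of_le (L := L) (le_sup_left (a := n ^ i))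
  have h1 := finrank_quotient_le_add (L := L) γ (n ^ (o + j) ⊔ Ideal.span {κ})
    (n ^ (s + o + j) ⊔ Ideal.span {κ}) (n ^ (s + o + j) ⊔ Ideal.span {κ, γ}) (by
      intro x hx
      obtain ⟨a, ha, b, hb, rfl⟩ := Submodule.mem_sup.1 hx
      rw [mul_add, add_assoc, pow_add]
      exact Submodule.add_mem_sup (Ideal.mul_mem_mul hγ ha) (Ideal.mul_mem_left _ _ hb)) (by
      rw [Ideal.span_insert, sup_assoc]) (by
      rw [Ideal.span_insert, ← sup_assoc]; exact le_sup_left)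
  have h2 := finrank_quotient_sup_span (L := L) (j := o + j) hκ hm ho (by omega)
  have h3 := finrank_quotient_sup_span (L := L) (j := s + o + j) hκ hm ho (by omega)
  rw [show o + j - o = j by omega] at h2
  rw [show s + o + j - o = s + j by omega] at h3
  have t1 := finrank_quotient_pow_idealOfVars (L := L) (o + j)
  have t2 := finrank_quotient_pow_idealOfVars (L := L) j
  have t3 := finrank_quotient_pow_idealOfVars (L := L) (s + o + j)
  have t4 := finrank_quotient_pow_idealOfVars (L := L) (s + j)
  change Module.finrank L (_ ⧸ n ^ _ ⊔ _) + Module.finrank L (_ ⧸ n ^ _) =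
    Module.finrank L (_ ⧸ n ^ _) at h2 h3
  change Module.finrank L (_ ⧸ n ^ _) * 6 = _ at t1 t2 t3 t4
  obtain rfl | rfl := hs
  · zify at *
    nlinarith
  · zify at *
    nlinarith

end PowerOfVars

section Multiplicity

theorem herm_mul {A : Type*} [CommRing A] (n : ℕ) (c : A) (x : Fin 5 → A) :
    herm n (fun i => c * x i) = c ^ (n + 1) * herm n x := by
  simp only [herm]
  ring

theorem hermThree_mem {A : Type*} [CommRing A] {I : Ideal A} (n : ℕ) {a : Fin 3 → A}
    (h : ∀ i, a i ∈ I) : hermThree n a ∈ I ^ (n + 1) := by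
  rw [hermThree]
  refine add_mem (add_mem ?_ ?_) (Ideal.pow_mem_pow (h 1) _)
  · rw [pow_succ]
    exact Ideal.mul_mem_mul (Ideal.pow_mem_pow (h 0) _) (h 2)
  · rw [pow_succ']
    exact Ideal.mul_mem_mul (h 0) (Ideal.pow_mem_pow (h 2) _)

theorem coeff_hermThree {L : Type*} [Field L] (n : ℕ) :
    coeff (Finsupp.single 1 (n + 1)) (hermThree n (X : Fin 3 → MvPolynomial (Fin 3) L)) = 1 := by
  rw [hermThree, coeff_add, coeff_add, coeff_mul_X', coeff_X_mul',
    if_neg (by simp), if_neg (by simp),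
    coeff_X_pow (σ := Fin 3), if_pos rfl]
  ring

variable {F : Type*} [Field F] [Fintype F]

/-- An approximate solution of `t ^ q + t + η = 0`. -/
theorem exists_pow_add_self_add_mem {q : ℕ} (hq : IsPrimePow q) (hF : Fintype.card F = q ^ 2)
    {A : Type*} [CommRing A] [Algebra F A] {I : Ideal A} {η : A} (hη : η ∈ I ^ 2) (j : ℕ) :
    ∃ t ∈ I ^ 2, t ^ q + t + η ∈ I ^ j ∧ t + η ∈ I ^ (2 * q) := by
  have h2 := hq.two_le
  suffices h : ∀ i, ∃ t ∈ I ^ 2, t ^ q + t + η ∈ I ^ i ∧ t ^ q + t + η ∈ I ∧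
      t + η ∈ I ^ (2 * q) by
    obtain ⟨t, h₁, h₃, -, h₄⟩ := h j
    exact ⟨t, h₁, h₃, h₄⟩
  have hsub : ∀ x y : A, (x - y) ^ q = x ^ q - y ^ q := fun x y => by
    rw [eq_sub_iff_add_eq, ← add_pow_of_card_eq (F := F) hq hF, sub_add_cancel]
  have hI : ∀ {m}, 0 < m → ∀ {x}, x ∈ I ^ m → x ∈ I := fun hm x hx => by
    simpa using Ideal.pow_le_pow_right hm hx
  have key : ∀ t ∈ I ^ 2, -(t ^ q) - η ∈ I ^ 2 ∧ -(t ^ q) - η + η ∈ I ^ (2 * q) := by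
    intro t ht
    have := Ideal.pow_mem_pow ht q
    rw [← pow_mul] at this
    refine ⟨sub_mem (neg_mem (Ideal.pow_le_pow_right (by omega) this)) hη, ?_⟩
    simpa using this
  intro i
  induction i with
  | zero =>
    obtain ⟨h, h'⟩ := key 0 (zero_mem _)
    refine ⟨_, h, by simp, ?_, h'⟩
    exact add_mem (add_mem (Ideal.pow_mem_of_mem _ (hI two_pos h) _ (by omega)) (hI two_pos h))
      (hI two_pos hη)
  | succ i ih =>
    obtain ⟨t, ht, hi, h₁, -⟩ := ih
    obtain ⟨h, h'⟩ := key t ht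
    have hnew : (-(t ^ q) - η) ^ q + (-(t ^ q) - η) + η = ((-(t ^ q) - η) - t) ^ q := by
      rw [hsub _ t]
      ring
    have hnew' : (-(t ^ q) - η) - t = - (t ^ q + t + η) := by ring
    refine ⟨_, h, ?_, ?_, h'⟩
    · have hpow : (-(t ^ q + t + η)) ^ q =
          (-(t ^ q + t + η)) ^ (q - 2) * (-(t ^ q + t + η)) ^ 2 := by
        rw [← pow_add, Nat.sub_add_cancel h2]
      rw [hnew, hnew', hpow]
      have : (-(t ^ q + t + η)) ^ 2 ∈ I ^ (i + 1) := by
        rw [neg_sq, sq, pow_succ]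
        exact Ideal.mul_mem_mul hi h₁
      exact Ideal.mul_mem_left _ _ this
    · rw [hnew, hnew']
      exact Ideal.pow_mem_of_mem _ (neg_mem h₁) _ (by omega)

omit [Fintype F] in
/-- The multiplicity of the zero of `G` at the base point. -/
theorem aeval_mem_pow_of_base {L : Type*} [CommRing L] [Algebra F L] {d : ℕ}
    {G : MvPolynomial (Fin 5) F} (hG : G.IsHomogeneous d) (hbase : eval (basePt F) G = 0) {s : ℕ}
    (hs : s = 1 ∨ s = 2 ∧ eval (basePt F) (pderiv 1 G) = 0 ∧ eval (basePt F) (pderiv 2 G) = 0 ∧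
      eval (basePt F) (pderiv 3 G) = 0) {I : Ideal L} {y : Fin 5 → L} (hy : ∀ i, y i ∈ I)
    (hy0 : y 0 ∈ I ^ 2) (hy4 : y 4 = 0) (hd : 0 < d) :
    aeval (fun i => y i + basePt L i) G ∈ I ^ s := by
  have hb : ∀ p : MvPolynomial (Fin 5) F, aeval (basePt L) p =
      algebraMap F L (eval (basePt F) p) := by
    intro p
    have : basePt L = fun i => algebraMap F L (basePt F i) := by
      funext i
      fin_cases i <;> simp [basePt]
    have h := aeval_algebraMap_apply L (basePt F) p
    rw [aeval_eq_eval] at h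
    rw [this]
    erw [h]
  have h1 : aeval (fun i => y i + basePt L i) G = (pencil G y (basePt L)).eval 1 := by
    have := comp_aeval_apply (fun i => Polynomial.C (y i) + Polynomial.X * Polynomial.C (basePt L i))
      ((Polynomial.aeval (R := L) (1 : L)).restrictScalars F) G
    rw [pencil]
    simpa [Polynomial.aeval_def] using this.symm
  rw [h1, Polynomial.eval_eq_sum, Polynomial.sum]
  refine sum_mem fun n _ => ?_
  rw [one_pow, mul_one]
  have h2 := coeff_pencil_mem hG (basePt L) hy n
  by_cases hn : s ≤ d - n
  · exact Ideal.pow_le_pow_right hn h2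
  have h0 : (pencil G y (basePt L)).coeff d = 0 := by
    rw [pencil, coeff_aeval_self hG, hb, hbase, map_zero]
  rcases lt_trichotomy n d with h | rfl | h
  · obtain rfl | ⟨rfl, hp1, hp2, hp3⟩ := hs
    · omega
    obtain rfl : n = d - 1 := by omega
    rw [coeff_pencil_sub_one hd hG, Fin.sum_univ_five]
    simp only [hb, hp1, hp2, hp3, hy4, map_zero, mul_zero, zero_mul, add_zero]
    exact Ideal.mul_mem_right _ _ hy0
  · rw [h0]
    exact zero_mem _
  · rw [pencil, coeff_aeval_eq_zero_of_lt hG _ _ h]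
    exact zero_mem _

theorem le_finrank_quotient_pointIdeal_pow {q : ℕ} (hq : IsPrimePow q)
    (hF : Fintype.card F = q ^ 2) {L : Type} [Field L] [Algebra F L] {A : Type*} [CommRing A]
    [Algebra L A] [Algebra F A] {d : ℕ} (hd : 0 < d)
    {G : MvPolynomial (Fin 5) F} (hG : G.IsHomogeneous d) (hbase : eval (basePt F) G = 0) {s : ℕ}
    (hs : s = 1 ∨ s = 2 ∧ eval (basePt F) (pderiv 1 G) = 0 ∧ eval (basePt F) (pderiv 2 G) = 0 ∧
      eval (basePt F) (pderiv 3 G) = 0) {z : Fin 5 → A} {e : Fin 5 → L} (he4 : e 4 = 1)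
    (huniv : ∀ (B : Type) [CommRing B] [Algebra L B] [Algebra F B] [IsScalarTower F L B]
      (ζ : Fin 5 → B), herm q ζ = 0 → herm (q ^ 3) ζ = 0 → aeval ζ G = 0 →
      ∑ i, e i • ζ i = 1 → ∃ φ : A →ₐ[L] B, ∀ i, φ (z i) = ζ i) (j : ℕ)
    [FiniteDimensional L (A ⧸ pointIdeal z (basePt F) ^ j)] :
    s * (q + 1) * j ≤
      Module.finrank L (A ⧸ pointIdeal z (basePt F) ^ j) + s * (q + 1) * (s + (q + 1)) := by
  have h2 := hq.two_le
  set n := idealOfVars (Fin 3) L with hn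
  have hX : ∀ i, X i ∈ n := fun i => Ideal.subset_span ⟨i, rfl⟩
  set η := hermThree q (X : Fin 3 → MvPolynomial (Fin 3) L)
  have hη : η ∈ n ^ (q + 1) := hermThree_mem q hX
  obtain ⟨t, ht, htj, htη⟩ := exists_pow_add_self_add_mem hq hF (I := n) (η := η)
    (Ideal.pow_le_pow_right (by omega) hη) j
  set κ := t ^ q ^ 3 + t + hermThree (q ^ 3) (X : Fin 3 → MvPolynomial (Fin 3) L)
  have hq3 : q + 1 ≤ q ^ 3 := by nlinarith [pow_pos (by omega : 0 < q) 2]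
  have hκη : κ + η ∈ n ^ (q + 2) := by
    have h1 : t ^ q ^ 3 ∈ n ^ (q + 2) := by
      have := Ideal.pow_mem_pow ht (q ^ 3)
      rw [← pow_mul] at this
      exact Ideal.pow_le_pow_right (by omega) this
    have h3 := Ideal.pow_le_pow_right (show q + 2 ≤ q ^ 3 + 1 by omega)
      (hermThree_mem (q ^ 3) hX)
    have h4 := Ideal.pow_le_pow_right (show q + 2 ≤ 2 * q by omega) htη
    have := add_mem (add_mem h1 h4) h3
    convert this using 1
    ring
  have hκ : κ ∈ n ^ (q + 1) := by
    have := sub_mem (Ideal.pow_le_pow_right (show q + 1 ≤ q + 2 by omega) hκη) hη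
    rwa [add_sub_cancel_right] at this
  have hκc : coeff (Finsupp.single 1 (q + 1)) κ ≠ 0 := by
    have h1 := (mem_pow_idealOfVars_iff' (q + 2) _).1 hκη (Finsupp.single 1 (q + 1)) (by simp)
    rw [coeff_add, coeff_hermThree] at h1
    intro h
    rw [h] at h1
    simp at h1
  have hn2 : n ^ 2 ≤ n := Ideal.pow_le_self two_ne_zero
  set ζ₀ : Fin 5 → MvPolynomial (Fin 3) L := ![t, X 0, X 1, X 2, 1] with hζ₀
  set γ := aeval ζ₀ G
  have hγ : γ ∈ n ^ s := by
    have := aeval_mem_pow_of_base (L := MvPolynomial (Fin 3) L) hG hbase hs (I := n)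
      (y := ![t, X 0, X 1, X 2, 0]) (by
        intro i
        fin_cases i
        · exact hn2 ht
        · exact hX 0
        · exact hX 1
        · exact hX 2
        · exact zero_mem _) ht rfl hd
    have hζ : ζ₀ = fun i => ![t, X 0, X 1, X 2, 0] i + basePt (MvPolynomial (Fin 3) L) i := by
      funext i
      fin_cases i <;> simp [hζ₀, basePt]
    rwa [← hζ] at this
  have hmain := le_finrank_quotient_sup_span_pair hκc (by simp) hκ hγ
    (hs.imp_right And.left) (Nat.succ_pos q) j
  refine hmain.trans (Nat.add_le_add_right ?_ _)
  set K := n ^ j ⊔ Ideal.span {κ, γ}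
  let B := MvPolynomial (Fin 3) L ⧸ K
  let π : MvPolynomial (Fin 3) L →ₐ[L] B := Ideal.Quotient.mkₐ L K
  have hπ : ∀ x, x ∈ K → π x = 0 := fun x hx => Ideal.Quotient.eq_zero_iff_mem.2 hx
  have hπj : (n.map π) ^ j = ⊥ := by
    rw [← Ideal.map_pow, Ideal.map_eq_bot_iff_le_ker]
    exact fun x hx => hπ x (Ideal.mem_sup_left hx)
  have hw : ∑ i, e i • π (ζ₀ i) - 1 ∈ n.map π := by
    have h1 : ∑ i, e i • π (ζ₀ i) - 1 = π (e 0 • t + e 1 • X 0 + e 2 • X 1 + e 3 • X 2) := by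
      rw [Fin.sum_univ_five]
      simp [hζ₀, he4]
    rw [h1]
    refine Ideal.mem_map_of_mem _ ?_
    refine add_mem (add_mem (add_mem ?_ ?_) ?_) ?_ <;> rw [Algebra.smul_def] <;>
      refine Ideal.mul_mem_left _ _ ?_
    exacts [hn2 ht, hX 0, hX 1, hX 2]
  set w := ∑ i, e i • π (ζ₀ i)
  have hnil : ∀ x ∈ n.map π, x ^ j = 0 := by
    intro x hx
    have := Ideal.pow_mem_pow hx j
    rwa [hπj] at this
  have hgeom : ∀ x : B, x - 1 ∈ n.map π → x * ∑ i ∈ Finset.range j, (1 - x) ^ i = 1 := by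
    intro x hx
    have h1 := mul_neg_geom_sum (1 - x) j
    have h3 := hnil (1 - x) (by rw [← neg_sub]; exact neg_mem hx)
    rw [h3, sub_sub_cancel, sub_zero] at h1
    exact h1
  set c : B := ∑ i ∈ Finset.range j, (1 - w) ^ i
  have hwc : w * c = 1 := hgeom w hw
  have hc : c - 1 ∈ n.map π := by
    have : c - 1 = -(c * (w - 1)) := by linear_combination hwc
    rw [this]
    exact neg_mem (Ideal.mul_mem_left _ _ hw)
  have hermπ : ∀ m, herm m (fun i => π (ζ₀ i)) = π (t ^ m + t + hermThree m X) := by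
    intro m
    simp [herm, hermThree, hζ₀]
    ring
  obtain ⟨φ, hφ⟩ := huniv B (fun i => c * π (ζ₀ i))
    (by rw [herm_mul, hermπ, hπ _ (Ideal.mem_sup_left htj), mul_zero])
    (by rw [herm_mul, hermπ, hπ _ (Ideal.mem_sup_right (Ideal.subset_span (by simp [κ]))),
      mul_zero])
    (by
      rw [aeval_mul_of_isHomogeneous hG]
      have := comp_aeval_apply ζ₀ (π.restrictScalars F) G
      have h3 : aeval (fun i => π (ζ₀ i)) G = π γ := this.symm
      rw [h3, hπ _ (Ideal.mem_sup_right (Ideal.subset_span (by simp))), mul_zero])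
    (by
      simp only [← mul_smul_comm]
      rw [← Finset.mul_sum, mul_comm]
      exact hwc)
  have hφ4 : φ (z 4) = c := by
    rw [hφ]
    simp [hζ₀]
  have hsurj : Function.Surjective φ := by
    rw [← AlgHom.range_eq_top, eq_top_iff]
    have hcr : c ∈ φ.range := ⟨z 4, hφ4⟩
    have hwr : w ∈ φ.range := by
      have h1 := hgeom c hc
      have : w = ∑ i ∈ Finset.range j, (1 - c) ^ i := by
        linear_combination -w * h1 + (∑ i ∈ Finset.range j, (1 - c) ^ i) * hwc
      rw [this]
      exact sum_mem fun i _ => pow_mem (sub_mem (one_mem _) hcr) _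
    have hXr : ∀ i, π (X i) ∈ φ.range := by
      have h1 : ∀ i, π (ζ₀ i) ∈ φ.range := by
        intro i
        have : π (ζ₀ i) = w * φ (z i) := by
          rw [hφ, ← mul_assoc, hwc, one_mul]
        rw [this]
        exact mul_mem hwr ⟨_, rfl⟩
      intro i
      fin_cases i
      exacts [h1 1, h1 2, h1 3]
    rintro x -
    obtain ⟨p, rfl⟩ := Ideal.Quotient.mk_surjective x
    change π p ∈ φ.range
    induction p using MvPolynomial.induction_on with
    | C a => exact ⟨algebraMap L A a, φ.commutes a⟩
    | add p p' h h' => rw [map_add]; exact add_mem h h'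
    | mul_X p i h => rw [map_mul]; exact mul_mem h (hXr i)
  have hker : ∀ x ∈ pointIdeal z (basePt F) ^ j, φ x = 0 := by
    intro x hx
    have h1 : pointIdeal z (basePt F) ≤ (n.map π).comap φ := by
      rw [pointIdeal, Ideal.span_le]
      rintro _ ⟨i, rfl⟩
      rw [SetLike.mem_coe, Ideal.mem_comap, map_sub, hφ]
      have h5 : ∀ x ∈ n, c * π x ∈ n.map π := fun x hx =>
        Ideal.mul_mem_left _ _ (Ideal.mem_map_of_mem _ hx)
      fin_cases i
      · simpa [basePt, hζ₀] using h5 _ (hn2 ht)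
      · simpa [basePt, hζ₀] using h5 _ (hX 0)
      · simpa [basePt, hζ₀] using h5 _ (hX 1)
      · simpa [basePt, hζ₀] using h5 _ (hX 2)
      · simpa [basePt, hζ₀] using hc
    have h3 := Ideal.pow_right_mono h1 j hx
    have h4 := Ideal.le_comap_pow φ j h3
    rw [hπj] at h4
    exact h4
  let g : (A ⧸ pointIdeal z (basePt F) ^ j) →ₐ[L] B := Ideal.Quotient.liftₐ _ φ hker
  refine LinearMap.finrank_le_finrank_of_surjective (f := g.toLinearMap) ?_
  intro b
  obtain ⟨a, rfl⟩ := hsurj b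
  exact ⟨Ideal.Quotient.mk _ a, rfl⟩

end Multiplicity

section Frame

variable {F : Type*} [Field F]

/-- The columns of `M` form a hyperbolic basis for the Hermitian form `∑ uᵢ ^ q w_{4 - i}`. -/
def IsHermFrame (q : ℕ) (M : Matrix (Fin 5) (Fin 5) F) : Prop :=
  ∀ m k, ∑ i, M i m ^ q * M (Fin.rev i) k = if k = Fin.rev m then 1 else 0

/-- The inverse of a hyperbolic frame. -/
def frameInv (q : ℕ) (M : Matrix (Fin 5) (Fin 5) F) : Matrix (Fin 5) (Fin 5) F :=
  fun m i => M (Fin.rev i) (Fin.rev m) ^ q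

theorem frameInv_mul {q : ℕ} {M : Matrix (Fin 5) (Fin 5) F} (h : IsHermFrame q M) :
    frameInv q M * M = 1 := by
  ext m k
  rw [Matrix.mul_apply, Matrix.one_apply]
  have h1 := h (Fin.rev m) k
  rw [Fin.rev_rev] at h1
  simp only [eq_comm (a := m)]
  rw [← h1, ← Equiv.sum_comp Fin.revPerm]
  simp [frameInv]

theorem mul_frameInv {q : ℕ} {M : Matrix (Fin 5) (Fin 5) F} (h : IsHermFrame q M) :
    M * frameInv q M = 1 :=
  mul_eq_one_comm.1 (frameInv_mul h)

variable {A : Type*} [CommRing A] [Algebra F A]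

/-- The action of a matrix over `F` on vectors over an `F`-algebra. -/
def matAct (M : Matrix (Fin 5) (Fin 5) F) (x : Fin 5 → A) : Fin 5 → A :=
  fun i => ∑ m, algebraMap F A (M i m) * x m

theorem matAct_matAct {M N : Matrix (Fin 5) (Fin 5) F} (h : M * N = 1) (x : Fin 5 → A) :
    matAct M (matAct N x) = x := by
  have h1 : ∀ (M : Matrix (Fin 5) (Fin 5) F) (x : Fin 5 → A),
      matAct M x = (M.map (algebraMap F A)).mulVec x := fun M x => rfl
  rw [h1, h1, Matrix.mulVec_mulVec, ← Matrix.map_mul, h,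
    Matrix.map_one _ (map_zero _) (map_one _), Matrix.one_mulVec]

theorem matAct_sub (M : Matrix (Fin 5) (Fin 5) F) (x y : Fin 5 → A) (i : Fin 5) :
    matAct M (fun i => x i - y i) i = matAct M x i - matAct M y i := by
  simp [matAct, mul_sub]

theorem matAct_algebraMap (M : Matrix (Fin 5) (Fin 5) F) (w : Fin 5 → F) (i : Fin 5) :
    matAct M (fun i => algebraMap F A (w i)) i = algebraMap F A (matAct M w i) := by
  simp [matAct]

theorem matAct_basePt (M : Matrix (Fin 5) (Fin 5) F) : matAct M (basePt F) = fun i => M i 4 := by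
  funext i
  rw [matAct, Fin.sum_univ_five]
  simp [basePt]

/-- Linear substitution. -/
def linSubst (M : Matrix (Fin 5) (Fin 5) F) (G : MvPolynomial (Fin 5) F) : MvPolynomial (Fin 5) F :=
  aeval (matAct M (X : Fin 5 → MvPolynomial (Fin 5) F)) G

theorem aeval_linSubst (M : Matrix (Fin 5) (Fin 5) F) (G : MvPolynomial (Fin 5) F)
    (x : Fin 5 → A) : aeval x (linSubst M G) = aeval (matAct M x) G := by
  rw [linSubst, comp_aeval_apply]
  congr 2
  funext i
  simp [matAct]

theorem eval_linSubst (M : Matrix (Fin 5) (Fin 5) F) (G : MvPolynomial (Fin 5) F)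
    (x : Fin 5 → F) : eval x (linSubst M G) = eval (matAct M x) G := by
  have := aeval_linSubst M G x
  rwa [aeval_eq_eval, aeval_eq_eval] at this

theorem isHomogeneous_linSubst {d : ℕ} {G : MvPolynomial (Fin 5) F} (hG : G.IsHomogeneous d)
    (M : Matrix (Fin 5) (Fin 5) F) : (linSubst M G).IsHomogeneous d := by
  have := IsHomogeneous.aeval hG (matAct M (X : Fin 5 → MvPolynomial (Fin 5) F)) (n := 1)
    fun i => IsHomogeneous.sum _ _ _ fun m _ => by
      simpa using (isHomogeneous_C (Fin 5) (M i m)).mul (isHomogeneous_X F m)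
  simpa [linSubst] using this

theorem pencil_linSubst (M : Matrix (Fin 5) (Fin 5) F) (G : MvPolynomial (Fin 5) F)
    (y v : Fin 5 → A) : pencil (linSubst M G) y v = pencil G (matAct M y) (matAct M v) := by
  rw [pencil, aeval_linSubst, pencil]
  congr 2
  funext i
  simp only [matAct, mul_add, Finset.sum_add_distrib, map_sum, Finset.mul_sum, map_mul,
    IsScalarTower.algebraMap_apply F A (Polynomial A), Polynomial.algebraMap_eq]
  congr 1
  exact Finset.sum_congr rfl fun _ _ => by ring

theorem pointIdeal_matAct_le (M : Matrix (Fin 5) (Fin 5) F) (x : Fin 5 → A) (v : Fin 5 → F) :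
    pointIdeal (matAct M x) (matAct M v) ≤ pointIdeal x v := by
  rw [pointIdeal, Ideal.span_le]
  rintro _ ⟨i, rfl⟩
  simp only [← matAct_algebraMap, ← matAct_sub]
  exact sum_mem fun m _ => Ideal.mul_mem_left _ _ (sub_mem_pointIdeal x v m)

theorem pointIdeal_matAct {M N : Matrix (Fin 5) (Fin 5) F} (h : N * M = 1) (x : Fin 5 → A)
    (v : Fin 5 → F) : pointIdeal (matAct M x) (matAct M v) = pointIdeal x v := by
  refine le_antisymm (pointIdeal_matAct_le M x v) ?_
  have := pointIdeal_matAct_le N (matAct M x) (matAct M v)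
  rwa [matAct_matAct h, matAct_matAct h] at this

variable [Fintype F]

omit [Fintype F] in
theorem sum_pow_card (x : Fin 5 → A) (a : Fin 5 → F) {n : ℕ}
    (hn : ∀ x y : A, (x + y) ^ n = x ^ n + y ^ n) (hn0 : n ≠ 0) :
    (∑ m, algebraMap F A (a m) * x m) ^ n = ∑ m, algebraMap F A (a m ^ n) * x m ^ n := by
  let φ : A →+ A := ⟨⟨fun x => x ^ n, zero_pow hn0⟩, hn⟩
  have := map_sum φ (fun m => algebraMap F A (a m) * x m) Finset.univ
  change (∑ m, algebraMap F A (a m) * x m) ^ n = ∑ m, (algebraMap F A (a m) * x m) ^ n at this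
  simpa only [map_pow, mul_pow] using this

theorem polarCoeff_linSubst (M : Matrix (Fin 5) (Fin 5) F) (G : MvPolynomial (Fin 5) F)
    (x : Fin 5 → A) (n : ℕ) : polarCoeff (linSubst M G) x n = polarCoeff G (matAct M x) n := by
  rw [polarCoeff, pencil_linSubst, polarCoeff]
  congr 2
  funext i
  rw [matAct, matAct, sum_pow_card x (M i) _ Fintype.card_ne_zero]
  · simp [FiniteField.pow_card]
  · intro x y
    obtain ⟨p, hp⟩ := CharP.exists F
    obtain ⟨n, hp', hn⟩ := FiniteField.card F p
    have := Fact.mk hp'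
    nontriviality A
    have : CharP A p := charP_of_injective_algebraMap (algebraMap F A).injective p
    rw [hn]
    exact add_pow_expChar_pow x y p n

theorem herm_matAct {q : ℕ} (hq : IsPrimePow q) (hF : Fintype.card F = q ^ 2)
    {M : Matrix (Fin 5) (Fin 5) F} (hM : IsHermFrame q M) {n : ℕ} (hn : n = q ∨ n = q ^ 3)
    (x : Fin 5 → A) : herm n (matAct M x) = herm n x := by
  have hherm : ∀ x : Fin 5 → A, herm n x = ∑ i, x i ^ n * x (Fin.rev i) := by
    intro x
    have h0 : Fin.rev (0 : Fin 5) = 4 := rfl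
    have h1 : Fin.rev (1 : Fin 5) = 3 := rfl
    have h2 : Fin.rev (2 : Fin 5) = 2 := rfl
    have h3 : Fin.rev (3 : Fin 5) = 1 := rfl
    have h4 : Fin.rev (4 : Fin 5) = 0 := rfl
    rw [Fin.sum_univ_five, herm, h0, h1, h2, h3, h4]
    ring
  have hq0 : q ≠ 0 := hq.ne_zero
  have hadd : ∀ x y : A, (x + y) ^ n = x ^ n + y ^ n := by
    have h1 : ∀ x y : A, (x + y) ^ q = x ^ q + y ^ q := add_pow_of_card_eq hq hF
    obtain rfl | rfl := hn
    · exact h1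
    · intro x y
      rw [pow_succ, sq]
      simp only [pow_mul, h1]
  have hnF : ∀ a : F, a ^ n = a ^ q := by
    intro a
    obtain rfl | rfl := hn
    · rfl
    · rw [show q ^ 3 = q ^ 2 * q by ring, pow_mul, ← hF, FiniteField.pow_card]
  have hn0 : n ≠ 0 := by
    obtain rfl | rfl := hn
    · exact hq0
    · exact pow_ne_zero _ hq0
  rw [hherm, hherm]
  have h1 : ∀ i, matAct M x i ^ n * matAct M x (Fin.rev i) =
      ∑ m, ∑ k, algebraMap F A (M i m ^ q * M (Fin.rev i) k) * (x m ^ n * x k) := by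
    intro i
    rw [matAct, matAct, sum_pow_card x (M i) hadd hn0, Finset.sum_mul_sum]
    refine Finset.sum_congr rfl fun m _ => Finset.sum_congr rfl fun k _ => ?_
    rw [hnF, map_mul]
    ring
  simp only [h1]
  rw [Finset.sum_comm]
  refine Finset.sum_congr rfl fun m _ => ?_
  rw [Finset.sum_comm]
  simp only [← Finset.sum_mul, ← map_sum, hM m]
  simp

end Frame

section Curve

variable {F : Type*} [Field F] {L : Type} [Field L] [Algebra F L] {A : Type*}
  [CommRing A] [Algebra L A] [Algebra F A] [IsScalarTower F L A]

/-- The linear form with coefficients `θ`. -/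
def linForm (θ : Fin 5 → L) (v : Fin 5 → F) : L := ∑ i, θ i * algebraMap F L (v i)

/-- `A` is the coordinate ring of the affine chart `∑ θᵢ ξᵢ = 1` of the intersection of the
hypersurfaces `herm q = 0`, `herm (q ^ 3) = 0` and `G = 0`. -/
structure IsCurveRing (q : ℕ) (G : MvPolynomial (Fin 5) F) (θ : Fin 5 → L) (ξ : Fin 5 → A) :
    Prop where
  surj : Function.Surjective (aeval (R := L) ξ)
  lin : ∑ i, θ i • ξ i = 1
  herm_one : herm q ξ = 0
  herm_three : herm (q ^ 3) ξ = 0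
  zero : aeval ξ G = 0
  univ : ∀ (B : Type) [CommRing B] [Algebra L B] [Algebra F B] [IsScalarTower F L B]
    (ζ : Fin 5 → B), herm q ζ = 0 → herm (q ^ 3) ζ = 0 → aeval ζ G = 0 →
    ∑ i, θ i • ζ i = 1 → ∃ φ : A →ₐ[L] B, ∀ i, φ (ξ i) = ζ i

/-- The coordinates scaled so as to specialise to `v`. -/
def scaledCoord (θ : Fin 5 → L) (ξ : Fin 5 → A) (v : Fin 5 → F) : Fin 5 → A :=
  fun i => algebraMap L A (linForm θ v) * ξ i

/-- The ideal of the point `v`. -/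
def ptIdeal (θ : Fin 5 → L) (ξ : Fin 5 → A) (v : Fin 5 → F) : Ideal A :=
  pointIdeal (scaledCoord θ ξ v) v

omit [Algebra L A] [IsScalarTower F L A] in
theorem map_matAct {B : Type*} [CommRing B] [Algebra F B] (φ : A →ₐ[F] B)
    (M : Matrix (Fin 5) (Fin 5) F) (x : Fin 5 → A) (i : Fin 5) :
    φ (matAct M x i) = matAct M (fun i => φ (x i)) i := by
  simp [matAct]

omit [Algebra F A] [IsScalarTower F L A] in
theorem sum_smul_matAct {θ : Fin 5 → L} {M : Matrix (Fin 5) (Fin 5) F} [Algebra F A]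
    [IsScalarTower F L A] (x : Fin 5 → A) :
    ∑ i, θ i • matAct M x i = ∑ m, linForm θ (fun i => M i m) • x m := by
  simp only [matAct, linForm, Finset.smul_sum, Finset.sum_smul]
  rw [Finset.sum_comm]
  refine Finset.sum_congr rfl fun m _ => Finset.sum_congr rfl fun i _ => ?_
  rw [IsScalarTower.algebraMap_apply F L A, ← Algebra.smul_def, smul_smul]

variable [Fintype F]

theorem IsCurveRing.exists_coord {q d : ℕ} (hq : IsPrimePow q) (hF : Fintype.card F = q ^ 2)
    {G : MvPolynomial (Fin 5) F} (hG : G.IsHomogeneous d) {θ : Fin 5 → L} {ξ : Fin 5 → A}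
    (h : IsCurveRing q G θ ξ) {M : Matrix (Fin 5) (Fin 5) F} (hM : IsHermFrame q M)
    {v : Fin 5 → F} (hv : v = fun i => M i 4) (hc : linForm θ v ≠ 0) :
    ∃ (z : Fin 5 → A) (e : Fin 5 → L), e 4 = 1 ∧ ∑ i, e i • z i = 1 ∧
      matAct M z = scaledCoord θ ξ v ∧ herm q z = 0 ∧ herm (q ^ 3) z = 0 ∧
      pointIdeal z (basePt F) = ptIdeal θ ξ v ∧
      ∀ (B : Type) [CommRing B] [Algebra L B] [Algebra F B] [IsScalarTower F L B]
        (ζ : Fin 5 → B), herm q ζ = 0 → herm (q ^ 3) ζ = 0 → aeval ζ (linSubst M G) = 0 →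
        ∑ i, e i • ζ i = 1 → ∃ φ : A →ₐ[L] B, ∀ i, φ (z i) = ζ i := by
  set c := linForm θ v with hcdef
  have hMN := mul_frameInv hM
  have hNM := frameInv_mul hM
  set z := matAct (frameInv q M) (scaledCoord θ ξ v) with hz
  have hMz : matAct M z = scaledCoord θ ξ v := matAct_matAct hMN _
  have hherm : ∀ n, n = q ∨ n = q ^ 3 → herm n ξ = 0 → herm n z = 0 := by
    intro n hn h0
    rw [← herm_matAct hq hF hM hn, hMz]
    unfold scaledCoord
    rw [herm_mul, h0, mul_zero]
  refine ⟨z, fun m => c⁻¹ * linForm θ (fun i => M i m), ?_, ?_, hMz, hherm _ (.inl rfl) h.herm_one,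
    hherm _ (.inr rfl) h.herm_three, ?_, ?_⟩
  · change c⁻¹ * linForm θ (fun i => M i 4) = 1
    rw [← hv, ← hcdef]
    exact inv_mul_cancel₀ hc
  · simp only [mul_smul]
    rw [← Finset.smul_sum, ← sum_smul_matAct, hMz]
    simp only [scaledCoord, ← Algebra.smul_def, smul_comm (θ _)]
    rw [← Finset.smul_sum, h.lin, ← hcdef, smul_smul, inv_mul_cancel₀ hc, one_smul]
  · rw [← pointIdeal_matAct hNM, hMz, matAct_basePt, ← hv, ptIdeal]
  · intro B _ _ _ _ ζ h₁ h₃ h₀ hl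
    obtain ⟨φ, hφ⟩ := h.univ B (fun i => algebraMap L B c⁻¹ * matAct M ζ i)
      (by rw [herm_mul, herm_matAct hq hF hM (.inl rfl), h₁, mul_zero])
      (by rw [herm_mul, herm_matAct hq hF hM (.inr rfl), h₃, mul_zero])
      (by rw [aeval_mul_of_isHomogeneous hG, ← aeval_linSubst, h₀, mul_zero])
      (by
        rw [← hl]
        simp only [← Algebra.smul_def, smul_comm (θ _), mul_smul]
        rw [← Finset.smul_sum, sum_smul_matAct, Finset.smul_sum])
    refine ⟨φ, fun i => ?_⟩
    have h1 := map_matAct (φ.restrictScalars F) (frameInv q M) (scaledCoord θ ξ v) i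
    rw [← hz] at h1
    refine h1.trans ?_
    rw [← matAct_matAct hNM ζ]
    congr 1
    funext i
    change φ (scaledCoord θ ξ v i) = _
    rw [scaledCoord, map_mul, hφ, AlgHom.commutes, ← mul_assoc, ← map_mul, ← hcdef,
      mul_inv_cancel₀ hc, map_one, one_mul]


omit [Fintype F] in
theorem IsCurveRing.coord_sub_mem {θ : Fin 5 → L} (ξ : Fin 5 → A) {v : Fin 5 → F}
    (hc : linForm θ v ≠ 0) (i : Fin 5) :
    ξ i - algebraMap L A ((linForm θ v)⁻¹ * algebraMap F L (v i)) ∈ ptIdeal θ ξ v := by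
  have h1 := Ideal.mul_mem_left _ (algebraMap L A (linForm θ v)⁻¹)
    (sub_mem_pointIdeal (scaledCoord θ ξ v) v i)
  rwa [mul_sub, scaledCoord, ← mul_assoc, ← map_mul, inv_mul_cancel₀ hc, map_one, one_mul,
    IsScalarTower.algebraMap_apply F L A, ← map_mul] at h1

omit [Fintype F] in
theorem IsCurveRing.exists_sub_algebraMap_mem {q : ℕ} {G : MvPolynomial (Fin 5) F}
    {θ : Fin 5 → L} {ξ : Fin 5 → A} (h : IsCurveRing q G θ ξ) {v : Fin 5 → F}
    (hc : linForm θ v ≠ 0) (a : A) : ∃ l, a - algebraMap L A l ∈ ptIdeal θ ξ v := by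
  obtain ⟨p, rfl⟩ := h.surj a
  induction p using MvPolynomial.induction_on with
  | C a => exact ⟨a, by simp⟩
  | add p p' hp hp' =>
    obtain ⟨l, hl⟩ := hp
    obtain ⟨l', hl'⟩ := hp'
    refine ⟨l + l', ?_⟩
    rw [map_add, map_add, add_sub_add_comm]
    exact add_mem hl hl'
  | mul_X p i hp =>
    obtain ⟨l, hl⟩ := hp
    refine ⟨l * ((linForm θ v)⁻¹ * algebraMap F L (v i)), ?_⟩
    rw [map_mul, aeval_X, map_mul]
    have := add_mem (Ideal.mul_mem_right (ξ i) _ hl)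
      (Ideal.mul_mem_left _ (algebraMap L A l) (IsCurveRing.coord_sub_mem ξ hc i))
    convert this using 1
    ring

theorem IsCurveRing.ptIdeal_isMaximal {q d : ℕ} (hq : IsPrimePow q)
    (hF : Fintype.card F = q ^ 2)
    {G : MvPolynomial (Fin 5) F} (hG : G.IsHomogeneous d) {θ : Fin 5 → L} {ξ : Fin 5 → A}
    (h : IsCurveRing q G θ ξ) {M : Matrix (Fin 5) (Fin 5) F} (hM : IsHermFrame q M)
    {v : Fin 5 → F} (hv : v = fun i => M i 4) (hc : linForm θ v ≠ 0) (hGv : eval v G = 0) :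
    (ptIdeal θ ξ v).IsMaximal := by
  obtain ⟨z, e, he, -, -, -, -, hpt, huniv⟩ := h.exists_coord hq hF hG hM hv hc
  have hb : basePt L = fun i => algebraMap F L (basePt F i) := by
    funext i
    fin_cases i <;> simp [basePt]
  have h0 : ∀ n, n ≠ 0 → herm n (basePt L) = 0 := fun n hn => by simp [herm, basePt, hn]
  obtain ⟨φ, hφ⟩ := huniv L (basePt L) (h0 _ hq.ne_zero) (h0 _ (pow_ne_zero _ hq.ne_zero))
    (by
      rw [aeval_linSubst, hb]
      have h1 : matAct M (fun i => algebraMap F L (basePt F i)) =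
          fun i => algebraMap F L (v i) := by
        funext i
        rw [matAct_algebraMap, matAct_basePt, ← hv]
      have h2 : aeval (fun i => algebraMap F L (v i)) G = algebraMap F L (eval v G) := by
        have h2 := aeval_algebraMap_apply L v G
        rwa [aeval_eq_eval] at h2
      rw [h1, h2, hGv, map_zero])
    (by
      rw [Fin.sum_univ_five]
      simp [basePt, he])
  have hker : ptIdeal θ ξ v = RingHom.ker φ := by
    have hle : ptIdeal θ ξ v ≤ RingHom.ker φ := by
      rw [← hpt, pointIdeal, Ideal.span_le]
      rintro _ ⟨i, rfl⟩
      rw [SetLike.mem_coe, RingHom.mem_ker, map_sub, hφ, hb,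
        IsScalarTower.algebraMap_apply F L A, AlgHom.commutes]
      exact sub_self _
    refine le_antisymm hle fun a ha => ?_
    obtain ⟨l, hl⟩ := h.exists_sub_algebraMap_mem hc a
    have h1 := hle hl
    rw [RingHom.mem_ker, map_sub, (RingHom.mem_ker).1 ha, AlgHom.commutes, zero_sub,
      neg_eq_zero] at h1
    obtain rfl : l = 0 := h1
    simpa using hl
  rw [hker]
  exact RingHom.ker_isMaximal_of_surjective φ fun l => ⟨algebraMap L A l, φ.commutes l⟩

omit [Fintype F] in
theorem IsCurveRing.finrank_quotient_le_one {q : ℕ} {G : MvPolynomial (Fin 5) F}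
    {θ : Fin 5 → L} {ξ : Fin 5 → A} (h : IsCurveRing q G θ ξ) {v : Fin 5 → F}
    (hc : linForm θ v ≠ 0) {I : Ideal A} (hI : ptIdeal θ ξ v ≤ I) :
    Module.finrank L (A ⧸ I) ≤ 1 := by
  refine finrank_le_one (1 : A ⧸ I) fun w => ?_
  obtain ⟨a, rfl⟩ := Ideal.Quotient.mk_surjective w
  obtain ⟨l, hl⟩ := h.exists_sub_algebraMap_mem hc a
  refine ⟨l, ?_⟩
  rw [← Algebra.algebraMap_eq_smul_one]
  exact (Ideal.Quotient.eq.2 (hI hl)).symm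

omit [Fintype F] in
theorem IsCurveRing.finiteDimensional_quotient_pow {q : ℕ} {G : MvPolynomial (Fin 5) F}
    {θ : Fin 5 → L} {ξ : Fin 5 → A} (h : IsCurveRing q G θ ξ) {v : Fin 5 → F}
    (hc : linForm θ v ≠ 0) (j : ℕ) : FiniteDimensional L (A ⧸ ptIdeal θ ξ v ^ j) := by
  let y : Fin 5 → A := fun i => ξ i - algebraMap L A ((linForm θ v)⁻¹ * algebraMap F L (v i))
  let φ : MvPolynomial (Fin 5) L →ₐ[L] A := aeval y
  have hφ : Function.Surjective φ := by
    rw [← AlgHom.range_eq_top, eq_top_iff]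
    rintro a -
    obtain ⟨p, rfl⟩ := h.surj a
    have hξ : ∀ i, ξ i ∈ φ.range := by
      intro i
      have : ξ i = φ (X i) + algebraMap L A ((linForm θ v)⁻¹ * algebraMap F L (v i)) := by
        simp [φ, y]
      rw [this]
      exact add_mem ⟨_, rfl⟩ (Subalgebra.algebraMap_mem _ _)
    induction p using MvPolynomial.induction_on with
    | C a =>
      rw [aeval_C]
      exact Subalgebra.algebraMap_mem _ _
    | add p p' h h' => rw [map_add]; exact add_mem h h'
    | mul_X p i h => rw [map_mul, aeval_X]; exact mul_mem h (hξ i)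
  have hle : idealOfVars (Fin 5) L ^ j ≤ (ptIdeal θ ξ v ^ j).comap φ := by
    refine le_trans (Ideal.pow_right_mono ?_ j) (Ideal.le_comap_pow φ j)
    rw [idealOfVars, Ideal.span_le]
    rintro _ ⟨i, rfl⟩
    rw [SetLike.mem_coe, Ideal.mem_comap, aeval_X]
    exact IsCurveRing.coord_sub_mem ξ hc i
  refine Module.Finite.of_surjective (Ideal.quotientMapₐ _ φ hle).toLinearMap ?_
  intro a
  obtain ⟨a, rfl⟩ := Ideal.Quotient.mk_surjective a
  obtain ⟨p, rfl⟩ := hφ a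
  exact ⟨Ideal.Quotient.mk _ p, rfl⟩

omit [Fintype F] in
theorem isCoprime_ptIdeal {θ : Fin 5 → L} (ξ : Fin 5 → A)
    (hθ : ∀ v : Fin 5 → F, linForm θ v = 0 → v = 0) {v w : Fin 5 → F} (hv : v ≠ 0)
    (hvw : ∀ a : F, a • v ≠ w) : IsCoprime (ptIdeal θ ξ v) (ptIdeal θ ξ w) := by
  by_cases hw : w = 0
  · exact absurd hw.symm (by simpa using hvw 0)
  have hcv : linForm θ v ≠ 0 := fun h => hv (hθ v h)
  have hcw : linForm θ w ≠ 0 := fun h => hw (hθ w h)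
  obtain ⟨i, hi⟩ := Function.ne_iff.1 hv
  rw [Pi.zero_apply] at hi
  set l := (linForm θ w)⁻¹ * algebraMap F L (w i) - (linForm θ v)⁻¹ * algebraMap F L (v i) with hl
  have hl0 : l ≠ 0 := by
    intro h0
    have h1 : linForm θ (v i • w - w i • v) = 0 := by
      have h2 : linForm θ (v i • w - w i • v) =
          algebraMap F L (v i) * linForm θ w - algebraMap F L (w i) * linForm θ v := by
        simp only [linForm, Finset.mul_sum, ← Finset.sum_sub_distrib]
        exact Finset.sum_congr rfl fun j _ => by simp; ring
      rw [h2]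
      rw [hl, sub_eq_zero, inv_mul_eq_iff_eq_mul₀ hcw, mul_left_comm, eq_inv_mul_iff_mul_eq₀ hcv]
        at h0
      linear_combination -h0
    have h3 := sub_eq_zero.1 (hθ _ h1)
    apply hvw ((v i)⁻¹ * w i)
    rw [mul_smul, ← h3, smul_smul, inv_mul_cancel₀ hi, one_smul]
  rw [Ideal.isCoprime_iff_sup_eq, Ideal.eq_top_iff_one]
  have h1 : algebraMap L A l ∈ ptIdeal θ ξ v ⊔ ptIdeal θ ξ w := by
    have := sub_mem (Ideal.mem_sup_left (IsCurveRing.coord_sub_mem ξ hcv i))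
      (Ideal.mem_sup_right (S := ptIdeal θ ξ v) (IsCurveRing.coord_sub_mem ξ hcw i))
    convert this using 1
    rw [hl, map_sub]
    ring
  have h2 := Ideal.mul_mem_left _ (algebraMap L A l⁻¹) h1
  rwa [← map_mul, inv_mul_cancel₀ hl0, map_one] at h2

end Curve

section Core

variable {F : Type} [Field F] [Fintype F] {L : Type} [Field L] [Algebra F L] {A : Type*}
  [CommRing A] [Algebra L A] [Algebra F A] [IsScalarTower F L A]

omit [IsScalarTower F L A] in
theorem polarCoeff_mem_sup_pow {d : ℕ} {G : MvPolynomial (Fin 5) F} (hG : G.IsHomogeneous d)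
    {θ : Fin 5 → L} {ξ : Fin 5 → A} {v : Fin 5 → F} (hv : eval v G = 0) (hc : linForm θ v ≠ 0)
    {k : ℕ} (hk : k < d) (hd : d ≤ Fintype.card F) {𝔮 : Ideal A}
    (h : ∀ n < k, polarCoeff G ξ n ∈ 𝔮) :
    polarCoeff G ξ k ∈ 𝔮 ⊔ ptIdeal θ ξ v ^ (k + 1) := by
  have hu : IsUnit (algebraMap L A (linForm θ v)) := (IsUnit.mk0 _ hc).map _
  have := (pencil_eq_zero_of_polarCoeff hG (x := scaledCoord θ ξ v) hv hk.le
    (I := 𝔮 ⊔ ptIdeal θ ξ v ^ (k + 1)) (fun _ => le_sup_right)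
    ((Ideal.pow_le_pow_right (by omega)).trans le_sup_right)
    (fun n hn => Ideal.mem_sup_left (by
      unfold scaledCoord
      rw [polarCoeff_mul hG]
      exact Ideal.mul_mem_left _ _ (h n hn))) k).2
  unfold scaledCoord at this
  rw [polarCoeff_mul hG] at this
  exact (Ideal.unit_mul_mem_iff_mem _ (hu.pow _)).1 this

omit [Algebra F A] [IsScalarTower F L A] in
theorem frobMinor_scaledCoord (θ : Fin 5 → L) (ξ : Fin 5 → A) (v : Fin 5 → F) (i j : Fin 5) :
    frobMinor F (scaledCoord θ ξ v) i j =
      algebraMap L A (linForm θ v) ^ (Fintype.card F + 1) * frobMinor F ξ i j := by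
  simp only [frobMinor, scaledCoord]
  ring

omit [IsScalarTower F L A] in
theorem frobMinor_mem_ptIdeal {θ : Fin 5 → L} (ξ : Fin 5 → A) {v : Fin 5 → F}
    (hc : linForm θ v ≠ 0) (i j : Fin 5) : frobMinor F ξ i j ∈ ptIdeal θ ξ v := by
  have hu : IsUnit (algebraMap L A (linForm θ v)) := (IsUnit.mk0 _ hc).map _
  have := frobMinor_mem (scaledCoord θ ξ v) v i j
  rw [frobMinor_scaledCoord] at this
  exact (Ideal.unit_mul_mem_iff_mem _ (hu.pow _)).1 this

theorem ptIdeal_le_of_frobMinor {θ : Fin 5 → L} {ξ : Fin 5 → A} (hl : ∑ i, θ i • ξ i = 1)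
    {v : Fin 5 → F} (hc : linForm θ v ≠ 0) {𝔮 : Ideal A} (h : ∀ i j, frobMinor F ξ i j ∈ 𝔮)
    (n : ℕ) : ptIdeal θ ξ v ≤ 𝔮 ⊔ ptIdeal θ ξ v ^ n := by
  refine pointIdeal_le_of_frobMinor (e := fun i => algebraMap L A (θ i))
    (u := algebraMap L A (linForm θ v)) ((IsUnit.mk0 _ hc).map _) ?_ ?_ ?_ n
  · simp only [scaledCoord, mul_left_comm _ (algebraMap L A (linForm θ v))]
    rw [← Finset.mul_sum]
    simp only [← Algebra.smul_def (θ _)]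
    rw [hl, mul_one]
  · simp only [linForm, map_sum, map_mul, ← IsScalarTower.algebraMap_apply F L A]
  · intro i j
    rw [frobMinor_scaledCoord]
    exact Ideal.mul_mem_left _ _ (h i j)

/-- The point `[0 : 0 : 0 : 0 : 1]` is a singular point of the section of `V(G)` by the tangent
hyperplane `x₀ = 0`. -/
def IsSingularAtBase (G : MvPolynomial (Fin 5) F) : Prop :=
  eval (basePt F) (pderiv 1 G) = 0 ∧ eval (basePt F) (pderiv 2 G) = 0 ∧
    eval (basePt F) (pderiv 3 G) = 0

theorem IsCurveRing.finrank_quotient_le_one_of_smooth {q d : ℕ} (hq : IsPrimePow q)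
    (hF : Fintype.card F = q ^ 2) (hd : 0 < d) (hdq : d ≤ q) {G : MvPolynomial (Fin 5) F}
    (hG : G.IsHomogeneous d) {θ : Fin 5 → L} {ξ : Fin 5 → A} (h : IsCurveRing q G θ ξ)
    {M : Matrix (Fin 5) (Fin 5) F} (hM : IsHermFrame q M) {v : Fin 5 → F}
    (hv : v = fun i => M i 4) (hc : linForm θ v ≠ 0) (hGv : eval v G = 0)
    (hsm : ¬ IsSingularAtBase (linSubst M G))
    (hiso : ∀ t : Fin 3 → F, t ≠ 0 → hermThree q t = 0 →
      ∃ α, eval ![0, t 0, t 1, t 2, α] (linSubst M G) ≠ 0)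
    {𝔮 : Ideal A} [h𝔮 : 𝔮.IsPrime] (hpol : ∀ n < d, polarCoeff G ξ n ∈ 𝔮) (j : ℕ) :
    Module.finrank L (A ⧸ (𝔮 ⊔ ptIdeal θ ξ v ^ j)) ≤ 1 := by
  refine h.finrank_quotient_le_one hc ?_
  have hmax := h.ptIdeal_isMaximal hq hF hG hM hv hc hGv
  by_cases hle : 𝔮 ≤ ptIdeal θ ξ v
  · refine le_trans ?_ le_sup_left
    obtain ⟨z, e, he4, he, hMz, hz₁, hz₃, hpt, -⟩ := h.exists_coord hq hF hG hM hv hc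
    rw [← hpt] at hle hmax ⊢
    have := hmax.isPrime
    refine pointIdeal_le_of_smooth hq hF hd hdq (isHomogeneous_linSubst hG M) ?_ ?_ hiso hz₁ hz₃
      (e := fun i => algebraMap L A (e i)) ?_ ?_ hle ?_
    · rw [eval_linSubst, matAct_basePt]
      exact hv ▸ hGv
    · unfold IsSingularAtBase at hsm
      tauto
    · simpa only [← Algebra.smul_def] using he
    · rw [he4, map_one]
    · intro n hn
      rw [polarCoeff_linSubst, hMz]
      unfold scaledCoord
      rw [polarCoeff_mul hG]
      exact Ideal.mul_mem_left _ _ (hpol n hn)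
  · have h1 : IsCoprime 𝔮 (ptIdeal θ ξ v ^ j) := by
      refine IsCoprime.pow_right ?_
      rw [Ideal.isCoprime_iff_sup_eq, sup_comm]
      exact hmax.1.2 _ (left_lt_sup.2 hle)
    rw [Ideal.isCoprime_iff_sup_eq.1 h1]
    exact le_top

open Classical in
/-- The weight of a point. -/
def ptWeight (G : MvPolynomial (Fin 5) F) : ℝ := if IsSingularAtBase G then 1 / 2 else 1

omit [Fintype F] in
theorem ptWeight_le_one (G : MvPolynomial (Fin 5) F) : ptWeight G ≤ 1 := by
  unfold ptWeight
  split_ifs <;> norm_num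

omit [Fintype F] in
theorem ptWeight_nonneg (G : MvPolynomial (Fin 5) F) : 0 ≤ ptWeight G := by
  unfold ptWeight
  split_ifs <;> norm_num

theorem IsCurveRing.weight_mul_finrank {q d : ℕ} (hq : IsPrimePow q)
    (hF : Fintype.card F = q ^ 2) (hd : 0 < d) {G : MvPolynomial (Fin 5) F}
    (hG : G.IsHomogeneous d) {θ : Fin 5 → L} {ξ : Fin 5 → A} (h : IsCurveRing q G θ ξ)
    {M : Matrix (Fin 5) (Fin 5) F} (hM : IsHermFrame q M) {v : Fin 5 → F}
    (hv : v = fun i => M i 4) (hc : linForm θ v ≠ 0) (hGv : eval v G = 0) (j : ℕ) :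
    ((q : ℝ) + 1) * j ≤ ptWeight (linSubst M G) * Module.finrank L (A ⧸ ptIdeal θ ξ v ^ j) +
      (q + 1) * (q + 3) := by
  obtain ⟨z, e, he4, he, hMz, hz₁, hz₃, hpt, huniv⟩ := h.exists_coord hq hF hG hM hv hc
  have hfd := h.finiteDimensional_quotient_pow hc j
  rw [← hpt] at hfd ⊢
  have hb : eval (basePt F) (linSubst M G) = 0 := by
    rw [eval_linSubst, matAct_basePt]
    exact hv ▸ hGv
  have hG' := isHomogeneous_linSubst hG M
  by_cases hs : IsSingularAtBase (linSubst M G)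
  · have := le_finrank_quotient_pointIdeal_pow hq hF hd hG' hb (s := 2) (.inr ⟨rfl, hs⟩) he4
      huniv j
    rw [ptWeight, if_pos hs]
    have h2 : (2 : ℝ) * (q + 1) * j ≤ Module.finrank L (A ⧸ pointIdeal z (basePt F) ^ j) +
      2 * (q + 1) * (2 + (q + 1)) := by exact_mod_cast this
    linarith
  · have := le_finrank_quotient_pointIdeal_pow hq hF hd hG' hb (s := 1) (.inl rfl) he4 huniv j
    rw [ptWeight, if_neg hs]
    have h2 : (1 : ℝ) * (q + 1) * j ≤ Module.finrank L (A ⧸ pointIdeal z (basePt F) ^ j) +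
      1 * (q + 1) * (1 + (q + 1)) := by exact_mod_cast this
    have : (0 : ℝ) ≤ q := Nat.cast_nonneg q
    nlinarith

/-- The slope that occurs in the estimates. -/
def ptSlope (q d : ℕ) : ℝ := ((d - 1) * (q : ℝ) ^ 2 + 1) / d

theorem degree_le_ptSlope_mul {q d k : ℕ} (hk : k < d) (hdq : d ≤ q) :
    ((d + k * (q ^ 2 - 1) : ℕ) : ℝ) ≤ ptSlope q d * (k + 1 : ℕ) := by
  have hq : 1 ≤ q ^ 2 := Nat.one_le_pow _ _ (by omega)
  have hd : (0 : ℝ) < d := by exact_mod_cast (by omega)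
  rw [ptSlope, div_mul_eq_mul_div, le_div_iff₀ hd]
  have h1 : (0 : ℝ) ≤ d - 1 - k := by
    have : ((k + 1 : ℕ) : ℝ) ≤ d := by exact_mod_cast hk
    push_cast at this
    linarith
  have h2 : (0 : ℝ) ≤ (q : ℝ) ^ 2 - d - 1 ∨ (d : ℝ) - 1 - k = 0 := by
    by_cases h : d = 1
    · right
      have : k = 0 := by omega
      simp [h, this]
    · left
      have h3 : (2 : ℝ) ≤ q := by exact_mod_cast (by omega)
      have h4 : (d : ℝ) ≤ q := by exact_mod_cast hdq
      nlinarith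
  have h3 : 0 ≤ (d - 1 - k : ℝ) * ((q : ℝ) ^ 2 - d - 1) := by
    rcases h2 with h2 | h2
    · exact mul_nonneg h1 h2
    · rw [h2, zero_mul]
  push_cast [Nat.cast_sub hq]
  linarith

theorem half_le_ptSlope {q d : ℕ} (hd : 1 < d) (hq : 1 ≤ q) :
    1 / 2 * ((q ^ 2 + 1 : ℕ) : ℝ) ≤ ptSlope q d := by
  have hd' : (2 : ℝ) ≤ d := by exact_mod_cast hd
  have hq' : (1 : ℝ) ≤ q := by exact_mod_cast hq
  rw [ptSlope, le_div_iff₀ (by linarith)]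
  push_cast
  nlinarith [mul_nonneg (sub_nonneg.2 hd') (by nlinarith : (0 : ℝ) ≤ (q : ℝ) ^ 2 - 1)]

theorem ptSlope_nonneg {q d : ℕ} (hd : 1 < d) : 0 ≤ ptSlope q d := by
  have hd' : (2 : ℝ) ≤ d := by exact_mod_cast hd
  unfold ptSlope
  have : (0 : ℝ) ≤ (d - 1) * (q : ℝ) ^ 2 := mul_nonneg (by linarith) (sq_nonneg _)
  positivity

theorem IsCurveRing.card_le {q d : ℕ} (hq : IsPrimePow q)
    (hF : Fintype.card F = q ^ 2) (hd : 1 < d) (hdq : d ≤ q) {G : MvPolynomial (Fin 5) F}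
    (hG : G.IsHomogeneous d) (hG4 : G.coeff (Finsupp.single 4 d) ≠ 0) {θ : Fin 5 → L}
    (hθ : ∀ v : Fin 5 → F, linForm θ v = 0 → v = 0) {ξ : Fin 5 → A}
    (h : IsCurveRing q G θ ξ) {ι : Type*} [Fintype ι] {M : ι → Matrix (Fin 5) (Fin 5) F}
    (hM : ∀ P, IsHermFrame q (M P)) {v : ι → Fin 5 → F} (hv0 : ∀ P, v P ≠ 0)
    (hv : ∀ P, v P = fun i => M P i 4) (hGv : ∀ P, eval (v P) G = 0)
    (hvw : Pairwise fun P P' => ∀ a : F, a • v P ≠ v P')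
    (hiso : ∀ P, ∀ t : Fin 3 → F, t ≠ 0 → hermThree q t = 0 →
      ∃ α, eval ![0, t 0, t 1, t 2, α] (linSubst (M P) G) ≠ 0) :
    Fintype.card ι ≤ (q ^ 3 + 1) * ((d - 1) * q ^ 2 + 1) := by
  classical
  have hq2 := hq.two_le
  have hc : ∀ P, linForm θ (v P) ≠ 0 := fun P h0 => hv0 P (hθ _ h0)
  have hnoeth : IsNoetherianRing A := isNoetherianRing_of_surjective _ _
    (aeval (R := L) ξ).toRingHom h.surj
  obtain ⟨c, hcb⟩ := sum_finrank_quotient_pow_le (degFiltration ξ h.surj)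
    (𝔪 := fun P => ptIdeal θ ξ (v P)) (fun P P' hP => isCoprime_ptIdeal ξ hθ (hv0 P) (hvw hP))
    (fun P j => h.finiteDimensional_quotient_pow (hc P) j)
    (w := fun P => ptWeight (linSubst (M P) G)) (fun P => ptWeight_nonneg _)
    (ρ := ptSlope q d) (ptSlope_nonneg hd)
    (κ := d * (q + 1) * (q ^ 3 + 1)) (c₀ := d * (q + 1) * (q ^ 3 + 1))
    (fun n => finrank_degSpan_le hq2 (by omega) h.lin h.herm_one h.herm_three
      (G := map (algebraMap F L) G) (hG.map _)
      (by rwa [coeff_map, (map_ne_zero _)]) (by rw [aeval_map_algebraMap, h.zero]) n) (by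
    intro 𝔮 h𝔮
    by_cases hgood : ∃ k, k < d ∧ polarCoeff G ξ k ∉ 𝔮
    · have hk := Nat.find_spec hgood
      set k := Nat.find hgood with hkdef
      have hmin : ∀ n < k, polarCoeff G ξ n ∈ 𝔮 := fun n hn => by
        by_contra hn'
        exact Nat.find_min hgood hn ⟨hn.trans hk.1, hn'⟩
      refine ⟨Finset.univ, d + k * (q ^ 2 - 1), k + 1, polarCoeff G ξ k, 0, by omega,
        by omega, hk.2, hF ▸ polarCoeff_mem_degSpan hG ξ k, fun P _ => ⟨?_, ?_⟩,
        fun P hP => absurd (Finset.mem_univ P) hP⟩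
      · exact polarCoeff_mem_sup_pow hG (hGv P) (hc P) hk.1 (by rw [hF]; nlinarith) hmin
      · refine le_trans ?_ (degree_le_ptSlope_mul hk.1 hdq)
        exact mul_le_of_le_one_left (Nat.cast_nonneg _) (ptWeight_le_one _)
    push Not at hgood
    by_cases hmin : ∀ i j, frobMinor F ξ i j ∈ 𝔮
    · refine ⟨∅, 1, 1, 1, 1, one_pos, one_pos, (Ideal.ne_top_iff_one _).1 h𝔮.ne_top, ?_, by simp,
        fun P _ j => h.finrank_quotient_le_one (hc P)
          (ptIdeal_le_of_frobMinor h.lin (hc P) hmin j)⟩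
      have h1 := degSpan_mono ξ (by simp : 0 * 1 ≤ 1)
        (pow_mem_degSpan (L := L) ξ (self_mem_degSpan ξ 0) 0)
      rwa [pow_zero] at h1
    · push Not at hmin
      obtain ⟨i, j, hij⟩ := hmin
      refine ⟨Finset.univ.filter fun P => IsSingularAtBase (linSubst (M P) G), q ^ 2 + 1, 1,
        frobMinor F ξ i j, 1, by omega, one_pos, hij, ?_, fun P hP => ⟨?_, ?_⟩,
        fun P hP j => ?_⟩
      · have h1 : ∀ i j, ξ i * ξ j ^ Fintype.card F ∈ degSpan L ξ (q ^ 2 + 1) := fun i j => by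
          have := mul_mem_degSpan ξ (self_mem_degSpan (L := L) ξ i)
            (pow_mem_degSpan ξ (self_mem_degSpan (L := L) ξ j) (q ^ 2))
          rw [mul_one, add_comm] at this
          rwa [hF]
        exact sub_mem (h1 i j) (h1 j i)
      · rw [pow_one]
        exact Ideal.mem_sup_right (frobMinor_mem_ptIdeal ξ (hc P) i j)
      · rw [Nat.cast_one, mul_one, ptWeight, if_pos (Finset.mem_filter.1 hP).2]
        exact half_le_ptSlope hd (by omega)
      · refine h.finrank_quotient_le_one_of_smooth hq hF (by omega) hdq hG (hM P) (hv P) (hc P)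
          (hGv P) ?_ (hiso P) hgood j
        simpa using hP)
  have hlin : ∀ j : ℕ, (Fintype.card ι : ℝ) * (q + 1) * j ≤
      ptSlope q d * (d * (q + 1) * (q ^ 3 + 1) : ℕ) * j +
        (c + Fintype.card ι * ((q + 1) * (q + 3))) := by
    intro j
    have h1 := Finset.sum_le_sum fun P (_ : P ∈ Finset.univ) =>
      h.weight_mul_finrank hq hF (by omega) hG (hM P) (hv P) (hc P) (hGv P) j
    rw [Finset.sum_add_distrib] at h1
    simp only [Finset.sum_const, Finset.card_univ, nsmul_eq_mul] at h1
    linarith [hcb j]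
  have hd0 : (d : ℝ) ≠ 0 := by positivity
  have hq1 : (0 : ℝ) < q + 1 := by positivity
  have hkey : (Fintype.card ι : ℝ) ≤ (q ^ 3 + 1) * ((d - 1) * q ^ 2 + 1) := by
    by_contra hcon
    rw [not_le] at hcon
    have hs : ptSlope q d * (d * (q + 1) * (q ^ 3 + 1) : ℕ) =
        (q + 1) * ((q ^ 3 + 1) * ((d - 1) * q ^ 2 + 1)) := by
      rw [ptSlope]
      push_cast
      field_simp
    rw [hs] at hlin
    obtain ⟨j, hj⟩ := exists_nat_gt ((c + Fintype.card ι * ((q + 1) * (q + 3))) /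
      ((Fintype.card ι - (q ^ 3 + 1) * ((d - 1) * q ^ 2 + 1)) * (q + 1)))
    rw [div_lt_iff₀ (mul_pos (sub_pos.2 hcon) hq1)] at hj
    linarith [hlin j]
  have : (Fintype.card ι : ℝ) ≤ ((q ^ 3 + 1) * ((d - 1) * q ^ 2 + 1) : ℕ) := by
    push_cast [Nat.cast_sub hd.le]
    exact hkey
  exact_mod_cast this

end Core

section Existence

variable {F : Type} [Field F]

/-- The ideal of the affine chart `∑ θᵢ xᵢ = 1` of the curve. -/
def curveIdeal (q : ℕ) (G : MvPolynomial (Fin 5) F) {L : Type} [Field L] [Algebra F L]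
    (θ : Fin 5 → L) : Ideal (MvPolynomial (Fin 5) L) :=
  Ideal.span {herm q X, herm (q ^ 3) X, map (algebraMap F L) G, ∑ i, θ i • X i - 1}

theorem map_herm {A B : Type*} [CommRing A] [CommRing B] (φ : A →+* B) (n : ℕ) (x : Fin 5 → A) :
    φ (herm n x) = herm n fun i => φ (x i) := by
  simp [herm]

theorem isCurveRing_curveIdeal (q : ℕ) (G : MvPolynomial (Fin 5) F) {L : Type} [Field L]
    [Algebra F L] (θ : Fin 5 → L) :
    IsCurveRing (A := MvPolynomial (Fin 5) L ⧸ curveIdeal q G θ) q G θ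
      fun i => Ideal.Quotient.mk _ (X i) := by
  have hmk : ∀ a ∈ curveIdeal q G θ, Ideal.Quotient.mk (curveIdeal q G θ) a = 0 :=
    fun a => Ideal.Quotient.eq_zero_iff_mem.2
  have hs : ∀ a, a ∈ ({herm q X, herm (q ^ 3) X, map (algebraMap F L) G, ∑ i, θ i • X i - 1} :
      Set (MvPolynomial (Fin 5) L)) → Ideal.Quotient.mk (curveIdeal q G θ) a = 0 :=
    fun a ha => hmk a (Ideal.subset_span ha)
  have hae : ∀ p : MvPolynomial (Fin 5) L,
      aeval (fun i => Ideal.Quotient.mk (curveIdeal q G θ) (X i)) p = Ideal.Quotient.mk _ p := by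
    intro p
    have := comp_aeval_apply (f := (X : Fin 5 → MvPolynomial (Fin 5) L))
      (Ideal.Quotient.mkₐ L (curveIdeal q G θ)) p
    rw [aeval_X_left_apply] at this
    exact this.symm
  refine ⟨fun a => ?_, ?_, ?_, ?_, ?_, ?_⟩
  · obtain ⟨p, rfl⟩ := Ideal.Quotient.mk_surjective a
    exact ⟨p, hae p⟩
  · have h := hs (∑ i, θ i • X i - 1) (by simp)
    rw [map_sub, map_one, sub_eq_zero, map_sum] at h
    exact h
  · rw [← map_herm]
    exact hs _ (by simp)
  · rw [← map_herm]
    exact hs _ (by simp)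
  · rw [← aeval_map_algebraMap L, hae]
    exact hs _ (by simp)
  · intro B _ _ _ _ ζ h₁ h₃ h₀ hl
    have hle : ∀ a ∈ curveIdeal q G θ, aeval (R := L) ζ a = 0 := by
      intro a ha
      rw [← RingHom.mem_ker]
      refine (Ideal.span_le.2 ?_) ha
      rintro b (rfl | rfl | rfl | rfl)
      · rw [SetLike.mem_coe, RingHom.mem_ker]
        have := map_herm (aeval (R := L) ζ).toRingHom q X
        refine this.trans ?_
        simpa using h₁
      · rw [SetLike.mem_coe, RingHom.mem_ker]
        have := map_herm (aeval (R := L) ζ).toRingHom (q ^ 3) X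
        refine this.trans ?_
        simpa using h₃
      · rw [SetLike.mem_coe, RingHom.mem_ker, aeval_map_algebraMap, h₀]
      · rw [SetLike.mem_coe, RingHom.mem_ker]
        simp [hl]
    exact ⟨Ideal.Quotient.liftₐ _ (aeval (R := L) ζ) hle, fun i =>
      aeval_X (R := L) ζ i⟩

theorem linForm_X_pow_eq_zero (v : Fin 5 → F)
    (h : linForm (fun i : Fin 5 => (RatFunc.X : RatFunc F) ^ (i : ℕ)) v = 0) : v = 0 := by
  have h1 : algebraMap (Polynomial F) (RatFunc F)
      (∑ i : Fin 5, Polynomial.C (v i) * Polynomial.X ^ (i : ℕ)) = 0 := by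
    rw [← h, linForm, map_sum]
    refine Finset.sum_congr rfl fun i _ => ?_
    rw [map_mul, map_pow, RatFunc.algebraMap_X, RatFunc.algebraMap_C, mul_comm]
    rfl
  rw [map_eq_zero_iff _ (RatFunc.algebraMap_injective F)] at h1
  funext i
  have h2 := congrArg (fun p => Polynomial.coeff p (i : ℕ)) h1
  simpa [Polynomial.finsetSum_coeff, Polynomial.coeff_X_pow, Fin.val_inj] using h2

variable [Fintype F]

/-- A Stöhr–Voloch type bound for the number of points of the section of the Hermitian threefold
by a hypersurface that contains no generator. -/
theorem card_le_of_isHermFrame {q d : ℕ} (hq : IsPrimePow q)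
    (hF : Fintype.card F = q ^ 2) (hd : 1 < d) (hdq : d ≤ q) {G : MvPolynomial (Fin 5) F}
    (hG : G.IsHomogeneous d) (hG4 : G.coeff (Finsupp.single 4 d) ≠ 0) {ι : Type*} [Fintype ι]
    {M : ι → Matrix (Fin 5) (Fin 5) F}
    (hM : ∀ P, IsHermFrame q (M P)) {v : ι → Fin 5 → F} (hv0 : ∀ P, v P ≠ 0)
    (hv : ∀ P, v P = fun i => M P i 4) (hGv : ∀ P, eval (v P) G = 0)
    (hvw : Pairwise fun P P' => ∀ a : F, a • v P ≠ v P')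
    (hiso : ∀ P, ∀ t : Fin 3 → F, t ≠ 0 → hermThree q t = 0 →
      ∃ α, eval ![0, t 0, t 1, t 2, α] (linSubst (M P) G) ≠ 0) :
    Fintype.card ι ≤ (q ^ 3 + 1) * ((d - 1) * q ^ 2 + 1) :=
  (isCurveRing_curveIdeal q G _).card_le hq hF hd hdq hG hG4 linForm_X_pow_eq_zero hM hv0 hv hGv
    hvw hiso

end Existence

section Hermitian

variable {F : Type*} [Field F] [Fintype F] {q : ℕ}

theorem card_filter_pow_add_self_le [DecidableEq F] (hq : 2 ≤ q) (β : F) :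
    (Finset.univ.filter fun c : F => c ^ q + c + β = 0).card ≤ q := by
  have hdeg : (Polynomial.X + Polynomial.C β : Polynomial F).natDegree < q :=
    (Polynomial.natDegree_X_add_C β).trans_lt (by omega)
  set p : Polynomial F := Polynomial.X ^ q + (Polynomial.X + Polynomial.C β)
  have hp : p.natDegree = q := by
    rw [Polynomial.natDegree_add_eq_left_of_natDegree_lt (by simpa using hdeg)]
    simp
  have hp0 : p ≠ 0 := by
    rintro h
    rw [h, Polynomial.natDegree_zero] at hp
    omega
  calc _ ≤ p.roots.toFinset.card := by
        refine Finset.card_le_card fun c hc => ?_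
        rw [Multiset.mem_toFinset, Polynomial.mem_roots hp0]
        simpa [p, add_assoc] using hc
    _ ≤ _ := (Multiset.toFinset_card_le _).trans ((Polynomial.card_roots' p).trans hp.le)

theorem pow_pow_eq_self (hF : Fintype.card F = q ^ 2) (a : F) : (a ^ q) ^ q = a := by
  rw [← pow_mul, ← sq, ← hF, FiniteField.pow_card]

theorem exists_pow_add_self_ne_zero (hq : 2 ≤ q) (hF : Fintype.card F = q ^ 2) :
    ∃ c : F, c ^ q + c ≠ 0 := by
  classical
  by_contra! h
  have := card_filter_pow_add_self_le (F := F) hq 0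
  rw [Finset.filter_true_of_mem (by simpa using h), Finset.card_univ, hF] at this
  nlinarith

theorem exists_pow_add_self_eq (hq : IsPrimePow q) (hF : Fintype.card F = q ^ 2) {α : F}
    (hα : α ^ q = α) : ∃ c : F, c ^ q + c = α := by
  obtain ⟨x, hx⟩ := exists_pow_add_self_ne_zero (F := F) hq.two_le hF
  have ht : (x ^ q + x) ^ q = x ^ q + x := by
    rw [add_pow_of_card_eq hq hF, pow_pow_eq_self hF, add_comm]
  refine ⟨α * x / (x ^ q + x), ?_⟩
  rw [div_pow, mul_pow, ht, hα]
  field_simp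

theorem exists_pow_succ_eq (hq : 2 ≤ q) (hF : Fintype.card F = q ^ 2) {α : F}
    (hα : α ^ q = α) : ∃ c : F, c ^ (q + 1) = α := by
  classical
  by_cases h0 : α = 0
  · exact ⟨0, by simp [h0]⟩
  obtain ⟨g, hg⟩ := IsCyclic.exists_generator (α := Fˣ)
  obtain ⟨k, hk⟩ := (mem_powers_iff_mem_zpowers (x := g)).2 (hg (Units.mk0 α h0))
  have hk' : g ^ k = Units.mk0 α h0 := hk
  have h1 : g ^ (k * (q - 1)) = 1 := by
    rw [pow_mul, hk', ← Units.val_inj, Units.val_pow_eq_pow_val, Units.val_mk0, Units.val_one]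
    have : α ^ (q - 1) * α = 1 * α := by
      rw [← pow_succ, Nat.sub_add_cancel (by omega), hα, one_mul]
    exact mul_right_cancel₀ h0 this
  have h2 := orderOf_dvd_of_pow_eq_one h1
  rw [orderOf_eq_card_of_forall_mem_zpowers hg, Nat.card_eq_fintype_card, Fintype.card_units, hF]
    at h2
  have h3 : q ^ 2 - 1 = (q + 1) * (q - 1) := by
    obtain ⟨m, rfl⟩ : ∃ m, q = m + 1 := ⟨q - 1, by omega⟩
    rw [Nat.add_sub_cancel]
    refine Nat.sub_eq_of_eq_add ?_
    ring
  rw [h3] at h2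
  obtain ⟨m, rfl⟩ := Nat.dvd_of_mul_dvd_mul_right (by omega) h2
  refine ⟨(g ^ m : Fˣ), ?_⟩
  have := congrArg Units.val hk'
  rw [Units.val_mk0] at this
  rw [← this, mul_comm, pow_mul, Units.val_pow_eq_pow_val _ (q + 1)]

omit [Fintype F] in
/-- The Hermitian form `∑ xᵢ ^ q yᵢ` as a linear form in `y`. -/
def hermDot (q : ℕ) (x : Fin 5 → F) : (Fin 5 → F) →ₗ[F] F :=
  ∑ i, (x i ^ q) • LinearMap.proj i

omit [Fintype F] in
theorem hermDot_apply (q : ℕ) (x y : Fin 5 → F) : hermDot q x y = ∑ i, x i ^ q * y i := by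
  simp [hermDot]

theorem hermDot_add (hq : IsPrimePow q) (hF : Fintype.card F = q ^ 2) (x x' : Fin 5 → F) :
    hermDot q (x + x') = hermDot q x + hermDot q x' := by
  simp [hermDot, add_pow_of_card_eq hq hF, add_smul, Finset.sum_add_distrib]

omit [Fintype F] in
theorem hermDot_smul (c : F) (x : Fin 5 → F) : hermDot q (c • x) = c ^ q • hermDot q x := by
  simp [hermDot, mul_pow, mul_smul, Finset.smul_sum]

omit [Fintype F] in
theorem hermDot_zero (hq : q ≠ 0) : hermDot q (0 : Fin 5 → F) = 0 := by
  simp [hermDot, hq]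

theorem hermDot_comm (hq : IsPrimePow q) (hF : Fintype.card F = q ^ 2) (x y : Fin 5 → F) :
    hermDot q y x = hermDot q x y ^ q := by
  rw [hermDot_apply, hermDot_apply, Fin.sum_univ_five, Fin.sum_univ_five]
  simp only [add_pow_of_card_eq hq hF, mul_pow, pow_pow_eq_self hF]
  ring

theorem hermDot_eq_zero_comm (hq : IsPrimePow q) (hF : Fintype.card F = q ^ 2) {x y : Fin 5 → F}
    (h : hermDot q x y = 0) : hermDot q y x = 0 := by
  rw [hermDot_comm hq hF, h, zero_pow hq.ne_zero]

theorem hermDot_eq_one_comm (hq : IsPrimePow q) (hF : Fintype.card F = q ^ 2) {x y : Fin 5 → F}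
    (h : hermDot q x y = 1) : hermDot q y x = 1 := by
  rw [hermDot_comm hq hF, h, one_pow]

omit [Fintype F] in
theorem eq_zero_of_hermDot {x : Fin 5 → F} (h : ∀ y, hermDot q x y = 0) : x = 0 := by
  funext i
  have := h (Pi.single i 1)
  rw [hermDot_apply] at this
  simp only [Pi.single_apply, mul_ite, mul_one, mul_zero, Finset.sum_ite_eq', Finset.mem_univ,
    if_true] at this
  exact eq_zero_of_pow_eq_zero this

theorem hermDot_eq_zero_of_isotropic (hq : IsPrimePow q) (hF : Fintype.card F = q ^ 2)
    {x y : Fin 5 → F} (h : ∀ a b : F, hermDot q (a • x + b • y) (a • x + b • y) = 0) :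
    hermDot q x y = 0 := by
  have hx := h 1 0
  have hy := h 0 1
  simp only [one_smul, zero_smul, add_zero, zero_add] at hx hy
  by_contra h0
  obtain ⟨c, hc⟩ := exists_pow_add_self_ne_zero (F := F) hq.two_le hF
  apply hc
  have h1 := h 1 (c / hermDot q x y)
  rw [one_smul, hermDot_add hq hF, hermDot_smul, LinearMap.add_apply, LinearMap.smul_apply, map_add,
    map_add, map_smul, map_smul, hx, hy, hermDot_comm hq hF x y, smul_eq_mul, smul_eq_mul,
    smul_eq_mul, div_mul_cancel₀ _ h0, mul_zero, add_zero, zero_add, ← mul_pow,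
    div_mul_cancel₀ _ h0] at h1
  rw [add_comm]
  exact h1

omit [Fintype F] in
theorem exists_hermDot_eq_one {x : Fin 5 → F} (hx : x ≠ 0) : ∃ y, hermDot q x y = 1 := by
  by_contra! h
  refine hx (eq_zero_of_hermDot (q := q) fun y => ?_)
  by_contra h0
  exact h ((hermDot q x y)⁻¹ • y) (by rw [map_smul, smul_eq_mul, inv_mul_cancel₀ h0])

theorem exists_hermDot_eq_one_and_zero (hF : Fintype.card F = q ^ 2) {x x' : Fin 5 → F}
    (h : ∀ c : F, x ≠ c • x') : ∃ y, hermDot q x y = 1 ∧ hermDot q x' y = 0 := by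
  by_contra! hcon
  have hker : ∀ y, hermDot q x' y = 0 → hermDot q x y = 0 := by
    intro y hy
    by_contra h0
    exact hcon ((hermDot q x y)⁻¹ • y) (by rw [map_smul, smul_eq_mul, inv_mul_cancel₀ h0])
      (by rw [map_smul, hy, smul_zero])
  have hx : x ≠ 0 := by simpa using h 0
  have hx' : x' ≠ 0 := by
    rintro rfl
    obtain ⟨y, hy⟩ := exists_hermDot_eq_one (q := q) hx
    refine hcon y hy ?_
    by_cases hq0 : q = 0
    · subst hq0
      rw [zero_pow two_ne_zero] at hF
      exact absurd hF Fintype.card_ne_zero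
    · rw [hermDot_zero hq0]
      rfl
  obtain ⟨w, hw⟩ := exists_hermDot_eq_one (q := q) hx'
  refine h (hermDot q x w ^ q) ?_
  have h1 : ∀ y, hermDot q x y = hermDot q x w * hermDot q x' y := by
    intro y
    have := hker (y - hermDot q x' y • w) (by
      rw [map_sub, map_smul, hw, smul_eq_mul, mul_one, sub_self])
    rw [map_sub, map_smul, smul_eq_mul, sub_eq_zero] at this
    rw [this, mul_comm]
  funext i
  have h2 := h1 (Pi.single i 1)
  simp only [hermDot_apply, Pi.single_apply, mul_ite, mul_one, mul_zero, Finset.sum_ite_eq',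
    Finset.mem_univ, if_true] at h2
  rw [← pow_pow_eq_self hF (x i), h2, mul_pow, pow_pow_eq_self hF, hermDot_apply]
  rfl

/-- A hyperbolic system that does not span contains a unit vector in its orthogonal complement. -/
theorem exists_orthogonal_unit (hq : IsPrimePow q) (hF : Fintype.card F = q ^ 2) {k : ℕ}
    (hk : k < 5) {b : Fin k → Fin 5 → F} {σ : Fin k → Fin k} (hσ : Function.Involutive σ)
    (hb : ∀ i j, hermDot q (b i) (b j) = if j = σ i then 1 else 0) :
    ∃ z, hermDot q z z = 1 ∧ ∀ i, hermDot q (b i) z = 0 := by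
  have hproj : ∀ y, ∀ i, hermDot q (b i) (y - ∑ j, hermDot q (b (σ j)) y • b j) = 0 := by
    intro y i
    rw [map_sub, map_sum]
    simp only [map_smul, hb, smul_eq_mul, mul_ite, mul_one, mul_zero, Finset.sum_ite_eq',
      Finset.mem_univ, if_true, hσ i, sub_self]
  suffices h : ∃ z, hermDot q z z ≠ 0 ∧ ∀ i, hermDot q (b i) z = 0 by
    obtain ⟨z, hz, hbz⟩ := h
    obtain ⟨c, hc⟩ := exists_pow_succ_eq (F := F) hq.two_le hF (α := (hermDot q z z)⁻¹)
      (by rw [inv_pow, ← hermDot_comm hq hF])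
    refine ⟨c • z, ?_, fun i => by rw [map_smul, hbz, smul_zero]⟩
    rw [hermDot_smul, LinearMap.smul_apply, map_smul, smul_eq_mul, smul_eq_mul, ← mul_assoc,
      ← pow_succ, hc, inv_mul_cancel₀ hz]
  by_contra! hcon
  have hcon' : ∀ z, (∀ i, hermDot q (b i) z = 0) → hermDot q z z = 0 := by
    intro z hz
    by_contra h0
    obtain ⟨i, hi⟩ := hcon z h0
    exact hi (hz i)
  have hspan : ∀ y, y = ∑ j, hermDot q (b (σ j)) y • b j := by
    intro y
    rw [← sub_eq_zero]
    set y' := y - ∑ j, hermDot q (b (σ j)) y • b j with hy'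
    refine eq_zero_of_hermDot (q := q) fun w => ?_
    set w' := w - ∑ j, hermDot q (b (σ j)) w • b j with hw'
    have h1 : hermDot q y' w' = 0 := hermDot_eq_zero_of_isotropic hq hF fun a b =>
      hcon' _ fun i => by rw [map_add, map_smul, map_smul, hproj, hproj, smul_zero, smul_zero,
        add_zero]
    rw [hw', map_sub, map_sum, sub_eq_zero] at h1
    rw [h1]
    refine Finset.sum_eq_zero fun j _ => ?_
    rw [map_smul, hermDot_eq_zero_comm hq hF (hproj y j), smul_zero]
  have htop : Submodule.span F (Set.range b) = ⊤ := by
    rw [eq_top_iff]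
    rintro y -
    rw [hspan y]
    exact Submodule.sum_mem _ fun j _ => Submodule.smul_mem _ _ (Submodule.subset_span ⟨j, rfl⟩)
  have := finrank_range_le_card (R := F) b
  rw [Set.finrank, htop, finrank_top, Module.finrank_fin_fun, Fintype.card_fin] at this
  omega

end Hermitian

section FermatFrame

variable {F : Type*} [Field F] {q : ℕ}

/-- The columns of `T` form a hyperbolic basis for the Hermitian form `∑ xᵢ ^ q yᵢ`. -/
def IsFermatFrame (q : ℕ) (T : Matrix (Fin 5) (Fin 5) F) : Prop :=
  ∀ m k, hermDot q (fun i => T i m) (fun i => T i k) = if k = Fin.rev m then 1 else 0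

/-- The inverse of a hyperbolic basis. -/
def fermatInv (q : ℕ) (T : Matrix (Fin 5) (Fin 5) F) : Matrix (Fin 5) (Fin 5) F :=
  fun m i => T i (Fin.rev m) ^ q

theorem fermatInv_mul {T : Matrix (Fin 5) (Fin 5) F} (h : IsFermatFrame q T) :
    fermatInv q T * T = 1 := by
  ext m k
  have h1 := h (Fin.rev m) k
  rw [Fin.rev_rev, hermDot_apply] at h1
  rw [Matrix.mul_apply, Matrix.one_apply]
  simp only [eq_comm (a := m)]
  exact h1

theorem mul_fermatInv {T : Matrix (Fin 5) (Fin 5) F} (h : IsFermatFrame q T) :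
    T * fermatInv q T = 1 :=
  mul_eq_one_comm.1 (fermatInv_mul h)

variable [Fintype F]

theorem exists_isotropic_add_smul (hq : IsPrimePow q) (hF : Fintype.card F = q ^ 2)
    {p y : Fin 5 → F} (hp : hermDot q p p = 0) (hy : hermDot q p y = 1) :
    ∃ c : F, hermDot q (y + c • p) (y + c • p) = 0 := by
  obtain ⟨c, hc⟩ := exists_pow_add_self_eq hq hF (α := -hermDot q y y) (by
    have := add_pow_of_card_eq hq hF (hermDot q y y) (-hermDot q y y)
    rw [add_neg_cancel, zero_pow hq.ne_zero, ← hermDot_comm hq hF] at this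
    linear_combination -this)
  refine ⟨c, ?_⟩
  rw [hermDot_add hq hF, hermDot_smul, LinearMap.add_apply, LinearMap.smul_apply, map_add, map_add,
    map_smul, map_smul, hp, hy, hermDot_eq_one_comm hq hF hy]
  simp only [smul_eq_mul]
  linear_combination hc

theorem exists_isFermatFrame_pair (hq : IsPrimePow q) (hF : Fintype.card F = q ^ 2)
    {p p' : Fin 5 → F} (hpp : hermDot q p p = 0) (hpp' : hermDot q p p' = 0)
    (hp'p' : hermDot q p' p' = 0) (hind : ∀ c : F, p ≠ c • p') (hind' : ∀ c : F, p' ≠ c • p) :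
    ∃ T, IsFermatFrame q T ∧ (fun i => T i 4) = p ∧ (fun i => T i 3) = p' := by
  have hp'p := hermDot_eq_zero_comm hq hF hpp'
  obtain ⟨y, hpy, hp'y⟩ := exists_hermDot_eq_one_and_zero hF hind
  obtain ⟨c, hc⟩ := exists_isotropic_add_smul hq hF hpp hpy
  set b₀ := y + c • p
  have hpb₀ : hermDot q p b₀ = 1 := by simp [b₀, hpy, hpp]
  have hp'b₀ : hermDot q p' b₀ = 0 := by simp [b₀, hp'y, hp'p]
  have hb₀p := hermDot_eq_one_comm hq hF hpb₀
  have hb₀p' := hermDot_eq_zero_comm hq hF hp'b₀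
  obtain ⟨w, hp'w, hpw⟩ := exists_hermDot_eq_one_and_zero hF hind'
  set w' := w - hermDot q b₀ w • p
  have hpw' : hermDot q p w' = 0 := by simp [w', hpw, hpp]
  have hp'w' : hermDot q p' w' = 1 := by simp [w', hp'w, hp'p]
  have hb₀w' : hermDot q b₀ w' = 0 := by simp [w', hb₀p]
  obtain ⟨c', hc'⟩ := exists_isotropic_add_smul hq hF hp'p' hp'w'
  set b₁ := w' + c' • p'
  have hpb₁ : hermDot q p b₁ = 0 := by simp [b₁, hpw', hpp']
  have hp'b₁ : hermDot q p' b₁ = 1 := by simp [b₁, hp'w', hp'p']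
  have hb₀b₁ : hermDot q b₀ b₁ = 0 := by simp [b₁, hb₀w', hb₀p']
  have hb₁p := hermDot_eq_zero_comm hq hF hpb₁
  have hb₁p' := hermDot_eq_one_comm hq hF hp'b₁
  have hb₁b₀ := hermDot_eq_zero_comm hq hF hb₀b₁
  obtain ⟨z, hz, hbz⟩ := exists_orthogonal_unit hq hF (k := 4) (by norm_num)
    (b := ![b₀, b₁, p', p]) (σ := Fin.rev) Fin.rev_involutive (by
      intro i j
      fin_cases i <;> fin_cases j <;> simp [*, Fin.rev, Fin.ext_iff])
  have h0 : hermDot q b₀ z = 0 := hbz 0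
  have h1 : hermDot q b₁ z = 0 := hbz 1
  have h2 : hermDot q p' z = 0 := hbz 2
  have h3 : hermDot q p z = 0 := hbz 3
  have h0' := hermDot_eq_zero_comm hq hF h0
  have h1' := hermDot_eq_zero_comm hq hF h1
  have h2' := hermDot_eq_zero_comm hq hF h2
  have h3' := hermDot_eq_zero_comm hq hF h3
  refine ⟨fun i m => (![b₀, b₁, z, p', p] : Fin 5 → Fin 5 → F) m i, fun m k => ?_, rfl, rfl⟩
  change hermDot q (![b₀, b₁, z, p', p] m) (![b₀, b₁, z, p', p] k) = _
  fin_cases m <;> fin_cases k <;> simp [*, Fin.rev, Fin.ext_iff]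

theorem exists_isFermatFrame (hq : IsPrimePow q) (hF : Fintype.card F = q ^ 2)
    {p : Fin 5 → F} (hp : p ≠ 0) (hpp : hermDot q p p = 0) :
    ∃ T, IsFermatFrame q T ∧ (fun i => T i 4) = p := by
  obtain ⟨y, hpy⟩ := exists_hermDot_eq_one (q := q) hp
  obtain ⟨c, hc⟩ := exists_isotropic_add_smul hq hF hpp hpy
  set b₀ := y + c • p
  have hpb₀ : hermDot q p b₀ = 1 := by simp [b₀, hpy, hpp]
  have hb₀p := hermDot_eq_one_comm hq hF hpb₀
  obtain ⟨y₁, h11, hb1⟩ := exists_orthogonal_unit hq hF (k := 2) (by norm_num)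
    (b := ![b₀, p]) (σ := Fin.rev) Fin.rev_involutive (by
      intro i j
      fin_cases i <;> fin_cases j <;> simp [*, Fin.rev])
  have hb₀1 : hermDot q b₀ y₁ = 0 := hb1 0
  have hp1 : hermDot q p y₁ = 0 := hb1 1
  have h1b₀ := hermDot_eq_zero_comm hq hF hb₀1
  have h1p := hermDot_eq_zero_comm hq hF hp1
  obtain ⟨y₂, h22, hb2⟩ := exists_orthogonal_unit hq hF (k := 3) (by norm_num)
    (b := ![b₀, y₁, p]) (σ := Fin.rev) Fin.rev_involutive (by
      intro i j
      fin_cases i <;> fin_cases j <;> simp [*, Fin.rev, Fin.ext_iff])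
  have h12 : hermDot q y₁ y₂ = 0 := hb2 1
  have hp2 : hermDot q p y₂ = 0 := hb2 2
  have h21 := hermDot_eq_zero_comm hq hF h12
  obtain ⟨ε, hε⟩ := exists_pow_succ_eq (F := F) hq.two_le hF (α := -1) (by
    have := add_pow_of_card_eq hq hF (1 : F) (-1)
    rw [add_neg_cancel, zero_pow hq.ne_zero, one_pow] at this
    linear_combination -this)
  have hp'1 : hermDot q y₁ (y₁ + ε • y₂) = 1 := by simp [h11, h12]
  obtain ⟨T, hT, h4, -⟩ := exists_isFermatFrame_pair hq hF hpp (p' := y₁ + ε • y₂)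
    (by simp [hp1, hp2])
    (by
      rw [hermDot_add hq hF, hermDot_smul]
      simp only [LinearMap.add_apply, LinearMap.smul_apply, map_add, map_smul, h11, h12, h21, h22,
        smul_eq_mul]
      linear_combination hε)
    (by
      rintro c rfl
      rw [map_smul, hp'1, smul_eq_mul, mul_one] at h1p
      rw [h1p, zero_smul] at hp
      exact hp rfl)
    (by
      intro c h
      rw [h, map_smul, h1p, smul_zero] at hp'1
      exact zero_ne_one hp'1)
  exact ⟨T, hT, h4⟩

theorem hermDot_matAct (hq : IsPrimePow q) (hF : Fintype.card F = q ^ 2)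
    {T : Matrix (Fin 5) (Fin 5) F} (hT : IsFermatFrame q T) (u w : Fin 5 → F) :
    hermDot q (matAct T u) (matAct T w) = ∑ i, u i ^ q * w (Fin.rev i) := by
  have h1 : ∀ u : Fin 5 → F, matAct T u = ∑ m, u m • fun i => T i m := by
    intro u
    funext i
    simp [matAct, mul_comm]
  have h2 : ∀ (s : Finset (Fin 5)) (f : Fin 5 → Fin 5 → F) (y : Fin 5 → F),
      hermDot q (∑ m ∈ s, f m) y = ∑ m ∈ s, hermDot q (f m) y := by
    intro s f y
    induction s using Finset.cons_induction with
    | empty => simp [hermDot_zero hq.ne_zero]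
    | cons a s ha ih =>
      rw [Finset.sum_cons, hermDot_add hq hF, LinearMap.add_apply, ih, Finset.sum_cons]
  rw [h1, h1, h2]
  refine Finset.sum_congr rfl fun m _ => ?_
  simp only [hermDot_smul, LinearMap.smul_apply, map_sum, map_smul, hT m, smul_eq_mul]
  simp [mul_comm]

theorem herm_eq_hermDot (hq : IsPrimePow q) (hF : Fintype.card F = q ^ 2)
    {T : Matrix (Fin 5) (Fin 5) F} (hT : IsFermatFrame q T) (u : Fin 5 → F) :
    hermDot q (matAct T u) (matAct T u) = herm q u := by
  rw [hermDot_matAct hq hF hT, Fin.sum_univ_five]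
  change u 0 ^ q * u 4 + u 1 ^ q * u 3 + u 2 ^ q * u 2 + u 3 ^ q * u 1 + u 4 ^ q * u 0 = _
  unfold herm
  ring

theorem isHermFrame_fermatInv_mul (hq : IsPrimePow q) (hF : Fintype.card F = q ^ 2)
    {T T' : Matrix (Fin 5) (Fin 5) F} (hT : IsFermatFrame q T) (hT' : IsFermatFrame q T') :
    IsHermFrame q (fermatInv q T * T') := by
  intro m k
  have h1 : ∀ m, matAct T (fun i => (fermatInv q T * T') i m) = fun i => T' i m := by
    intro m
    have h2 : (fun i => (fermatInv q T * T') i m) = matAct (fermatInv q T) fun i => T' i m := by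
      funext i
      simp [matAct, Matrix.mul_apply]
    rw [h2, matAct_matAct (mul_fermatInv hT)]
  have h2 := hermDot_matAct hq hF hT (fun i => (fermatInv q T * T') i m)
    fun i => (fermatInv q T * T') i k
  rw [h1, h1] at h2
  exact h2.symm.trans (hT' m k)

end FermatFrame

section NoLine

variable {F : Type*} [Field F] {q d : ℕ}

/-- The line spanned by `x` and `y` is totally isotropic and contained in `G = 0`. -/
def OnGen (q : ℕ) (G : MvPolynomial (Fin 5) F) (x y : Fin 5 → F) : Prop :=
  ∀ a b : F, hermDot q (a • x + b • y) (a • x + b • y) = 0 ∧ eval (a • x + b • y) G = 0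

theorem eval_smul_of_isHomogeneous {G : MvPolynomial (Fin 5) F} (hG : G.IsHomogeneous d)
    (c : F) (x : Fin 5 → F) : eval (c • x) G = c ^ d * eval x G := by
  have := aeval_mul_of_isHomogeneous hG c x
  rwa [aeval_eq_eval, aeval_eq_eval] at this

theorem eval_basePt {G : MvPolynomial (Fin 5) F} (hG : G.IsHomogeneous d) :
    eval (basePt F) G = G.coeff (Finsupp.single 4 d) := by
  rw [eval_eq', Finset.sum_eq_single (Finsupp.single 4 d)]
  · simp [basePt, Finsupp.single_apply]
  · intro s hs hne
    have hd := hG (mem_support_iff.1 hs)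
    rw [Pi.one_def, ← Finsupp.degree_eq_weight_one, Finsupp.degree_eq_sum,
      Fin.sum_univ_five] at hd
    rw [Fin.prod_univ_five]
    by_contra h0
    simp only [basePt, Matrix.cons_val, one_pow, mul_one] at h0
    have h1 : s 0 = 0 ∧ s 1 = 0 ∧ s 2 = 0 ∧ s 3 = 0 := by
      refine ⟨?_, ?_, ?_, ?_⟩ <;> by_contra h2 <;> exact h0 (by simp [zero_pow h2])
    obtain ⟨h20, h21, h22, h23⟩ := h1
    apply hne
    ext i
    fin_cases i <;> simp [h20, h21, h22, h23]
    omega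
  · intro h
    simp [notMem_support_iff.1 h]

theorem matAct_add_smul (M : Matrix (Fin 5) (Fin 5) F) (a b : F) (x y : Fin 5 → F) :
    matAct M (a • x + b • y) = a • matAct M x + b • matAct M y := by
  funext i
  simp only [matAct, Pi.add_apply, Pi.smul_apply, smul_eq_mul, mul_add, Finset.sum_add_distrib,
    Finset.mul_sum]
  congr 1 <;> exact Finset.sum_congr rfl fun m _ => mul_left_comm _ _ _

theorem matAct_smul (M : Matrix (Fin 5) (Fin 5) F) (a : F) (x : Fin 5 → F) :
    matAct M (a • x) = a • matAct M x := by
  simpa using matAct_add_smul M a 0 x 0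

theorem matAct_zero (M : Matrix (Fin 5) (Fin 5) F) : matAct M (0 : Fin 5 → F) = 0 := by
  simpa using matAct_smul M 0 0

theorem matAct_ne_zero {M N : Matrix (Fin 5) (Fin 5) F} (h : M * N = 1) {x : Fin 5 → F}
    (hx : x ≠ 0) : matAct N x ≠ 0 := by
  intro h0
  apply hx
  rw [← matAct_matAct h x, h0, matAct_zero]

theorem matAct_mul_matrix (M N : Matrix (Fin 5) (Fin 5) F) (x : Fin 5 → F) :
    matAct M (matAct N x) = matAct (M * N) x :=
  Matrix.mulVec_mulVec x M N

end NoLine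

section NoLineBound

variable {F : Type} [Field F] [Fintype F] {q d : ℕ}

theorem exists_isotropic_eval_ne_zero (hq : IsPrimePow q) (hF : Fintype.card F = q ^ 2)
    {G : MvPolynomial (Fin 5) F} (hno : ∀ x y, OnGen q G x y → ¬ LinearIndependent F ![x, y])
    {v : Fin 5 → F} (hv : v ≠ 0) (hvv : hermDot q v v = 0) :
    ∃ p, hermDot q p p = 0 ∧ eval p G ≠ 0 := by
  obtain ⟨T, hT, -⟩ := exists_isFermatFrame hq hF hv hvv
  by_contra! h
  have h1 : ∀ a b : F, matAct T ![0, 0, 0, b, a] =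
      a • (fun i => T i 4) + b • fun i => T i 3 := by
    intro a b
    funext i
    simp [matAct, Fin.sum_univ_five, mul_comm, add_comm]
  refine hno (fun i => T i 4) (fun i => T i 3) (fun a b => ?_) ?_
  · have h2 : hermDot q (a • (fun i => T i 4) + b • fun i => T i 3)
        (a • (fun i => T i 4) + b • fun i => T i 3) = 0 := by
      rw [← h1, herm_eq_hermDot hq hF hT]
      simp [herm, hq.ne_zero]
    exact ⟨h2, h _ h2⟩
  · rw [LinearIndependent.pair_iff]
    intro a b hab
    have h3 : matAct T ![0, 0, 0, b, a] = 0 := by rw [h1, hab]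
    have h4 : (![0, 0, 0, b, a] : Fin 5 → F) = 0 := by
      by_contra h0
      exact matAct_ne_zero (fermatInv_mul hT) h0 h3
    exact ⟨congrFun h4 4, congrFun h4 3⟩

theorem card_le_of_forall_not_onGen (hq : IsPrimePow q) (hF : Fintype.card F = q ^ 2)
    (hd : 1 < d) (hdq : d ≤ q) {G : MvPolynomial (Fin 5) F} (hG : G.IsHomogeneous d)
    (hno : ∀ x y, OnGen q G x y → ¬ LinearIndependent F ![x, y])
    {ι : Type} [Fintype ι] {v : ι → Fin 5 → F} (hv0 : ∀ P, v P ≠ 0)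
    (hvv : ∀ P, hermDot q (v P) (v P) = 0) (hGv : ∀ P, eval (v P) G = 0)
    (hvw : Pairwise fun P P' => ∀ a : F, a • v P ≠ v P') :
    Fintype.card ι ≤ (q ^ 3 + 1) * ((d - 1) * q ^ 2 + 1) := by
  cases isEmpty_or_nonempty ι with
  | inl h => simp
  | inr h =>
  obtain ⟨P₀⟩ := h
  obtain ⟨p, hpp, hGp⟩ := exists_isotropic_eval_ne_zero hq hF hno (hv0 P₀) (hvv P₀)
  have hp0 : p ≠ 0 := by
    rintro rfl
    have := eval_smul_of_isHomogeneous hG 0 (0 : Fin 5 → F)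
    rw [zero_smul, zero_pow (by omega), zero_mul] at this
    exact hGp this
  obtain ⟨T, hT, hT4⟩ := exists_isFermatFrame hq hF hp0 hpp
  choose S hS hS4 using fun P => exists_isFermatFrame hq hF (hv0 P) (hvv P)
  have hTv : ∀ x : Fin 5 → F, matAct T (matAct (fermatInv q T) x) = x :=
    matAct_matAct (mul_fermatInv hT)
  refine card_le_of_isHermFrame hq hF hd hdq (isHomogeneous_linSubst hG T) ?_
    (M := fun P => fermatInv q T * S P) (fun P => isHermFrame_fermatInv_mul hq hF hT (hS P))
    (v := fun P => matAct (fermatInv q T) (v P)) ?_ ?_ ?_ ?_ ?_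
  · rw [← eval_basePt (isHomogeneous_linSubst hG T), eval_linSubst, matAct_basePt, hT4]
    exact hGp
  · exact fun P => matAct_ne_zero (mul_fermatInv hT) (hv0 P)
  · intro P
    funext i
    rw [← hS4 P]
    simp [matAct, Matrix.mul_apply]
  · intro P
    rw [eval_linSubst, hTv]
    exact hGv P
  · intro P P' hPP a h
    refine hvw hPP a ?_
    rw [← hTv (v P'), ← h, matAct_smul, hTv]
  · intro P t ht0 ht
    by_contra! h
    have h0 : ∀ α : F, eval (matAct (S P) ![0, t 0, t 1, t 2, α]) G = 0 := by
      intro α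
      have := h α
      rwa [eval_linSubst, eval_linSubst, matAct_mul_matrix, ← mul_assoc, mul_fermatInv hT,
        one_mul] at this
    have h1 : ∀ a b : F, a • matAct (S P) ![0, t 0, t 1, t 2, 0] + b • v P =
        matAct (S P) ![0, a * t 0, a * t 1, a * t 2, b] := by
      intro a b
      rw [← hS4 P, ← matAct_basePt, ← matAct_add_smul]
      congr 1
      funext i
      fin_cases i <;> simp [basePt]
    refine hno (matAct (S P) ![0, t 0, t 1, t 2, 0]) (v P) (fun a b => ⟨?_, ?_⟩) ?_
    · rw [h1, herm_eq_hermDot hq hF (hS P)]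
      unfold hermThree at ht
      simp only [herm, Matrix.cons_val, zero_pow hq.ne_zero, mul_pow]
      linear_combination a ^ (q + 1) * ht
    · by_cases ha : a = 0
      · rw [ha, zero_smul, zero_add, eval_smul_of_isHomogeneous hG, hGv, mul_zero]
      · have h2 : (![0, a * t 0, a * t 1, a * t 2, b] : Fin 5 → F) =
            a • ![0, t 0, t 1, t 2, a⁻¹ * b] := by
          funext i
          fin_cases i <;> simp [ha]
        rw [h1, h2, matAct_smul, eval_smul_of_isHomogeneous hG, h0, mul_zero]
    · rw [LinearIndependent.pair_iff]
      intro a b hab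
      rw [h1] at hab
      have h4 : (![0, a * t 0, a * t 1, a * t 2, b] : Fin 5 → F) = 0 := by
        by_contra h0
        exact matAct_ne_zero (fermatInv_mul (hS P)) h0 hab
      refine ⟨?_, congrFun h4 4⟩
      by_contra ha
      apply ht0
      funext i
      fin_cases i
      · exact (mul_eq_zero.1 (congrFun h4 1)).resolve_left ha
      · exact (mul_eq_zero.1 (congrFun h4 2)).resolve_left ha
      · exact (mul_eq_zero.1 (congrFun h4 3)).resolve_left ha

end NoLineBound

section Line

variable {F : Type*} [Field F] [Fintype F] {q d : ℕ}

theorem card_filter_eval_add_smul_le [DecidableEq F] {G : MvPolynomial (Fin 5) F}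
    (hG : G.IsHomogeneous d) {R s : Fin 5 → F} (hs : eval s G = 0)
    (hR : ∃ l : F, eval (R + l • s) G ≠ 0) :
    (Finset.univ.filter fun l : F => eval (R + l • s) G = 0).card ≤ d - 1 := by
  set p := pencil G R s
  have hp : ∀ l, p.eval l = eval (R + l • s) G := by
    intro l
    have h1 := comp_aeval_apply (Polynomial.aeval l : Polynomial F →ₐ[F] F)
      (f := fun i => Polynomial.C (R i) + Polynomial.X * Polynomial.C (s i)) G
    rw [← Polynomial.coe_aeval_eq_eval, ← aeval_eq_eval]
    refine h1.trans ?_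
    congr 2
    funext i
    simp
    ring
  have hp0 : p ≠ 0 := by
    rintro h
    obtain ⟨l, hl⟩ := hR
    rw [← hp, h, Polynomial.eval_zero] at hl
    exact hl rfl
  have hdeg : p.natDegree < d := by
    rw [Polynomial.natDegree_lt_iff_degree_lt hp0, Polynomial.degree_lt_iff_coeff_zero]
    intro m hm
    obtain rfl | hm := hm.eq_or_lt
    · rw [← hs, ← aeval_eq_eval]
      exact coeff_aeval_self hG R s
    · exact coeff_aeval_eq_zero_of_lt hG R s hm
  calc _ ≤ p.roots.toFinset.card := by
        refine Finset.card_le_card fun l hl => ?_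
        rw [Multiset.mem_toFinset, Polynomial.mem_roots hp0, Polynomial.IsRoot, hp]
        simpa using hl
    _ ≤ _ := (Multiset.toFinset_card_le _).trans ((Polynomial.card_roots' p).trans (by omega))

theorem sub_pow_of_card_eq (hq : IsPrimePow q) (hF : Fintype.card F = q ^ 2) (x y : F) :
    (x - y) ^ q = x ^ q - y ^ q := by
  rw [eq_sub_iff_add_eq, ← add_pow_of_card_eq hq hF, sub_add_cancel]

omit [Fintype F] in
theorem herm_zero_add_smul (hq : IsPrimePow q) (b c l : F) :
    herm q (![0, 1, b, c, 0] + l • ![0, 0, 0, 0, 1] : Fin 5 → F) =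
      c ^ q + c + b ^ (q + 1) := by
  simp [herm, hq.ne_zero]
  ring

theorem herm_one_add_smul (hq : IsPrimePow q) (hF : Fintype.card F = q ^ 2) (a b c l : F) :
    herm q (![1, a, b, 0, c] + l • ![0, 0, 0, 1, -a ^ q] : Fin 5 → F) =
      c ^ q + c + b ^ (q + 1) := by
  have h : (c + -(l * a ^ q)) ^ q = c ^ q - l ^ q * a := by
    rw [← sub_eq_add_neg, sub_pow_of_card_eq hq hF, mul_pow, pow_pow_eq_self hF]
  simp [herm, h]
  ring

theorem card_le_of_isotropic_line (hq : IsPrimePow q) (hF : Fintype.card F = q ^ 2)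
    {G : MvPolynomial (Fin 5) F} (hG : G.IsHomogeneous d)
    (hL : ∀ a b : F, eval ![0, 0, 0, a, b] G = 0)
    (hfib : ∀ R s : Fin 5 → F, s 0 = 0 → s 1 = 0 → s 2 = 0 → s ≠ 0 → (R 0 ≠ 0 ∨ R 1 ≠ 0) →
      (∀ l : F, herm q (R + l • s) = 0) → ∃ l : F, eval (R + l • s) G ≠ 0)
    {ι : Type*} [Fintype ι] {u : ι → Fin 5 → F} (hu0 : ∀ P, u P ≠ 0)
    (huu : ∀ P, herm q (u P) = 0) (hGu : ∀ P, eval (u P) G = 0)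
    (huw : Pairwise fun P P' => ∀ a : F, a • u P ≠ u P') :
    Fintype.card ι ≤
      (q ^ 2 + 1) + (q ^ 2 * (q ^ 2 * (q * (d - 1))) + q ^ 2 * (q * (d - 1))) := by
  classical
  let Z : F → Finset F := fun b => Finset.univ.filter fun c : F => c ^ q + c + b ^ (q + 1) = 0
  have hZ : ∀ b, (Z b).card ≤ q := fun b => card_filter_pow_add_self_le hq.two_le _
  let E : (Fin 5 → F) → (Fin 5 → F) → Finset (Fin 5 → F) := fun R s =>
    (Finset.univ.filter fun l : F => eval (R + l • s) G = 0).image fun l => R + l • s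
  let A : Finset (Fin 5 → F) :=
    insert ![0, 0, 0, 0, 1] (Finset.univ.image fun l : F => ![0, 0, 0, 1, l])
  let B : Finset (Fin 5 → F) := Finset.univ.biUnion fun a : F => Finset.univ.biUnion fun b : F =>
    (Z b).biUnion fun c => E ![1, a, b, 0, c] ![0, 0, 0, 1, -a ^ q]
  let C : Finset (Fin 5 → F) := Finset.univ.biUnion fun b : F =>
    (Z b).biUnion fun c => E ![0, 1, b, c, 0] ![0, 0, 0, 0, 1]
  have hA : A.card ≤ q ^ 2 + 1 := by
    refine (Finset.card_insert_le _ _).trans (Nat.add_le_add_right ?_ 1)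
    exact Finset.card_image_le.trans (by rw [Finset.card_univ, hF])
  have hB : B.card ≤ q ^ 2 * (q ^ 2 * (q * (d - 1))) := by
    rw [← hF, ← Finset.card_univ]
    refine Finset.card_biUnion_le_card_mul _ _ _ fun a _ => ?_
    refine Finset.card_biUnion_le_card_mul _ _ _ fun b _ => ?_
    refine (Finset.card_biUnion_le_card_mul _ _ (d - 1) fun c hc => ?_).trans
      (Nat.mul_le_mul_right _ (hZ b))
    refine Finset.card_image_le.trans (card_filter_eval_add_smul_le hG (hL _ _) ?_)
    refine hfib _ _ rfl rfl rfl (fun h => one_ne_zero (congrFun h 3)) (Or.inl one_ne_zero) ?_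
    intro l
    rw [herm_one_add_smul hq hF]
    exact (Finset.mem_filter.1 hc).2
  have hC : C.card ≤ q ^ 2 * (q * (d - 1)) := by
    rw [← hF, ← Finset.card_univ]
    refine Finset.card_biUnion_le_card_mul _ _ _ fun b _ => ?_
    refine (Finset.card_biUnion_le_card_mul _ _ (d - 1) fun c hc => ?_).trans
      (Nat.mul_le_mul_right _ (hZ b))
    refine Finset.card_image_le.trans (card_filter_eval_add_smul_le hG (hL _ _) ?_)
    refine hfib _ _ rfl rfl rfl (fun h => one_ne_zero (congrFun h 4)) (Or.inr one_ne_zero) ?_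
    intro l
    rw [herm_zero_add_smul hq]
    exact (Finset.mem_filter.1 hc).2
  have hmem : ∀ P, ∃ a : F, a ≠ 0 ∧ a • u P ∈ A ∪ (B ∪ C) := by
    intro P
    have hw : ∀ a : F, herm q (a • u P) = 0 ∧ eval (a • u P) G = 0 := by
      intro a
      have h1 := herm_mul q a (u P)
      rw [huu, mul_zero] at h1
      exact ⟨h1, by rw [eval_smul_of_isHomogeneous hG, hGu, mul_zero]⟩
    by_cases h0 : u P 0 = 0
    · by_cases h1 : u P 1 = 0
      · have h2 : u P 2 = 0 := by
          have := huu P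
          simpa [herm, h0, h1, hq.ne_zero] using this
        by_cases h3 : u P 3 = 0
        · have h4 : u P 4 ≠ 0 := by
            intro h4
            apply hu0 P
            funext i
            fin_cases i <;> assumption
          refine ⟨(u P 4)⁻¹, inv_ne_zero h4, Finset.mem_union_left _ ?_⟩
          refine Finset.mem_insert.2 (Or.inl ?_)
          funext i
          fin_cases i <;> simp [h0, h1, h2, h3, h4]
        · refine ⟨(u P 3)⁻¹, inv_ne_zero h3, Finset.mem_union_left _ ?_⟩
          refine Finset.mem_insert.2 (Or.inr (Finset.mem_image.2 ⟨(u P 3)⁻¹ * u P 4,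
            Finset.mem_univ _, ?_⟩))
          funext i
          fin_cases i <;> simp [h0, h1, h2, h3]
      · refine ⟨(u P 1)⁻¹, inv_ne_zero h1, Finset.mem_union_right _ (Finset.mem_union_right _ ?_)⟩
        obtain ⟨hh, hG'⟩ := hw (u P 1)⁻¹
        set w := (u P 1)⁻¹ • u P
        have hw' : w = ![0, 1, w 2, w 3, 0] + w 4 • ![0, 0, 0, 0, 1] := by
          funext i
          fin_cases i <;> simp [w, h0, h1]
        rw [hw', herm_zero_add_smul hq] at hh
        refine Finset.mem_biUnion.2 ⟨w 2, Finset.mem_univ _, Finset.mem_biUnion.2 ⟨w 3,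
          Finset.mem_filter.2 ⟨Finset.mem_univ _, hh⟩, Finset.mem_image.2 ⟨w 4,
          Finset.mem_filter.2 ⟨Finset.mem_univ _, ?_⟩, hw'.symm⟩⟩⟩
        rw [← hw']
        exact hG'
    · refine ⟨(u P 0)⁻¹, inv_ne_zero h0, Finset.mem_union_right _ (Finset.mem_union_left _ ?_)⟩
      obtain ⟨hh, hG'⟩ := hw (u P 0)⁻¹
      set w := (u P 0)⁻¹ • u P
      have hw' : w = ![1, w 1, w 2, 0, w 4 + w 1 ^ q * w 3] +
          w 3 • ![0, 0, 0, 1, -w 1 ^ q] := by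
        funext i
        fin_cases i
        · simp [w, h0]
        · simp
        · simp
        · simp
        · simp
          ring
      rw [hw', herm_one_add_smul hq hF] at hh
      refine Finset.mem_biUnion.2 ⟨w 1, Finset.mem_univ _, Finset.mem_biUnion.2 ⟨w 2,
        Finset.mem_univ _, Finset.mem_biUnion.2 ⟨w 4 + w 1 ^ q * w 3,
        Finset.mem_filter.2 ⟨Finset.mem_univ _, hh⟩, Finset.mem_image.2 ⟨w 3,
        Finset.mem_filter.2 ⟨Finset.mem_univ _, ?_⟩, hw'.symm⟩⟩⟩⟩
      rw [← hw']
      exact hG'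
  choose a ha0 ha using hmem
  calc Fintype.card ι ≤ (A ∪ (B ∪ C)).card := by
        rw [← Finset.card_univ]
        refine Finset.card_le_card_of_injOn (fun P => a P • u P) (fun P _ => ha P) ?_
        intro P _ P' _ h
        by_contra hne
        refine huw hne ((a P')⁻¹ * a P) ?_
        rw [mul_smul]
        change (a P')⁻¹ • (fun P => a P • u P) P = _
        rw [h]
        exact inv_smul_smul₀ (ha0 P') _
    _ ≤ _ := (Finset.card_union_le _ _).trans
      (add_le_add hA ((Finset.card_union_le _ _).trans (add_le_add hB hC)))

theorem card_le_of_onGen (hq : IsPrimePow q) (hF : Fintype.card F = q ^ 2)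
    {G : MvPolynomial (Fin 5) F} (hG : G.IsHomogeneous d) {x y : Fin 5 → F}
    (hxy : LinearIndependent F ![x, y]) (hgen : OnGen q G x y)
    (hmeet : ∀ (a b : F) (R : Fin 5 → F), a • x + b • y ≠ 0 → OnGen q G (a • x + b • y) R →
      R ∈ Submodule.span F {x, y})
    {ι : Type*} [Fintype ι] {v : ι → Fin 5 → F} (hv0 : ∀ P, v P ≠ 0)
    (hvv : ∀ P, hermDot q (v P) (v P) = 0) (hGv : ∀ P, eval (v P) G = 0)
    (hvw : Pairwise fun P P' => ∀ a : F, a • v P ≠ v P') :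
    Fintype.card ι ≤
      (q ^ 2 + 1) + (q ^ 2 * (q ^ 2 * (q * (d - 1))) + q ^ 2 * (q * (d - 1))) := by
  have hind : ∀ c : F, x ≠ c • y := by
    intro c h
    have := LinearIndependent.pair_iff.1 hxy 1 (-c) (by rw [h]; simp)
    exact one_ne_zero this.1
  have hind' : ∀ c : F, y ≠ c • x := by
    intro c h
    have := LinearIndependent.pair_iff.1 hxy (-c) 1 (by rw [h]; simp)
    exact one_ne_zero this.2
  obtain ⟨T, hT, h4, h3⟩ := exists_isFermatFrame_pair hq hF (by simpa using (hgen 1 0).1)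
    (hermDot_eq_zero_of_isotropic hq hF fun a b => (hgen a b).1) (by simpa using (hgen 0 1).1)
    hind hind'
  have hTv : ∀ x : Fin 5 → F, matAct T (matAct (fermatInv q T) x) = x :=
    matAct_matAct (mul_fermatInv hT)
  have hs : ∀ s : Fin 5 → F, s 0 = 0 → s 1 = 0 → s 2 = 0 → matAct T s = s 4 • x + s 3 • y := by
    intro s h0 h1 h2
    rw [← h4, ← h3]
    funext i
    simp [matAct, Fin.sum_univ_five, h0, h1, h2, mul_comm, add_comm]
  refine card_le_of_isotropic_line hq hF (isHomogeneous_linSubst hG T)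
    (u := fun P => matAct (fermatInv q T) (v P)) ?_ ?_ ?_ ?_ ?_ ?_
  · intro a b
    rw [eval_linSubst, hs _ rfl rfl rfl]
    exact (hgen _ _).2
  · intro R s h0 h1 h2 hs0 hR hRs
    by_contra! h
    have hTs := hs s h0 h1 h2
    have hs0' := matAct_ne_zero (fermatInv_mul hT) hs0
    rw [hTs] at hs0'
    have hgen' : OnGen q G (s 4 • x + s 3 • y) (matAct T R) := by
      intro a b
      by_cases hb : b = 0
      · rw [hb, zero_smul, add_zero, smul_add, smul_smul, smul_smul]
        exact hgen _ _
      · have h5 : a • (s 4 • x + s 3 • y) + b • matAct T R =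
            matAct T (b • (R + (b⁻¹ * a) • s)) := by
          rw [smul_add b, smul_smul b, mul_inv_cancel_left₀ hb, matAct_add_smul, hTs, add_comm]
        have h6 := herm_mul q b (R + (b⁻¹ * a) • s)
        rw [hRs, mul_zero] at h6
        have h7 := h (b⁻¹ * a)
        rw [eval_linSubst] at h7
        rw [h5]
        exact ⟨(herm_eq_hermDot hq hF hT _).trans h6,
          by rw [matAct_smul, eval_smul_of_isHomogeneous hG, h7, mul_zero]⟩
    obtain ⟨a, b, hab⟩ := Submodule.mem_span_pair.1 (hmeet _ _ _ hs0' hgen')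
    have h8 : matAct T ![0, 0, 0, b, a] = matAct T R := by
      rw [← hab, hs _ rfl rfl rfl]
      rfl
    have h9 : (![0, 0, 0, b, a] : Fin 5 → F) = R := by
      rw [← matAct_matAct (fermatInv_mul hT) R, ← h8, matAct_matAct (fermatInv_mul hT)]
    rw [← h9] at hR
    simp at hR
  · exact fun P => matAct_ne_zero (mul_fermatInv hT) (hv0 P)
  · intro P
    rw [← herm_eq_hermDot hq hF hT, hTv, hvv]
  · intro P
    rw [eval_linSubst, hTv]
    exact hGv P
  · intro P P' hPP a h
    refine hvw hPP a ?_
    rw [← hTv (v P'), ← h, matAct_smul, hTv]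

end Line

section Projective

variable {F : Type} [Field F] {q d : ℕ}

theorem mem_hermV3_iff {P : P4 F} : P ∈ hermV3 q F ↔ hermDot q P.rep P.rep = 0 := by
  simp [hermV3, hermDot_apply, pow_succ]

theorem OnGen.subset {G : MvPolynomial (Fin 5) F} {x y : Fin 5 → F} (h : OnGen q G x y) :
    {P : P4 F | P.submodule ≤ Submodule.span F {x, y}} ⊆ hermV3 q F ∩ VG G := by
  intro P hP
  have hrep : P.rep ∈ P.submodule := by
    rw [Projectivization.submodule_eq]
    exact Submodule.mem_span_singleton_self _
  obtain ⟨a, b, hab⟩ := Submodule.mem_span_pair.1 (hP hrep)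
  obtain ⟨h1, h2⟩ := h a b
  rw [hab] at h1 h2
  exact ⟨mem_hermV3_iff.2 h1, h2⟩

theorem finrank_span_pair_eq_two {x y : Fin 5 → F} (h : LinearIndependent F ![x, y]) :
    Module.finrank F (Submodule.span F {x, y}) = 2 := by
  have := finrank_span_eq_card h
  rwa [Matrix.range_cons, Matrix.range_cons, Matrix.range_empty, Set.union_empty,
    Fintype.card_fin] at this

theorem mem_span_of_onGen {G : MvPolynomial (Fin 5) F}
    (hone : ∀ Pl : Set (P4 F), IsPlane F Pl →
      ∀ g₁ g₂ : Set (P4 F), IsLine F g₁ → IsLine F g₂ →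
        g₁ ⊆ hermV3 q F → g₂ ⊆ hermV3 q F →
        g₁ ⊆ Pl ∩ VG G → g₂ ⊆ Pl ∩ VG G → g₁ = g₂)
    {x y z R : Fin 5 → F} (hxy : LinearIndependent F ![x, y]) (hgen : OnGen q G x y)
    (hz : z ∈ Submodule.span F {x, y}) (hz0 : z ≠ 0) (hgen' : OnGen q G z R) :
    R ∈ Submodule.span F {x, y} := by
  by_contra hR
  have hzR : LinearIndependent F ![z, R] := by
    rw [LinearIndependent.pair_iff]
    intro s t hst
    have ht : t = 0 := by
      by_contra ht
      apply hR
      rw [← inv_smul_smul₀ ht R, ← neg_eq_iff_add_eq_zero.2 hst]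
      exact Submodule.smul_mem _ _ (Submodule.neg_mem _ (Submodule.smul_mem _ _ hz))
    rw [ht, zero_smul, add_zero] at hst
    exact ⟨(smul_eq_zero.1 hst).resolve_right hz0, ht⟩
  have hR0 : R ≠ 0 := by
    rintro rfl
    exact hR (Submodule.zero_mem _)
  set W := Submodule.span F {x, y}
  set W' := Submodule.span F {z, R}
  have hW : Module.finrank F W = 2 := finrank_span_pair_eq_two hxy
  have hW' : Module.finrank F W' = 2 := finrank_span_pair_eq_two hzR
  have hzW' : z ∈ W' := Submodule.subset_span (by simp)
  have hRW' : R ∈ W' := Submodule.subset_span (by simp)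
  have hsup := Submodule.finrank_sup_add_finrank_inf_eq W W'
  have h1 : 0 < Module.finrank F ↥(W ⊓ W') := by
    have : Nontrivial ↥(W ⊓ W') :=
      ⟨⟨z, hz, hzW'⟩, 0, fun h => hz0 (congrArg Subtype.val h)⟩
    exact Module.finrank_pos
  have h2 : Module.finrank F ↥(W ⊓ W') < Module.finrank F W' :=
    Submodule.finrank_lt_finrank_of_lt (inf_lt_right.2 fun h => hR (h hRW'))
  have heq := hone {P | P.submodule ≤ W ⊔ W'} ⟨W ⊔ W', by omega, rfl⟩
    {P | P.submodule ≤ W} {P | P.submodule ≤ W'} ⟨W, hW, rfl⟩ ⟨W', hW', rfl⟩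
    (fun P hP => (hgen.subset hP).1) (fun P hP => (hgen'.subset hP).1)
    (fun P hP => ⟨show P.submodule ≤ W ⊔ W' from le_sup_of_le_left hP, (hgen.subset hP).2⟩)
    (fun P hP => ⟨show P.submodule ≤ W ⊔ W' from le_sup_of_le_right hP, (hgen'.subset hP).2⟩)
  have hmem : Projectivization.mk F R hR0 ∈ {P : P4 F | P.submodule ≤ W'} := by
    rw [Set.mem_ofPred_eq, Projectivization.submodule_mk, Submodule.span_singleton_le_iff_mem]
    exact hRW'
  rw [← heq, Set.mem_ofPred_eq, Projectivization.submodule_mk,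
    Submodule.span_singleton_le_iff_mem] at hmem
  exact hR hmem

end Projective

theorem stmt8 (q : ℕ) (hq : IsPrimePow q)
    (F : Type) [Field F] [Fintype F] (hF : Fintype.card F = q ^ 2)
    (d : ℕ) (hd1 : 1 < d) (hdq : d ≤ q)
    (G : MvPolynomial (Fin 5) F) (hG : G ≠ 0) (hGd : G.IsHomogeneous d)
    (hnoplane : ∀ S : Set (P4 F), IsPlane F S → ¬ S ⊆ VG G)
    (hone : ∀ Pl : Set (P4 F), IsPlane F Pl →
      ∀ g₁ g₂ : Set (P4 F), IsLine F g₁ → IsLine F g₂ →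
        g₁ ⊆ hermV3 q F → g₂ ⊆ hermV3 q F →
        g₁ ⊆ Pl ∩ VG G → g₂ ⊆ Pl ∩ VG G → g₁ = g₂) :
    (VG G ∩ hermV3 q F).ncard ≤
        (d - 1) * q ^ 5 + (d - 1) * q ^ 3 + q ^ 2 + (d - 1) * q + 1 ∧
      (d - 1) * q ^ 5 + (d - 1) * q ^ 3 + q ^ 2 + (d - 1) * q + 1 <
        d * (q ^ 5 + q ^ 2) + q ^ 3 + 1 := by
  have hfin : Finite (P4 F) := Quotient.finite _
  have := Fintype.ofFinite ↥(VG G ∩ hermV3 q F)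
  have hcard : (VG G ∩ hermV3 q F).ncard = Fintype.card ↥(VG G ∩ hermV3 q F) := by
    rw [← Nat.card_coe_set_eq, Nat.card_eq_fintype_card]
  let v : ↥(VG G ∩ hermV3 q F) → Fin 5 → F := fun P => P.1.rep
  have hv0 : ∀ P, v P ≠ 0 := fun P => P.1.rep_nonzero
  have hGv : ∀ P, eval (v P) G = 0 := fun P => P.2.1
  have hvv : ∀ P, hermDot q (v P) (v P) = 0 := fun P => mem_hermV3_iff.1 P.2.2
  have hvw : Pairwise fun P P' => ∀ a : F, a • v P ≠ v P' := by
    intro P P' hne a h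
    apply hne
    apply Subtype.ext
    rw [← P.1.mk_rep, ← P'.1.mk_rep, eq_comm, Projectivization.mk_eq_mk_iff']
    exact ⟨a, h⟩
  obtain ⟨e, rfl⟩ : ∃ e, d = e + 1 := ⟨d - 1, by omega⟩
  rw [Nat.add_sub_cancel, hcard]
  constructor
  · by_cases hno : ∀ x y, OnGen q G x y → ¬ LinearIndependent F ![x, y]
    · refine (card_le_of_forall_not_onGen hq hF hd1 hdq hGd hno hv0 hvv hGv hvw).trans ?_
      rw [Nat.add_sub_cancel]
      obtain ⟨e, rfl⟩ : ∃ e', e = e' + 1 := ⟨e - 1, by omega⟩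
      have h1 : e * q ^ 2 ≤ e * q ^ 3 :=
        Nat.mul_le_mul_left _ (Nat.pow_le_pow_right (by omega) (by norm_num))
      nlinarith
    · push Not at hno
      obtain ⟨x, y, hgen, hxy⟩ := hno
      refine (card_le_of_onGen hq hF hGd hxy hgen (fun a b R h0 hgen' =>
        mem_span_of_onGen hone hxy hgen (Submodule.mem_span_pair.2 ⟨a, b, rfl⟩) h0 hgen')
        hv0 hvv hGv hvw).trans ?_
      rw [Nat.add_sub_cancel]
      nlinarith
  · have he : e * q ^ 3 + e * q < q ^ 5 := by
      have hq2 := hq.two_le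
      have h1 : e * q ^ 3 ≤ q * q ^ 3 := Nat.mul_le_mul_right _ (by omega)
      have h2 : e * q ≤ q * q := Nat.mul_le_mul_right _ (by omega)
      have h3 : q ^ 2 < q ^ 4 := Nat.pow_lt_pow_right hq2 (by norm_num)
      have h4 : 2 * q ^ 4 ≤ q * q ^ 4 := Nat.mul_le_mul_right _ hq2
      nlinarith
    nlinarith
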